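/- Estimate of the first commutator term (Lemma 3.2): let k₀ ≥ 5, T₀ > 0. Suppose f : [0,T₀] × ℝ³ → ℝ is nonnegative, with ‖f(t,·)‖_{L¹(ℝ³)} = 1 for all t and t ↦ ⟨·⟩^{k₀} f(t,·) continuous from [0,T₀] into L^{3/2}(ℝ³). Let w : [0,T₀] × ℝ³ → ℝ be such that w and all its v-derivatives are continuous in (t,v) and rapidly decaying in v uniformly in t. For T ∈ (0,T₀] define Int(I₁₂⁽¹⁾)(T) := −∫₀^T ∫_{ℝ³} (𝓜w)(t,v) Σ_{i=1}^{3} Tr( ∂_{v_i}A[f(t,·)](v) · Hess_v( ∂_{v_i}(𝓜²w) )(t,v) ) dv dt. Then for every ε₀ > 0 there exist t* ∈ (0,T₀] and C_{ε₀} > 0 such that for every T ∈ (0,t*]: Int(I₁₂⁽¹⁾)(T) ≤ ε₀ ∫₀^T ‖⟨·⟩^{−3/2} ∇(𝓜w)(t,·)‖²_{L²(ℝ³)} dt + C_{ε₀} ∫₀^T ‖(𝓜w)(t,·)‖²_{L²(ℝ³)} dt. -/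

import Mathlib

open MeasureTheory Set
open scoped ENNReal

noncomputable section

/-- The Japanese bracket `⟨v⟩ = (1+|v|²)^(1/2)` on `ℝ³`. -/
def jap (v : EuclideanSpace ℝ (Fin 3)) : ℝ := Real.sqrt (1 + ‖v‖ ^ 2)

/-- Partial derivative in the `i`-th coordinate direction. -/
def pd (i : Fin 3) (φ : EuclideanSpace ℝ (Fin 3) → ℝ) (v : EuclideanSpace ℝ (Fin 3)) : ℝ :=
  fderiv ℝ φ v (EuclideanSpace.single i 1)

/-- Iterated partial derivative along a list of coordinate directions (a multi-index). -/
def pdMany : List (Fin 3) → (EuclideanSpace ℝ (Fin 3) → ℝ) → EuclideanSpace ℝ (Fin 3) → ℝ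
  | [], φ => φ
  | i :: l, φ => pd i (pdMany l φ)

/-- The projection kernel `P(z) = Id − z⊗z/|z|²`. -/
def Pker (z : EuclideanSpace ℝ (Fin 3)) (i j : Fin 3) : ℝ :=
  (if i = j then (1 : ℝ) else 0) - z i * z j / ‖z‖ ^ 2

/-- The Landau matrix `A[h](v) = (1/(8π)) ∫ (P(v−z)/|v−z|) h(z) dz` (entry `(i,j)`). -/
def LandauA (h : EuclideanSpace ℝ (Fin 3) → ℝ) (v : EuclideanSpace ℝ (Fin 3)) (i j : Fin 3) : ℝ :=
  (1 / (8 * Real.pi)) * ∫ z, Pker (v - z) i j / ‖v - z‖ * h z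

/-- The Landau potential `a[h](v) = (1/(4π)) ∫ h(z)/|v−z| dz`. -/
def landaua (h : EuclideanSpace ℝ (Fin 3) → ℝ) (v : EuclideanSpace ℝ (Fin 3)) : ℝ :=
  (1 / (4 * Real.pi)) * ∫ z, h z / ‖v - z‖

/-- The Bessel potential operator `𝓜 = (I − Δ)⁻¹` via its integral kernel. -/
def besselM (h : EuclideanSpace ℝ (Fin 3) → ℝ) (v : EuclideanSpace ℝ (Fin 3)) : ℝ :=
  (1 / (4 * Real.pi)) * ∫ z, Real.exp (-‖v - z‖) / ‖v - z‖ * h z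

/-- Squared euclidean norm of the gradient. -/
def gradNormSq (φ : EuclideanSpace ℝ (Fin 3) → ℝ) (v : EuclideanSpace ℝ (Fin 3)) : ℝ :=
  ∑ i, (pd i φ v) ^ 2

/-- Euclidean norm of the gradient. -/
def gradNorm (φ : EuclideanSpace ℝ (Fin 3) → ℝ) (v : EuclideanSpace ℝ (Fin 3)) : ℝ :=
  Real.sqrt (gradNormSq φ v)

instance : Fact ((1 : ℝ≥0∞) ≤ 3 / 2) := ⟨by
  rw [ENNReal.le_div_iff_mul_le (by norm_num) (by norm_num)]
  norm_num⟩

/-- `w` together with all of its `v`-derivatives is continuous in `(t,v)` and rapidly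
decaying in `v`, uniformly in `t ∈ [0,T₀]`. -/
def NiceW (T₀ : ℝ) (w : ℝ → EuclideanSpace ℝ (Fin 3) → ℝ) : Prop :=
  (∀ l : List (Fin 3),
      Continuous fun p : ℝ × EuclideanSpace ℝ (Fin 3) => pdMany l (w p.1) p.2) ∧
  ∀ (l : List (Fin 3)) (n : ℕ), ∃ C : ℝ, ∀ t ∈ Icc (0 : ℝ) T₀, ∀ v,
    jap v ^ n * |pdMany l (w t) v| ≤ C

/-- `∫₀ᵀ ‖⟨·⟩^{−3/2} ∇(𝓜w)(t,·)‖²_{L²(ℝ³)} dt`. -/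
def dissT (w : ℝ → EuclideanSpace ℝ (Fin 3) → ℝ) (T : ℝ) : ℝ :=
  ∫ t in Ioo (0 : ℝ) T, ∫ v, jap v ^ (-(3 : ℝ)) * gradNormSq (besselM (w t)) v

/-- `∫₀ᵀ ‖(𝓜w)(t,·)‖²_{L²(ℝ³)} dt`. -/
def l2T (w : ℝ → EuclideanSpace ℝ (Fin 3) → ℝ) (T : ℝ) : ℝ :=
  ∫ t in Ioo (0 : ℝ) T, ∫ v, (besselM (w t) v) ^ 2

/-- `sup_{t ∈ [0,T]} ‖(𝓜w)(t,·)‖²_{L²(ℝ³)}`. -/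
def supT (w : ℝ → EuclideanSpace ℝ (Fin 3) → ℝ) (T : ℝ) : ℝ :=
  ⨆ t ∈ Icc (0 : ℝ) T, ∫ v, (besselM (w t) v) ^ 2

open scoped NNReal
set_option linter.unusedSectionVars false

/-- Three dimensional euclidean space. -/
abbrev E3 := EuclideanSpace ℝ (Fin 3)

lemma jap_sq (v : E3) : jap v ^ 2 = 1 + ‖v‖ ^ 2 := by
  unfold jap; rw [Real.sq_sqrt (by positivity)]

lemma one_le_jap (v : E3) : 1 ≤ jap v := by
  unfold jap
  rw [Real.one_le_sqrt]
  nlinarith [sq_nonneg ‖v‖]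

lemma jap_pos (v : E3) : 0 < jap v := lt_of_lt_of_le one_pos (one_le_jap v)

lemma norm_le_jap (v : E3) : ‖v‖ ≤ jap v := by
  apply Real.le_sqrt_of_sq_le; linarith

lemma jap_continuous : Continuous jap := by
  unfold jap; fun_prop

lemma norm_add_sq_le (a b : E3) : ‖a + b‖ ^ 2 ≤ 2 * ‖a‖ ^ 2 + 2 * ‖b‖ ^ 2 := by
  have h := norm_add_le a b
  have h0 := norm_nonneg (a + b)
  nlinarith [sq_nonneg (‖a‖ - ‖b‖), norm_nonneg a, norm_nonneg b]

lemma jap_add_le (v y : E3) (hy : ‖y‖ ≤ 1) : jap (v + y) ≤ 2 * jap v := by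
  have h := norm_add_sq_le v y
  have h2 : ‖y‖ ^ 2 ≤ 1 := by nlinarith [norm_nonneg y]
  have := jap_pos v
  refine (sq_le_sq₀ (jap_pos _).le (by positivity)).1 ?_
  rw [mul_pow, jap_sq, jap_sq]; nlinarith [sq_nonneg ‖v‖]

lemma jap_le_mul (v z : E3) : jap v ≤ 2 * (jap z * jap (v - z)) := by
  have h := norm_add_sq_le z (v - z)
  have h1 := jap_pos z
  have h2 := jap_pos (v - z)
  refine (sq_le_sq₀ (jap_pos _).le (by positivity)).1 ?_
  rw [mul_pow, mul_pow, jap_sq, jap_sq, jap_sq]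
  rw [add_sub_cancel] at h
  nlinarith [sq_nonneg ‖z‖, sq_nonneg ‖v - z‖, mul_nonneg (sq_nonneg ‖z‖) (sq_nonneg ‖v - z‖)]

lemma finrank_E3 : Module.finrank ℝ E3 = 3 := by simp

lemma integrable_jap4 : Integrable (fun v : E3 => (jap v ^ 4)⁻¹) := by
  have h := integrable_rpow_neg_one_add_norm_sq (E := E3) (μ := volume) (r := 4)
    (by rw [finrank_E3]; norm_num)
  refine h.congr (.of_forall fun v => ?_)
  have : jap v ^ 4 = (1 + ‖v‖ ^ 2) ^ 2 := by rw [← jap_sq]; ring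
  simp only [this]
  rw [show (-4 / 2 : ℝ) = -((2 : ℕ) : ℝ) by norm_num, Real.rpow_neg (by positivity),
    Real.rpow_natCast]

/-- The (unnormalised) Bessel kernel. -/
def bK (x : E3) : ℝ := Real.exp (-‖x‖) / ‖x‖
/-- The radial factor of the gradient of the Bessel kernel. -/
def bk (x : E3) : ℝ := -(Real.exp (-‖x‖) * (1 + ‖x‖) / ‖x‖ ^ 3)
/-- Dominating kernel. -/
def kb (x : E3) : ℝ := Real.exp (-‖x‖) * (1 / ‖x‖ + (1 + ‖x‖) / ‖x‖ ^ 2)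

lemma kb_nonneg (x : E3) : 0 ≤ kb x := by unfold kb; positivity
lemma bK_nonneg (x : E3) : 0 ≤ bK x := by unfold bK; positivity
lemma bK_le_kb (x : E3) : |bK x| ≤ kb x := by
  rw [abs_of_nonneg (bK_nonneg x)]
  unfold bK kb
  rw [div_eq_mul_one_div]
  gcongr
  have : 0 ≤ (1 + ‖x‖) / ‖x‖ ^ 2 := by positivity
  linarith
lemma bk_le_kb (x : E3) : |bk x| * ‖x‖ ≤ kb x := by
  unfold bk kb
  rw [abs_neg, abs_of_nonneg (by positivity)]
  rcases eq_or_ne x 0 with rfl | hx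
  · simp
  have hx : 0 < ‖x‖ := norm_pos_iff.2 hx
  have : Real.exp (-‖x‖) * (1 + ‖x‖) / ‖x‖ ^ 3 * ‖x‖ = Real.exp (-‖x‖) * ((1 + ‖x‖) / ‖x‖ ^ 2) := by
    field_simp
  rw [this]
  gcongr
  have : 0 ≤ 1 / ‖x‖ := by positivity
  linarith

lemma bK_meas : Measurable bK := by unfold bK; fun_prop
lemma bk_meas : Measurable bk := by unfold bk; fun_prop
lemma kb_meas : Measurable kb := by unfold kb; fun_prop

lemma integrable_kb_jap : Integrable (fun x : E3 => kb x * jap x ^ 4) := by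
  have h : Integrable (fun x : E3 => (fun r : ℝ => Real.exp (-r) * (1 / r + (1 + r) / r ^ 2)
      * (1 + r ^ 2) ^ 2) ‖x‖) := by
    refine (integrable_fun_norm_addHaar (E := E3) volume (f := fun r : ℝ =>
      Real.exp (-r) * (1 / r + (1 + r) / r ^ 2) * (1 + r ^ 2) ^ 2)).2 ?_
    rw [finrank_E3]
    have h2 : IntegrableOn (fun r : ℝ => ((2 * r + 1) * (1 + r ^ 2) ^ 2) * Real.exp (-r))
        (Ioi 0) := by
      apply integrable_of_isBigO_exp_neg (b := 1 / 2) (by norm_num)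
      · fun_prop
      · have h3 : ∀ n : ℕ, (fun r : ℝ => r ^ n) =o[Filter.atTop] fun r => Real.exp (1 / 2 * r) :=
          fun n => isLittleO_pow_exp_pos_mul_atTop n (by norm_num)
        have h4 : (fun r : ℝ => ((2 * r + 1) * (1 + r ^ 2) ^ 2)) =O[Filter.atTop]
            fun r => Real.exp (1 / 2 * r) := by
          have : (fun r : ℝ => ((2 * r + 1) * (1 + r ^ 2) ^ 2)) = fun r =>
            2 * r ^ 1 + r ^ 0 + 4 * r ^ 3 + 2 * r ^ 2 + 2 * r ^ 5 + r ^ 4 := by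
            ext r; ring
          rw [this]
          have c := fun n => (h3 n).isBigO
          exact ((((((c 1).const_mul_left 2).add (c 0)).add ((c 3).const_mul_left 4)).add
            ((c 2).const_mul_left 2)).add ((c 5).const_mul_left 2)).add (c 4)
        have h5 := h4.mul (Asymptotics.isBigO_refl (fun r : ℝ => Real.exp (-r)) Filter.atTop)
        refine h5.congr_right fun r => ?_
        rw [← Real.exp_add]; congr 1; ring
    refine h2.congr_fun (fun r hr => ?_) measurableSet_Ioi
    have hr : (0 : ℝ) < r := hr
    simp only [smul_eq_mul]
    norm_num
    field_simp
    ring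
  refine h.congr (.of_forall fun x => ?_)
  have : jap x ^ 4 = (1 + ‖x‖ ^ 2) ^ 2 := by rw [← jap_sq]; ring
  simp only [this, kb]

lemma integrable_kb : Integrable kb := by
  refine integrable_kb_jap.mono' kb_meas.aestronglyMeasurable (.of_forall fun x => ?_)
  rw [Real.norm_of_nonneg (kb_nonneg x)]
  exact le_mul_of_one_le_right (kb_nonneg x) (one_le_pow₀ (one_le_jap x))

/-- Continuous functions with decay of order four. -/
def Dec (C : ℝ) (φ : E3 → ℝ) : Prop := Continuous φ ∧ ∀ v, |φ v| ≤ C * (jap v ^ 4)⁻¹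

lemma jap4_inv_le_one (v : E3) : (jap v ^ 4)⁻¹ ≤ 1 := inv_le_one_of_one_le₀ (one_le_pow₀ (one_le_jap v))

lemma jap4_inv_pos (v : E3) : 0 < (jap v ^ 4)⁻¹ := by have := jap_pos v; positivity

lemma Dec.nonneg {C : ℝ} {φ : E3 → ℝ} (h : Dec C φ) : 0 ≤ C := by
  have h1 := (abs_nonneg _).trans (h.2 0)
  exact nonneg_of_mul_nonneg_left h1 (jap4_inv_pos 0)

lemma Dec.bdd {C : ℝ} {φ : E3 → ℝ} (h : Dec C φ) (v : E3) : |φ v| ≤ C :=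
  (h.2 v).trans (mul_le_of_le_one_right h.nonneg (jap4_inv_le_one v))

lemma Dec.integrable {C : ℝ} {φ : E3 → ℝ} (h : Dec C φ) : Integrable φ :=
  (integrable_jap4.const_mul C).mono' h.1.aestronglyMeasurable (.of_forall h.2)

/-- Convolution of `φ` with a vector valued kernel. -/
def cv {F : Type*} [NormedAddCommGroup F] [NormedSpace ℝ F] (κ : E3 → F) (φ : E3 → ℝ) (v : E3) : F :=
  ∫ z, φ z • κ (v - z)

section
variable {F : Type*} [NormedAddCommGroup F] [NormedSpace ℝ F]

lemma cv_eq (κ : E3 → F) (φ : E3 → ℝ) (v : E3) : cv κ φ v = ∫ x, φ (v - x) • κ x := by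
  unfold cv
  rw [← integral_sub_left_eq_self _ _ v]
  simp

lemma cv_integrable {κ : E3 → F} (hm : AEStronglyMeasurable κ volume) (hb : ∀ x, ‖κ x‖ ≤ kb x)
    {φ : E3 → ℝ} (hφ : AEStronglyMeasurable φ volume) {B : ℝ} (hB : ∀ v, |φ v| ≤ B) (v : E3) :
    Integrable (fun x => φ (v - x) • κ x) := by
  have hp : AEStronglyMeasurable (fun x => φ (v - x)) volume :=
    hφ.comp_measurePreserving (Measure.measurePreserving_sub_left volume v)
  refine (integrable_kb.const_mul B).mono' (hp.smul hm) (.of_forall fun x => ?_)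
  rw [norm_smul, Real.norm_eq_abs]
  exact mul_le_mul (hB _) (hb x) (norm_nonneg _) ((abs_nonneg _).trans (hB 0))

lemma cv_integrable' {κ : E3 → F} (hm : AEStronglyMeasurable κ volume) (hb : ∀ x, ‖κ x‖ ≤ kb x)
    {φ : E3 → ℝ} (hφ : AEStronglyMeasurable φ volume) {B : ℝ} (hB : ∀ v, |φ v| ≤ B) (v : E3) :
    Integrable (fun z => φ z • κ (v - z)) := by
  have := (cv_integrable hm hb hφ hB v).comp_sub_left v
  simpa using this

lemma cv_continuous {κ : E3 → F} (hm : AEStronglyMeasurable κ volume) (hb : ∀ x, ‖κ x‖ ≤ kb x)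
    {φ : E3 → ℝ} (hφ : Continuous φ) {B : ℝ} (hB : ∀ v, |φ v| ≤ B) : Continuous (cv κ φ) := by
  have : cv κ φ = fun v => ∫ x, φ (v - x) • κ x := funext (cv_eq κ φ)
  rw [this]
  refine continuous_of_dominated (bound := fun x => B * kb x) (fun v => ?_) (fun v => ?_)
    (integrable_kb.const_mul B) ?_
  · exact (cv_integrable hm hb hφ.aestronglyMeasurable hB v).aestronglyMeasurable
  · refine .of_forall fun x => ?_
    rw [norm_smul, Real.norm_eq_abs]
    exact mul_le_mul (hB _) (hb x) (norm_nonneg _) ((abs_nonneg _).trans (hB 0))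
  · refine .of_forall fun x => ?_
    fun_prop

/-- A universal constant. -/
def Ckb : ℝ := 16 * ∫ x, kb x * jap x ^ 4

lemma Ckb_nonneg : 0 ≤ Ckb := by
  unfold Ckb
  have : 0 ≤ ∫ x, kb x * jap x ^ 4 := integral_nonneg fun x =>
    mul_nonneg (kb_nonneg x) (pow_nonneg (jap_pos x).le _)
  positivity

lemma cv_decay {κ : E3 → F} (hb : ∀ x, ‖κ x‖ ≤ kb x)
    {φ : E3 → ℝ} {C : ℝ} (h : Dec C φ) (v : E3) : ‖cv κ φ v‖ ≤ Ckb * C * (jap v ^ 4)⁻¹ := by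
  rw [cv_eq]
  have h1 : ‖∫ x, φ (v - x) • κ x‖ ≤ ∫ x, (16 * C * (jap v ^ 4)⁻¹) * (kb x * jap x ^ 4) := by
    refine norm_integral_le_of_norm_le (integrable_kb_jap.const_mul _) (.of_forall fun x => ?_)
    rw [norm_smul, Real.norm_eq_abs]
    have h2 := h.2 (v - x)
    have h3 := jap_le_mul v x
    have p1 := jap_pos v
    have p2 := jap_pos x
    have p3 := jap_pos (v - x)
    have h4 : jap v ^ 4 ≤ 16 * (jap x ^ 4 * jap (v - x) ^ 4) := by
      have := pow_le_pow_left₀ p1.le h3 4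
      refine this.trans (le_of_eq ?_); ring
    have h5 : (jap (v - x) ^ 4)⁻¹ ≤ 16 * (jap v ^ 4)⁻¹ * jap x ^ 4 := by
      rw [inv_le_iff_one_le_mul₀ (by positivity)]
      rw [show 16 * (jap v ^ 4)⁻¹ * jap x ^ 4 * jap (v - x) ^ 4 =
        (16 * (jap x ^ 4 * jap (v - x) ^ 4)) / jap v ^ 4 by field_simp]
      rwa [one_le_div (by positivity)]
    have hC := h.nonneg
    calc |φ (v - x)| * ‖κ x‖ ≤ (C * (16 * (jap v ^ 4)⁻¹ * jap x ^ 4)) * kb x := by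
          refine mul_le_mul (h2.trans ?_) (hb x) (norm_nonneg _) (by positivity)
          gcongr
      _ = _ := by ring
  refine h1.trans (le_of_eq ?_)
  rw [integral_const_mul, Ckb]; ring

lemma L1_tendsto {κ : E3 → F} (hm : AEStronglyMeasurable κ volume) (hb : ∀ x, ‖κ x‖ ≤ kb x)
    {κn : ℕ → E3 → F} (hmn : ∀ n, AEStronglyMeasurable (κn n) volume)
    (hbn : ∀ n x, x ≠ 0 → ‖κn n x‖ ≤ kb x)
    (hlim : ∀ x, x ≠ 0 → Filter.Tendsto (fun n => κn n x) Filter.atTop (nhds (κ x))) :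
    Filter.Tendsto (fun n => ∫ x, ‖κn n x - κ x‖) Filter.atTop (nhds 0) := by
  have h0 : ∀ᵐ x : E3, x ≠ 0 := by
    simp [ae_iff]
  have := tendsto_integral_of_dominated_convergence (μ := (volume : Measure E3))
    (F := fun n x => ‖κn n x - κ x‖) (f := fun _ => (0:ℝ))
    (fun x => 2 * kb x) (fun n => ((hmn n).sub hm).norm) (integrable_kb.const_mul 2)
    (fun n => h0.mono fun x hx => ?_) (h0.mono fun x hx => ?_)
  · simpa using this
  · rw [norm_norm]
    refine (norm_sub_le _ _).trans ?_
    linarith [hbn n x hx, hb x]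
  · exact tendsto_iff_norm_sub_tendsto_zero.1 (hlim x hx)

lemma cv_sub_le {κ κ' : E3 → F} (hb : Integrable κ)
    (hb' : Integrable κ')
    {φ : E3 → ℝ} (hφ : AEStronglyMeasurable φ volume) {B : ℝ} (hB : ∀ v, |φ v| ≤ B) (v : E3) :
    ‖cv κ φ v - cv κ' φ v‖ ≤ B * ∫ x, ‖κ x - κ' x‖ := by
  have hp : AEStronglyMeasurable (fun x => φ (v - x)) volume :=
    hφ.comp_measurePreserving (Measure.measurePreserving_sub_left volume v)
  have hi : ∀ κ : E3 → F, Integrable κ → Integrable fun x => φ (v - x) • κ x := by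
    intro κ hκ
    refine (hκ.norm.const_mul B).mono' (hp.smul hκ.1) (.of_forall fun x => ?_)
    rw [norm_smul, Real.norm_eq_abs]
    exact mul_le_mul_of_nonneg_right (hB _) (norm_nonneg _)
  rw [cv_eq, cv_eq, ← integral_sub (hi _ hb) (hi _ hb')]
  rw [← integral_const_mul]
  refine norm_integral_le_of_norm_le ((hb.sub hb').norm.const_mul B) (.of_forall fun x => ?_)
  rw [← smul_sub, norm_smul, Real.norm_eq_abs]
  exact mul_le_mul_of_nonneg_right (hB _) (norm_nonneg _)
end

/-- Fréchet derivative of the Bessel kernel. -/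
def dK (x : E3) : E3 →L[ℝ] ℝ := bk x • innerSL ℝ x

lemma dK_norm (x : E3) : ‖dK x‖ ≤ kb x := by
  unfold dK
  rw [norm_smul, innerSL_apply_norm, Real.norm_eq_abs]
  exact bk_le_kb x

lemma dK_meas : AEStronglyMeasurable dK (volume : Measure E3) := by
  unfold dK
  exact bk_meas.aestronglyMeasurable.smul (innerSL ℝ (E := E3)).continuous.aestronglyMeasurable

/-- regularised radius -/
def rho (n : ℕ) (x : E3) : ℝ := Real.sqrt (‖x‖ ^ 2 + (1 / ((n : ℝ) + 1)) ^ 2)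
/-- regularised kernel -/
def Kn (n : ℕ) (x : E3) : ℝ := Real.exp (-rho n x) / rho n x
/-- derivative of the regularised kernel -/
def dKn (n : ℕ) (x : E3) : E3 →L[ℝ] ℝ :=
  (-(Real.exp (-rho n x) * (1 + rho n x) / rho n x ^ 3)) • innerSL ℝ x

lemma rho_pos (n : ℕ) (x : E3) : 0 < rho n x := by unfold rho; positivity
lemma rho_cont (n : ℕ) : Continuous (rho n) := by unfold rho; fun_prop
lemma norm_le_rho (n : ℕ) (x : E3) : ‖x‖ ≤ rho n x := by
  apply Real.le_sqrt_of_sq_le; linarith [sq_nonneg (1 / ((n : ℝ) + 1))]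
lemma eps_le_rho (n : ℕ) (x : E3) : 1 / ((n : ℝ) + 1) ≤ rho n x := by
  apply Real.le_sqrt_of_sq_le; linarith [sq_nonneg ‖x‖]

lemma Kn_hasFDerivAt (n : ℕ) (x : E3) : HasFDerivAt (Kn n) (dKn n x) x := by
  have hq : HasFDerivAt (fun x : E3 => ‖x‖ ^ 2 + (1 / ((n : ℝ) + 1)) ^ 2)
      (2 • innerSL ℝ x) x := (hasStrictFDerivAt_norm_sq x).hasFDerivAt.add_const _
  have hp : 0 < ‖x‖ ^ 2 + (1 / ((n : ℝ) + 1)) ^ 2 := by positivity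
  have hs := hq.sqrt hp.ne'
  have hr : HasFDerivAt (rho n) ((1 / rho n x) • innerSL ℝ x) x := by
    refine hs.congr_fderiv ?_
    ext y
    simp [rho]
    field_simp
  have hρ := rho_pos n x
  have hd : HasDerivAt (fun s : ℝ => Real.exp (-s) / s)
      ((-(Real.exp (-rho n x)) * rho n x - Real.exp (-rho n x) * 1) / rho n x ^ 2) (rho n x) := by
    have := ((hasDerivAt_neg (rho n x)).exp).div (hasDerivAt_id (rho n x)) hρ.ne'
    refine this.congr_deriv ?_
    simp
  have := hd.comp_hasFDerivAt x hr
  refine this.congr_fderiv ?_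
  ext y
  simp [dKn]
  field_simp
  ring

lemma exp_mul_le {r s : ℝ} (hr : 0 ≤ r) (hrs : r ≤ s) :
    Real.exp (-s) * (1 + s) ≤ Real.exp (-r) * (1 + r) := by
  have h1 : Real.exp (-r) = Real.exp (-s) * Real.exp (s - r) := by
    rw [← Real.exp_add]; congr 1; ring
  rw [h1, mul_assoc]
  refine mul_le_mul_of_nonneg_left ?_ (Real.exp_pos _).le
  nlinarith [Real.add_one_le_exp (s - r)]

lemma dKn_norm_le (n : ℕ) (x : E3) :
    ‖dKn n x‖ ≤ Real.exp (-rho n x) * (1 + rho n x) / rho n x ^ 2 := by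
  have hρ := rho_pos n x
  unfold dKn
  rw [norm_smul, innerSL_apply_norm, Real.norm_eq_abs, abs_neg, abs_of_nonneg (by positivity)]
  calc _ ≤ Real.exp (-rho n x) * (1 + rho n x) / rho n x ^ 3 * rho n x := by
        gcongr; exact norm_le_rho n x
    _ = _ := by field_simp

lemma dKn_bdd (n : ℕ) (x : E3) : ‖dKn n x‖ ≤ ((n : ℝ) + 1) ^ 2 := by
  have hρ := rho_pos n x
  refine (dKn_norm_le n x).trans ?_
  have h1 := exp_mul_le le_rfl hρ.le
  simp at h1
  have h2 := eps_le_rho n x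
  have h3 : 1 ≤ rho n x * ((n : ℝ) + 1) := by
    rwa [div_le_iff₀ (by positivity)] at h2
  rw [div_le_iff₀ (by positivity), ← mul_pow]
  refine h1.trans (one_le_pow₀ ?_)
  linarith

lemma dKn_le_kb (n : ℕ) (x : E3) (hx : x ≠ 0) : ‖dKn n x‖ ≤ kb x := by
  have hx' : 0 < ‖x‖ := norm_pos_iff.2 hx
  refine (dKn_norm_le n x).trans ?_
  have h1 := exp_mul_le hx'.le (norm_le_rho n x)
  calc _ ≤ Real.exp (-‖x‖) * (1 + ‖x‖) / ‖x‖ ^ 2 := by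
        gcongr; exact norm_le_rho n x
    _ ≤ kb x := by
        unfold kb
        rw [mul_div_assoc]
        gcongr
        have : 0 ≤ 1 / ‖x‖ := by positivity
        linarith

lemma Kn_bdd (n : ℕ) (x : E3) : ‖Kn n x‖ ≤ (n : ℝ) + 1 := by
  have hρ := rho_pos n x
  unfold Kn
  rw [Real.norm_of_nonneg (by positivity)]
  have h2 := eps_le_rho n x
  have h3 : 1 ≤ rho n x * ((n : ℝ) + 1) := by
    rwa [div_le_iff₀ (by positivity)] at h2
  rw [div_le_iff₀ (by positivity)]
  have : Real.exp (-rho n x) ≤ 1 := by simp [hρ.le]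
  linarith

lemma Kn_le_kb (n : ℕ) (x : E3) (hx : x ≠ 0) : ‖Kn n x‖ ≤ kb x := by
  have hρ := rho_pos n x
  have hx' : 0 < ‖x‖ := norm_pos_iff.2 hx
  have h := norm_le_rho n x
  refine le_trans ?_ ((le_abs_self _).trans (bK_le_kb x))
  unfold Kn bK
  rw [Real.norm_of_nonneg (by positivity)]
  gcongr

lemma Kn_cont (n : ℕ) : Continuous (Kn n) := by
  unfold Kn
  have := rho_cont n
  fun_prop (disch := exact fun x => (rho_pos n x).ne')

lemma dKn_cont (n : ℕ) : Continuous (dKn n) := by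
  unfold dKn
  have := rho_cont n
  have h2 := (innerSL ℝ (E := E3)).continuous
  have h3 : ∀ x, rho n x ^ 3 ≠ 0 := fun x => (pow_pos (rho_pos n x) 3).ne'
  have h4 : Continuous fun x => (-(Real.exp (-rho n x) * (1 + rho n x) / rho n x ^ 3)) := by
    fun_prop (disch := assumption)
  exact h4.smul h2

lemma rho_tendsto (x : E3) : Filter.Tendsto (fun n => rho n x) Filter.atTop (nhds ‖x‖) := by
  unfold rho
  have h := (tendsto_one_div_add_atTop_nhds_zero_nat (𝕜 := ℝ)).pow 2
  have h2 := (h.const_add (‖x‖ ^ 2)).sqrt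
  simpa using h2

lemma Kn_tendsto (x : E3) (hx : x ≠ 0) :
    Filter.Tendsto (fun n => Kn n x) Filter.atTop (nhds (bK x)) := by
  have h := rho_tendsto x
  have hx' : ‖x‖ ≠ 0 := norm_ne_zero_iff.2 hx
  exact ((Real.continuous_exp.tendsto _).comp h.neg).div h hx'

lemma dKn_tendsto (x : E3) (hx : x ≠ 0) :
    Filter.Tendsto (fun n => dKn n x) Filter.atTop (nhds (dK x)) := by
  have h := rho_tendsto x
  have hx' : ‖x‖ ≠ 0 := norm_ne_zero_iff.2 hx
  have := ((((Real.continuous_exp.tendsto _).comp h.neg).mul (h.const_add 1)).div (h.pow 3)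
    (pow_ne_zero 3 hx')).neg
  exact Filter.Tendsto.smul this (tendsto_const_nhds (x := (innerSL ℝ x : E3 →L[ℝ] ℝ)))

lemma bK_norm (x : E3) : ‖bK x‖ ≤ kb x := bK_le_kb x

lemma integrable_of_le_kb {F : Type*} [NormedAddCommGroup F] {κ : E3 → F}
    (hm : AEStronglyMeasurable κ volume) (hb : ∀ x, x ≠ 0 → ‖κ x‖ ≤ kb x) : Integrable κ := by
  have h0 : ∀ᵐ x : E3, x ≠ 0 := by
    simp [ae_iff]
  exact integrable_kb.mono' hm (h0.mono hb)

lemma cv_hasFDerivAt {φ : E3 → ℝ} (hi : Integrable φ) {B : ℝ} (hB : ∀ v, |φ v| ≤ B) (v : E3) :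
    HasFDerivAt (cv bK φ) (cv dK φ v) v := by
  have hφ := hi.1
  have hB0 : 0 ≤ B := (abs_nonneg _).trans (hB 0)
  have iK : Integrable bK := integrable_of_le_kb bK_meas.aestronglyMeasurable fun x _ => bK_norm x
  have idK : Integrable dK := integrable_of_le_kb dK_meas fun x _ => dK_norm x
  have iKn : ∀ n, Integrable (Kn n) := fun n =>
    integrable_of_le_kb (Kn_cont n).aestronglyMeasurable (Kn_le_kb n)
  have idKn : ∀ n, Integrable (dKn n) := fun n =>
    integrable_of_le_kb (dKn_cont n).aestronglyMeasurable (dKn_le_kb n)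
  have t1 := (L1_tendsto bK_meas.aestronglyMeasurable bK_norm
    (fun n => (Kn_cont n).aestronglyMeasurable) Kn_le_kb Kn_tendsto).const_mul B
  have t2 := (L1_tendsto dK_meas dK_norm
    (fun n => (dKn_cont n).aestronglyMeasurable) dKn_le_kb dKn_tendsto).const_mul B
  rw [mul_zero] at t1 t2
  refine hasFDerivAt_of_tendstoUniformly (f := fun n => cv (Kn n) φ) (f' := fun n => cv (dKn n) φ)
    (l := Filter.atTop) ?_ ?_ ?_ v
  · rw [Metric.tendstoUniformly_iff]
    intro ε hε
    filter_upwards [t2.eventually (gt_mem_nhds hε)] with n hn x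
    rw [dist_comm, dist_eq_norm]
    exact (cv_sub_le (idKn n) idK hφ hB x).trans_lt hn
  · intro n x
    refine hasFDerivAt_integral_of_dominated_of_fderiv_le (𝕜 := ℝ) (s := univ)
      (F := fun v z => φ z • Kn n (v - z)) (F' := fun v z => φ z • dKn n (v - z)) Filter.univ_mem
      (bound := fun z => |φ z| * ((n : ℝ) + 1) ^ 2) ?_ ?_ ?_ ?_ ?_ ?_
    · refine .of_forall fun v => ?_
      have : Continuous fun z => Kn n (v - z) := (Kn_cont n).comp (by fun_prop)
      exact hφ.smul this.aestronglyMeasurable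
    · have : Continuous fun z => Kn n (x - z) := (Kn_cont n).comp (by fun_prop)
      refine (hi.norm.mul_const ((n : ℝ) + 1)).mono' (hφ.smul this.aestronglyMeasurable)
        (.of_forall fun z => ?_)
      rw [norm_smul]
      gcongr
      exact Kn_bdd _ _
    · have : Continuous fun z => dKn n (x - z) := (dKn_cont n).comp (by fun_prop)
      exact hφ.smul this.aestronglyMeasurable
    · refine .of_forall fun z y _ => ?_
      rw [norm_smul, Real.norm_eq_abs]
      gcongr
      exact dKn_bdd _ _
    · exact hi.norm.mul_const _
    · refine .of_forall fun z y _ => ?_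
      have h1 : HasFDerivAt (fun y => Kn n (y - z)) (dKn n (y - z)) y :=
        (hasFDerivAt_comp_sub z).2 (Kn_hasFDerivAt n (y - z))
      exact HasFDerivAt.const_smul (𝕜 := ℝ) h1 (φ z)
  · intro x
    rw [tendsto_iff_norm_sub_tendsto_zero]
    exact squeeze_zero (fun n => norm_nonneg _)
      (fun n => cv_sub_le (iKn n) iK hφ hB x) t1

/-- C¹ functions decaying, with derivative, of order four. -/
def Dec1 (C : ℝ) (φ : E3 → ℝ) : Prop :=
  ContDiff ℝ 1 φ ∧ (∀ v, |φ v| ≤ C * (jap v ^ 4)⁻¹) ∧ ∀ v, ‖fderiv ℝ φ v‖ ≤ C * (jap v ^ 4)⁻¹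

lemma Dec1.dec {C : ℝ} {φ : E3 → ℝ} (h : Dec1 C φ) : Dec C φ := ⟨h.1.continuous, h.2.1⟩

lemma norm_e (i : Fin 3) : ‖(EuclideanSpace.single i (1:ℝ) : E3)‖ = 1 := by simp

lemma abs_pd_le (i : Fin 3) (φ : E3 → ℝ) (v : E3) : |pd i φ v| ≤ ‖fderiv ℝ φ v‖ := by
  unfold pd
  have := (fderiv ℝ φ v).le_opNorm (EuclideanSpace.single i (1:ℝ))
  rwa [norm_e, mul_one] at this

lemma Dec1.pd_dec {C : ℝ} {φ : E3 → ℝ} (h : Dec1 C φ) (i : Fin 3) : Dec C (pd i φ) := by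
  refine ⟨?_, fun v => (abs_pd_le i φ v).trans (h.2.2 v)⟩
  have := h.1.continuous_fderiv one_ne_zero
  unfold pd
  fun_prop

lemma Dec1.hasFDerivAt {C : ℝ} {φ : E3 → ℝ} (h : Dec1 C φ) (v : E3) :
    HasFDerivAt φ (fderiv ℝ φ v) v := (h.1.differentiable one_ne_zero v).hasFDerivAt

lemma cv_fderiv {C : ℝ} {φ : E3 → ℝ} (h : Dec C φ) (v : E3) :
    fderiv ℝ (cv bK φ) v = cv dK φ v := (cv_hasFDerivAt h.integrable h.bdd v).fderiv

lemma cv_dec1 {C : ℝ} {φ : E3 → ℝ} (h : Dec C φ) : Dec1 (Ckb * C) (cv bK φ) := by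
  refine ⟨?_, fun v => cv_decay bK_norm h v, fun v => ?_⟩
  · rw [contDiff_one_iff_fderiv]
    refine ⟨fun v => (cv_hasFDerivAt h.integrable h.bdd v).differentiableAt, ?_⟩
    rw [funext (cv_fderiv h)]
    exact cv_continuous dK_meas dK_norm h.1 h.bdd
  · rw [cv_fderiv h]; exact cv_decay dK_norm h v

lemma cv_fderiv_apply {C : ℝ} {φ : E3 → ℝ} (h : Dec C φ) (v y : E3) :
    fderiv ℝ (cv bK φ) v y = ∫ z, φ z * (bk (v - z) * inner ℝ (v - z) y) := by
  rw [cv_fderiv h, cv, ContinuousLinearMap.integral_apply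
    (cv_integrable' dK_meas dK_norm h.1.aestronglyMeasurable h.bdd v)]
  simp [dK, inner_sub_left]

lemma pd_cv {C : ℝ} {g : E3 → ℝ} (h : Dec1 C g) (i : Fin 3) (v : E3) :
    pd i (cv bK g) v = cv bK (pd i g) v := by
  have h1 : HasFDerivAt (fun v => ∫ x, g (v - x) • bK x) (∫ x, bK x • fderiv ℝ g (v - x)) v := by
    have hc := h.1.continuous_fderiv one_ne_zero
    refine hasFDerivAt_integral_of_dominated_of_fderiv_le (𝕜 := ℝ) (s := univ) Filter.univ_mem
      (F := fun v x => g (v - x) • bK x) (F' := fun v x => bK x • fderiv ℝ g (v - x))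
      (bound := fun x => C * kb x) ?_ ?_ ?_ ?_ ?_ ?_
    · exact .of_forall fun v => (cv_integrable bK_meas.aestronglyMeasurable bK_norm
        h.1.continuous.aestronglyMeasurable h.dec.bdd v).1
    · exact cv_integrable bK_meas.aestronglyMeasurable bK_norm
        h.1.continuous.aestronglyMeasurable h.dec.bdd v
    · refine bK_meas.aestronglyMeasurable.smul (Continuous.aestronglyMeasurable ?_)
      fun_prop
    · refine .of_forall fun x y _ => ?_
      rw [norm_smul, mul_comm]
      refine mul_le_mul ?_ (bK_norm x) (norm_nonneg _) h.dec.nonneg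
      exact (h.2.2 _).trans (mul_le_of_le_one_right h.dec.nonneg (jap4_inv_le_one _))
    · exact integrable_kb.const_mul C
    · refine .of_forall fun x y _ => ?_
      have h1 : HasFDerivAt (fun y => g (y - x)) (fderiv ℝ g (y - x)) y :=
        (hasFDerivAt_comp_sub x).2 (h.hasFDerivAt (y - x))
      have h2 := HasFDerivAt.const_smul (𝕜 := ℝ) h1 (bK x)
      simp only [smul_eq_mul, mul_comm (g _)]
      exact h2
  have h2 : (fun v => ∫ x, g (v - x) • bK x) = cv bK g := (funext (cv_eq bK g)).symm
  rw [h2] at h1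
  have h3 : Integrable (fun x => bK x • fderiv ℝ g (v - x)) := by
    have hc := h.1.continuous_fderiv one_ne_zero
    refine (integrable_kb.const_mul C).mono' ?_ (.of_forall fun x => ?_)
    · refine bK_meas.aestronglyMeasurable.smul (Continuous.aestronglyMeasurable ?_)
      fun_prop
    · rw [norm_smul, mul_comm]
      refine mul_le_mul ?_ (bK_norm x) (norm_nonneg _) h.dec.nonneg
      exact (h.2.2 _).trans (mul_le_of_le_one_right h.dec.nonneg (jap4_inv_le_one _))
  rw [pd, h1.fderiv, ContinuousLinearMap.integral_apply h3, cv_eq]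
  simp [pd, mul_comm]

lemma cv_translate {F : Type*} [NormedAddCommGroup F] [NormedSpace ℝ F] (κ : E3 → F) (φ : E3 → ℝ)
    (y v : E3) : cv κ (fun z => φ (z + y)) v = cv κ φ (v + y) := by
  rw [cv_eq, cv_eq]
  congr 1; ext x; rw [sub_add_eq_add_sub]

lemma inner_eq_sum (L : E3 →L[ℝ] ℝ) (x : E3) :
    L x = ∑ i, L (EuclideanSpace.single i 1) * x i := by
  conv_lhs => rw [← (EuclideanSpace.basisFun (Fin 3) ℝ).sum_repr x]
  simp [mul_comm]

/-! polar coordinates -/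

lemma polar_1d {ψ ψ' : ℝ → ℝ} (hd : ∀ r, HasDerivAt ψ (ψ' r) r) (hc : Continuous ψ')
    {B : ℝ} (h1 : ∀ r, |ψ r| ≤ B) (h2 : ∀ r, |ψ' r| ≤ B) :
    ∫ r in Ioi (0:ℝ), (r * Real.exp (-r) * ψ r - (1 + r) * Real.exp (-r) * ψ' r) = ψ 0 := by
  have hψc : Continuous ψ := continuous_iff_continuousAt.2 fun r => (hd r).continuousAt
  have hB : 0 ≤ B := (abs_nonneg _).trans (h1 0)
  have hder : ∀ r, HasDerivAt (fun r => -((1 + r) * Real.exp (-r) * ψ r))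
      (r * Real.exp (-r) * ψ r - (1 + r) * Real.exp (-r) * ψ' r) r := by
    intro r
    have e : HasDerivAt (fun r => Real.exp (-r)) (Real.exp (-r) * (-1)) r :=
      (hasDerivAt_neg r).exp
    have a : HasDerivAt (fun r : ℝ => 1 + r) 1 r := (hasDerivAt_id r).const_add 1
    refine ((a.mul e).mul (hd r)).neg.congr_deriv ?_
    simp only [Pi.mul_apply]
    ring
  have hIntg0 : IntegrableOn (fun r : ℝ => (1 + 2 * r) * Real.exp (-r) * B) (Ioi 0) := by
    refine Integrable.mul_const ?_ B
    apply integrable_of_isBigO_exp_neg (b := 1 / 2) (by norm_num)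
    · fun_prop
    · have h3 : ∀ n : ℕ, (fun r : ℝ => r ^ n) =o[Filter.atTop] fun r => Real.exp (1 / 2 * r) :=
        fun n => isLittleO_pow_exp_pos_mul_atTop n (by norm_num)
      have h4 : (fun r : ℝ => 1 + 2 * r) =O[Filter.atTop] fun r => Real.exp (1 / 2 * r) := by
        have : (fun r : ℝ => 1 + 2 * r) = fun r => r ^ 0 + 2 * r ^ 1 := by ext r; ring
        rw [this]
        exact (h3 0).isBigO.add ((h3 1).isBigO.const_mul_left 2)
      have h5 := h4.mul (Asymptotics.isBigO_refl (fun r : ℝ => Real.exp (-r)) Filter.atTop)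
      refine h5.congr_right fun r => ?_
      rw [← Real.exp_add]; congr 1; ring
  have hIntg : IntegrableOn (fun r => r * Real.exp (-r) * ψ r - (1 + r) * Real.exp (-r) * ψ' r)
      (Ioi 0) := by
    refine Integrable.mono' hIntg0 (Continuous.aestronglyMeasurable (by fun_prop)) ?_
    refine (ae_restrict_mem measurableSet_Ioi).mono fun r hr => ?_
    have hr : (0:ℝ) < r := hr
    refine (norm_sub_le _ _).trans ?_
    rw [norm_mul, norm_mul _ (ψ' r), Real.norm_of_nonneg (by positivity),
      Real.norm_of_nonneg (by positivity : 0 ≤ (1 + r) * Real.exp (-r)), Real.norm_eq_abs,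
      Real.norm_eq_abs]
    have e := Real.exp_pos (-r)
    calc _ ≤ r * Real.exp (-r) * B + (1 + r) * Real.exp (-r) * B := by
          gcongr
          · exact h1 r
          · exact h2 r
      _ = _ := by ring
  have hlim : Filter.Tendsto (fun r => -((1 + r) * Real.exp (-r) * ψ r)) Filter.atTop (nhds 0) := by
    have t1 := Real.tendsto_pow_mul_exp_neg_atTop_nhds_zero 0
    have t2 := Real.tendsto_pow_mul_exp_neg_atTop_nhds_zero 1
    have t3 := (t1.add t2).mul_const B
    simp only [add_zero, zero_mul] at t3
    refine squeeze_zero_norm' ?_ t3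
    filter_upwards [Filter.eventually_ge_atTop 0] with r hr
    rw [norm_neg, norm_mul, Real.norm_of_nonneg (by positivity), Real.norm_eq_abs]
    have e := Real.exp_pos (-r)
    calc _ ≤ (1 + r) * Real.exp (-r) * B := by
          gcongr; exact h1 r
      _ = _ := by ring
  have := integral_Ioi_of_hasDerivAt_of_tendsto' (a := 0) (fun r _ => hder r) hIntg hlim
  rw [this]; simp

/-- The sphere area. -/
def S2 : ℝ := (volume : Measure E3).toSphere.real univ

lemma integral_polar {G : E3 → ℝ} (hG : Integrable G) :
    ∫ x, G x = ∫ s : Metric.sphere (0:E3) 1, ∫ r in Ioi (0:ℝ), r ^ 2 * G (r • (s : E3))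
      ∂volume ∂(volume : Measure E3).toSphere := by
  have hmp := (volume : Measure E3).measurePreserving_homeomorphUnitSphereProd
  have hme := (homeomorphUnitSphereProd E3).measurableEmbedding
  have e1 : ∫ x, G x = ∫ x : ({(0)}ᶜ : Set E3), G x ∂((volume : Measure E3).comap (↑)) := by
    rw [integral_subtype_comap (measurableSet_singleton _).compl fun x ↦ G x,
        restrict_compl_singleton]
  have e2 : ∫ x : ({(0)}ᶜ : Set E3), G x ∂((volume : Measure E3).comap (↑)) =
      ∫ p, G (p.2.1 • (p.1 : E3)) ∂(volume : Measure E3).toSphere.prod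
        (.volumeIoiPow (Module.finrank ℝ E3 - 1)) := by
    rw [← hmp.integral_comp hme]
    congr 1; ext x
    have := congrArg Subtype.val ((homeomorphUnitSphereProd E3).symm_apply_apply x)
    simp only [homeomorphUnitSphereProd_symm_apply_coe] at this
    rw [this]
  have i2 : Integrable (fun p : Metric.sphere (0:E3) 1 × Ioi (0:ℝ) => G (p.2.1 • (p.1 : E3)))
      ((volume : Measure E3).toSphere.prod (.volumeIoiPow (Module.finrank ℝ E3 - 1))) := by
    rw [← hmp.integrable_comp_emb hme]
    have : (fun p : Metric.sphere (0:E3) 1 × Ioi (0:ℝ) => G (p.2.1 • (p.1 : E3))) ∘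
      (homeomorphUnitSphereProd E3) = G ∘ Subtype.val := by
      ext x
      have := congrArg Subtype.val ((homeomorphUnitSphereProd E3).symm_apply_apply x)
      simp only [homeomorphUnitSphereProd_symm_apply_coe] at this
      simp only [Function.comp_apply]
      rw [this]
    rw [this, ← integrableOn_iff_comap_subtypeVal (measurableSet_singleton _).compl]
    exact hG.integrableOn
  rw [e1, e2, integral_prod _ i2]
  congr 1; ext s
  rw [finrank_E3]
  simp only [Measure.volumeIoiPow, ENNReal.ofReal]
  rw [integral_withDensity_eq_integral_smul]
  · rw [integral_subtype_comap measurableSet_Ioi fun a : ℝ ↦ Real.toNNReal (a ^ (3 - 1)) • G (a • (s:E3))]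
    refine setIntegral_congr_fun measurableSet_Ioi fun x hx ↦ ?_
    simp only [NNReal.smul_def]
    rw [Real.coe_toNNReal _ (pow_nonneg hx.out.le _)]
    norm_num
  · exact (measurable_subtype_coe.pow_const _).real_toNNReal

lemma kernel_identity {C : ℝ} {ζ : E3 → ℝ} (h : Dec1 C ζ) :
    ∫ x, (bk x * fderiv ℝ ζ x x + bK x * ζ x) = S2 * ζ 0 := by
  have hC := h.dec.nonneg
  have hc := h.1.continuous_fderiv one_ne_zero
  have hb1 : ∀ v, |ζ v| ≤ C := h.dec.bdd
  have hb2 : ∀ v, ‖fderiv ℝ ζ v‖ ≤ C := fun v =>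
    (h.2.2 _).trans (mul_le_of_le_one_right hC (jap4_inv_le_one _))
  have hi : Integrable fun x => (bk x * fderiv ℝ ζ x x + bK x * ζ x) := by
    refine (integrable_kb.const_mul (2 * C)).mono' ?_ (.of_forall fun x => ?_)
    · refine ((bk_meas.aestronglyMeasurable.mul (Continuous.aestronglyMeasurable ?_)).add
        (bK_meas.aestronglyMeasurable.mul h.1.continuous.aestronglyMeasurable))
      fun_prop
    · refine (norm_add_le _ _).trans ?_
      rw [norm_mul, norm_mul, Real.norm_eq_abs, Real.norm_eq_abs (ζ x)]
      have a1 := (fderiv ℝ ζ x).le_opNorm x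
      have a2 := bk_le_kb x
      have a3 := bK_norm x
      have a4 := hb1 x
      have a5 := hb2 x
      have a6 := kb_nonneg x
      calc _ ≤ |bk x| * (C * ‖x‖) + kb x * C := by
            gcongr
            exact a1.trans (by gcongr)
        _ ≤ _ := by nlinarith
  rw [integral_polar hi]
  have key : ∀ s : Metric.sphere (0:E3) 1, ∫ r in Ioi (0:ℝ), r ^ 2 *
      (bk (r • (s : E3)) * fderiv ℝ ζ (r • (s : E3)) (r • (s : E3)) + bK (r • (s : E3)) * ζ (r • (s : E3)))
      = ζ 0 := by
    intro s
    have hs : ‖(s : E3)‖ = 1 := by simp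
    have hd : ∀ r : ℝ, HasDerivAt (fun r : ℝ => ζ (r • (s : E3))) (fderiv ℝ ζ (r • (s : E3)) (s : E3)) r := by
      intro r
      have e : HasDerivAt (fun r : ℝ => r • (s : E3)) (s : E3) r := by
        simpa using (hasDerivAt_id r).smul_const (s : E3)
      exact (h.hasFDerivAt (r • (s : E3))).comp_hasDerivAt r e
    have := polar_1d hd (by fun_prop) (B := C) (fun r => hb1 _) (fun r => by
      have := (fderiv ℝ ζ (r • (s : E3))).le_opNorm (s : E3)
      rw [hs, mul_one] at this
      exact this.trans (hb2 _))
    simp only [zero_smul] at this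
    rw [← this]
    refine setIntegral_congr_fun measurableSet_Ioi fun r hr => ?_
    have hr : (0:ℝ) < r := hr
    have hn : ‖r • (s : E3)‖ = r := by rw [norm_smul, hs, mul_one, Real.norm_of_nonneg hr.le]
    simp only [bk, bK, hn, map_smul, smul_eq_mul]
    field_simp
    ring
  simp only [key]
  rw [integral_const, S2, smul_eq_mul]

lemma jap_le_add (v y : E3) (hy : ‖y‖ ≤ 1) : jap v ≤ 2 * jap (v + y) := by
  have := jap_add_le (v + y) (-y) (by simpa using hy)
  simpa using this

lemma jap4_inv_add_le (v y : E3) (hy : ‖y‖ ≤ 1) : (jap (v + y) ^ 4)⁻¹ ≤ 16 * (jap v ^ 4)⁻¹ := by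
  have h := jap_le_add v y hy
  have p1 := jap_pos v
  have p2 := jap_pos (v + y)
  have h2 := pow_le_pow_left₀ p1.le h 4
  rw [inv_le_iff_one_le_mul₀ (by positivity),
    show 16 * (jap v ^ 4)⁻¹ * jap (v + y) ^ 4 = (2 * jap (v + y)) ^ 4 / jap v ^ 4 by field_simp; norm_num]
  rwa [one_le_div (by positivity)]

/-- Difference quotient. -/
def dq (e : E3) (δ : ℝ) (φ : E3 → ℝ) (v : E3) : ℝ := (φ (v + δ • e) - φ v) / δ

lemma dq_dec {C : ℝ} {φ : E3 → ℝ} (h : Dec C φ) {e : E3} (he : ‖e‖ = 1) {δ : ℝ} (h0 : 0 < δ)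
    (h1 : δ ≤ 1) : Dec (17 * C / δ) (dq e δ φ) := by
  have hc := h.1
  refine ⟨by unfold dq; fun_prop, fun v => ?_⟩
  unfold dq
  rw [abs_div, abs_of_pos h0, div_mul_eq_mul_div]
  gcongr
  have hy : ‖δ • e‖ ≤ 1 := by rw [norm_smul, he, Real.norm_of_nonneg h0.le]; linarith
  have a1 := h.2 (v + δ • e)
  have a2 := h.2 v
  have a3 := jap4_inv_add_le v _ hy
  have a4 := h.nonneg
  have := abs_sub (φ (v + δ • e)) (φ v)
  nlinarith

lemma dq_cv {C : ℝ} {φ : E3 → ℝ} (h : Dec C φ) (e : E3) (δ : ℝ) :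
    cv bK (dq e δ φ) = dq e δ (cv bK φ) := by
  ext v
  unfold dq
  rw [← cv_translate]
  unfold cv
  have i1 := cv_integrable' bK_meas.aestronglyMeasurable bK_norm h.1.aestronglyMeasurable h.bdd v
  have hc := h.1
  have i2 := cv_integrable' bK_meas.aestronglyMeasurable bK_norm (φ := fun z => φ (z + δ • e))
    (Continuous.aestronglyMeasurable (by fun_prop)) (fun v => h.bdd _) v
  rw [← integral_sub i2 i1, ← integral_div]
  congr 1; ext z
  simp only [smul_eq_mul]; ring

lemma dq_fderiv {C : ℝ} {h : E3 → ℝ} (hh : Dec1 C h) (e : E3) (δ : ℝ) (v y : E3) :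
    fderiv ℝ (dq e δ h) v y = (fderiv ℝ h (v + δ • e) y - fderiv ℝ h v y) / δ := by
  have h1 : HasFDerivAt (fun v => h (v + δ • e)) (fderiv ℝ h (v + δ • e)) v :=
    (hasFDerivAt_comp_add_right (δ • e)).2 (hh.hasFDerivAt _)
  have h2 := (h1.sub (hh.hasFDerivAt v)).const_mul (δ⁻¹)
  have h3 : dq e δ h = fun v => δ⁻¹ * (h (v + δ • e) - h v) := by
    ext v; unfold dq; rw [div_eq_inv_mul]
  rw [h3]
  erw [h2.fderiv]
  simp [div_eq_inv_mul]

lemma weak_form {C C' : ℝ} {φ ζ : E3 → ℝ} (hφ : Dec C φ) (hζ : Dec1 C' ζ) :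
    ∫ v, (∑ j, pd j (cv bK φ) v * pd j ζ v + cv bK φ v * ζ v) = S2 * ∫ v, φ v * ζ v := by
  have hC' := hζ.dec.nonneg
  have hc := hζ.1.continuous_fderiv one_ne_zero
  have hb2 : ∀ v, ‖fderiv ℝ ζ v‖ ≤ C' := fun v =>
    (hζ.2.2 _).trans (mul_le_of_le_one_right hC' (jap4_inv_le_one _))
  have e1 : ∀ v, ∑ j, pd j (cv bK φ) v * pd j ζ v + cv bK φ v * ζ v =
      ∫ z, φ z * (bk (v - z) * fderiv ℝ ζ v (v - z) + bK (v - z) * ζ v) := by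
    intro v
    have i1 : ∀ j : Fin 3, Integrable fun z => φ z * (bk (v - z) * inner ℝ (v - z) (EuclideanSpace.single j (1:ℝ))) * pd j ζ v := by
      intro j
      refine Integrable.mul_const ?_ _
      have := (cv_integrable' dK_meas dK_norm hφ.1.aestronglyMeasurable hφ.bdd v).apply_continuousLinearMap (EuclideanSpace.single j (1:ℝ))
      simpa [dK, inner_sub_left] using this
    have i2 := (cv_integrable' bK_meas.aestronglyMeasurable bK_norm hφ.1.aestronglyMeasurable hφ.bdd v).mul_const (ζ v)
    simp only [pd, cv_fderiv_apply hφ, cv]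
    simp only [pd] at i1
    simp_rw [← integral_mul_const]
    rw [← integral_finset_sum _ (fun j _ => i1 j), ← integral_add (integrable_finset_sum _ (fun j _ => i1 j)) i2]
    congr 1; ext z
    rw [inner_eq_sum (fderiv ℝ ζ v) (v - z)]
    simp only [smul_eq_mul, Fin.sum_univ_three]
    simp only [EuclideanSpace.inner_single_right]
    simp
    ring
  have hIntg : Integrable (fun p : E3 × E3 => φ p.2 * (bk (p.1 - p.2) * fderiv ℝ ζ p.1 (p.1 - p.2) + bK (p.1 - p.2) * ζ p.1)) (volume.prod volume) := by
    have h0 := Integrable.convolution_integrand (ContinuousLinearMap.mul ℝ ℝ) (μ := volume) (ν := volume)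
      hφ.integrable.norm integrable_kb
    refine (h0.const_mul (2 * C')).mono' ?_ (.of_forall fun p => ?_)
    · have m1 : Measurable fun p : E3 × E3 => bk (p.1 - p.2) := bk_meas.comp (by fun_prop)
      have m2 : Measurable fun p : E3 × E3 => bK (p.1 - p.2) := bK_meas.comp (by fun_prop)
      have m3 : Measurable fun p : E3 × E3 => φ p.2 := hφ.1.measurable.comp measurable_snd
      have m4 : Measurable fun p : E3 × E3 => ζ p.1 := hζ.1.continuous.measurable.comp measurable_fst
      have m5 : Continuous fun p : E3 × E3 => fderiv ℝ ζ p.1 (p.1 - p.2) := by fun_prop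
      exact (m3.mul ((m1.mul m5.measurable).add (m2.mul m4))).aestronglyMeasurable
    · rw [norm_mul]
      simp only [ContinuousLinearMap.mul_apply', ← mul_assoc]
      rw [mul_comm (2 * C'), mul_assoc]
      refine mul_le_mul_of_nonneg_left ?_ (norm_nonneg _)
      set x := p.1 - p.2
      refine (norm_add_le _ _).trans ?_
      rw [norm_mul, norm_mul, Real.norm_eq_abs, Real.norm_eq_abs (ζ p.1)]
      have a1 := (fderiv ℝ ζ p.1).le_opNorm x
      have a2 := bk_le_kb x
      have a3 := bK_norm x
      have a4 := hζ.dec.bdd p.1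
      have a5 := hb2 p.1
      have a6 := kb_nonneg x
      calc _ ≤ |bk x| * (C' * ‖x‖) + kb x * C' := by
            gcongr
            exact a1.trans (by gcongr)
        _ ≤ _ := by nlinarith
  simp_rw [e1]
  rw [integral_integral_swap hIntg, ← integral_const_mul]
  congr 1; ext z
  rw [integral_const_mul]
  have hz : Dec1 (C' * (16 * jap z ^ 4)) (fun x => ζ (x + z)) := by
    have pz := jap_pos z
    have hle : ∀ v, (jap (v + z) ^ 4)⁻¹ ≤ 16 * jap z ^ 4 * (jap v ^ 4)⁻¹ := by
      intro v
      have h := jap_le_mul v (-z)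
      have hz : jap (-z) = jap z := by simp [jap]
      rw [hz, sub_neg_eq_add] at h
      have p1 := jap_pos v
      have p2 := jap_pos (v + z)
      have h2 := pow_le_pow_left₀ p1.le h 4
      rw [inv_le_iff_one_le_mul₀ (by positivity),
        show 16 * jap z ^ 4 * (jap v ^ 4)⁻¹ * jap (v + z) ^ 4 = (2 * (jap z * jap (v + z))) ^ 4 / jap v ^ 4 by field_simp; norm_num]
      rwa [one_le_div (by positivity)]
    refine ⟨hζ.1.comp (by fun_prop), fun v => ?_, fun v => ?_⟩
    · refine (hζ.2.1 _).trans ?_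
      rw [mul_assoc]
      exact mul_le_mul_of_nonneg_left (hle v) hC'
    · rw [fderiv_comp_add_right]
      refine (hζ.2.2 _).trans ?_
      rw [mul_assoc]
      exact mul_le_mul_of_nonneg_left (hle v) hC'
  have := kernel_identity hz
  simp only [fderiv_comp_add_right, zero_add] at this
  rw [← integral_add_right_eq_self _ z]
  simp only [add_sub_cancel_right]
  rw [this]; ring

/-- The weight. -/
def om (v : E3) : ℝ := (jap v ^ 3)⁻¹

lemma om_pos (v : E3) : 0 < om v := by have := jap_pos v; unfold om; positivity
lemma om_le_one (v : E3) : om v ≤ 1 := inv_le_one_of_one_le₀ (one_le_pow₀ (one_le_jap v))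
lemma om_cont : Continuous om := by
  unfold om
  exact (jap_continuous.pow 3).inv₀ (fun v => (pow_pos (jap_pos v) 3).ne')

lemma om_hasFDerivAt (v : E3) : HasFDerivAt om ((-(3 * (jap v ^ 5)⁻¹)) • innerSL ℝ v) v := by
  have h1 : HasFDerivAt (fun x : E3 => 1 + ‖x‖ ^ 2) ((2:ℝ) • innerSL ℝ v) v := by
    have h0 := (HasStrictFDerivAt.hasFDerivAt (hasStrictFDerivAt_norm_sq v)).const_add 1
    refine h0.congr_fderiv ?_
    ext y; simp [two_smul]
  have hp : (0:ℝ) < 1 + ‖v‖ ^ 2 := by positivity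
  have h2 := h1.sqrt hp.ne'
  have h3 : HasFDerivAt jap _ v := h2
  have h4 := h3.pow 3
  have hj := jap_pos v
  have h5 := (hasDerivAt_inv (x := jap v ^ 3) (by positivity)).comp_hasFDerivAt v h4
  refine h5.congr_fderiv ?_
  ext y
  simp only [smul_apply, smul_eq_mul]
  have : Real.sqrt (1 + ‖v‖ ^ 2) = jap v := rfl
  rw [this]
  field_simp
  simp
  ring

lemma om_contDiff : ContDiff ℝ 1 om := by
  unfold om jap
  refine ContDiff.inv (ContDiff.pow (ContDiff.sqrt (contDiff_const.add (contDiff_norm_sq ℝ)) (fun x => by positivity)) 3) (fun x => by positivity)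

lemma norm_div_jap (v : E3) : ‖v‖ ≤ jap v ^ 2 / 2 := by
  rw [jap_sq]; nlinarith [sq_nonneg (‖v‖ - 1)]

/-- integrability helper -/
lemma integrable_of_dec {h : E3 → ℝ} {K : ℝ} (hc : Continuous h) (hb : ∀ v, |h v| ≤ K * (jap v ^ 4)⁻¹) :
    Integrable h := (show Dec K h from ⟨hc, hb⟩).integrable

lemma fderiv_om_mul {C : ℝ} {χ : E3 → ℝ} (h : Dec1 C χ) (v y : E3) :
    fderiv ℝ (fun v => om v * χ v) v y = om v * fderiv ℝ χ v y - 3 * (jap v ^ 5)⁻¹ * inner ℝ v y * χ v := by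
  have : HasFDerivAt (fun v => om v * χ v) _ v := (om_hasFDerivAt v).mul (h.hasFDerivAt v)
  rw [this.fderiv]
  simp
  ring

lemma om_mul_dec1 {C : ℝ} {χ : E3 → ℝ} (h : Dec1 C χ) : Dec1 (4 * C) (fun v => om v * χ v) := by
  have hC := h.dec.nonneg
  refine ⟨om_contDiff.mul h.1, fun v => ?_, fun v => ?_⟩
  · rw [abs_mul, abs_of_pos (om_pos v)]
    have := h.2.1 v
    have h2 := om_le_one v
    have h3 := om_pos v
    have h4 := abs_nonneg (χ v)
    nlinarith
  · have : HasFDerivAt (fun v => om v * χ v) _ v := (om_hasFDerivAt v).mul (h.hasFDerivAt v)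
    rw [this.fderiv]
    have h5 : 3 * (jap v ^ 5)⁻¹ * ‖v‖ ≤ 3 := by
      have := one_le_jap v
      have h6 := norm_le_jap v
      rw [mul_assoc, inv_mul_eq_div]
      have : ‖v‖ / jap v ^ 5 ≤ 1 := by
        rw [div_le_one (by positivity)]
        exact h6.trans (le_self_pow₀ this (by norm_num))
      linarith
    have h7 := h.2.1 v
    have h8 := h.2.2 v
    have h2 := om_le_one v
    have h3 := om_pos v
    have hj := jap_pos v
    refine (norm_add_le _ _).trans ?_
    rw [norm_smul, norm_smul, norm_smul, innerSL_apply_norm, Real.norm_of_nonneg h3.le, norm_neg,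
      Real.norm_of_nonneg (show 0 ≤ 3 * (jap v ^ 5)⁻¹ by positivity), Real.norm_eq_abs]
    calc _ ≤ 1 * (C * (jap v ^ 4)⁻¹) + (C * (jap v ^ 4)⁻¹) * 3 := by gcongr
      _ = _ := by ring

lemma jensen01 {q : ℝ → ℝ} (hq : Continuous q) : (∫ s in (0:ℝ)..1, q s) ^ 2 ≤ ∫ s in (0:ℝ)..1, q s ^ 2 := by
  set m := ∫ s in (0:ℝ)..1, q s
  have h0 : 0 ≤ ∫ s in (0:ℝ)..1, (q s - m) ^ 2 :=
    intervalIntegral.integral_nonneg (by norm_num) (fun s _ => sq_nonneg _)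
  have h1 : ∫ s in (0:ℝ)..1, (q s - m) ^ 2 = (∫ s in (0:ℝ)..1, q s ^ 2) - m ^ 2 := by
    have e : ∀ s, (q s - m) ^ 2 = (q s ^ 2 - (2 * m) * q s) + m ^ 2 := fun s => by ring
    simp_rw [e]
    rw [intervalIntegral.integral_add, intervalIntegral.integral_sub, intervalIntegral.integral_const_mul]
    · simp only [intervalIntegral.integral_const]; change _ - 2 * m * m + _ = _; simp; ring
    all_goals exact Continuous.intervalIntegrable (by fun_prop) _ _
  linarith

lemma dq_jensen {C : ℝ} {ζ : E3 → ℝ} (h : Dec1 C ζ) (e : E3) {δ : ℝ} (hδ : δ ≠ 0) (v : E3) :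
    (dq e δ ζ v) ^ 2 ≤ ∫ s in (0:ℝ)..1, (fderiv ℝ ζ (v + (s * δ) • e) e) ^ 2 := by
  have hc := h.1.continuous_fderiv one_ne_zero
  have hcq : Continuous fun s : ℝ => fderiv ℝ ζ (v + (s * δ) • e) e := by fun_prop
  refine le_trans (le_of_eq ?_) (jensen01 hcq)
  congr 1
  have hd : ∀ s : ℝ, HasDerivAt (fun s : ℝ => ζ (v + (s * δ) • e) / δ) (fderiv ℝ ζ (v + (s * δ) • e) e) s := by
    intro s
    have h1 : HasDerivAt (fun s : ℝ => v + (s * δ) • e) (δ • e) s := by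
      simpa using (((hasDerivAt_id s).mul_const δ).smul_const e).const_add v
    have h2 := ((h.hasFDerivAt (v + (s * δ) • e)).comp_hasDerivAt s h1).div_const δ
    refine h2.congr_deriv ?_
    rw [map_smul, smul_eq_mul]; field_simp
  rw [intervalIntegral.integral_eq_sub_of_hasDerivAt (fun s _ => hd s) (hcq.intervalIntegrable _ _)]
  simp [dq]; ring

lemma dq_weighted {C : ℝ} {ζ : E3 → ℝ} (h : Dec1 C ζ) {e : E3} (he : ‖e‖ = 1) {δ : ℝ} (hδ : δ ≠ 0)
    (h1 : |δ| ≤ 1) :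
    ∫⁻ v, ENNReal.ofReal (jap v ^ 3 * (dq e δ ζ v) ^ 2) ≤
      8 * ∫⁻ v, ENNReal.ofReal (jap v ^ 3 * (fderiv ℝ ζ v e) ^ 2) := by
  have hc := h.1.continuous_fderiv one_ne_zero
  have hj := jap_continuous
  have e1 : ∀ v, ENNReal.ofReal (jap v ^ 3 * (dq e δ ζ v) ^ 2) ≤
      ∫⁻ s in Ioc (0:ℝ) 1, ENNReal.ofReal (jap v ^ 3 * (fderiv ℝ ζ (v + (s * δ) • e) e) ^ 2) := by
    intro v
    have hcq : Continuous fun s : ℝ => jap v ^ 3 * (fderiv ℝ ζ (v + (s * δ) • e) e) ^ 2 := by fun_prop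
    have hp := jap_pos v
    rw [← ofReal_integral_eq_lintegral_ofReal]
    · apply ENNReal.ofReal_le_ofReal
      rw [integral_const_mul]
      refine mul_le_mul_of_nonneg_left ?_ (by positivity)
      have := dq_jensen h e hδ v
      rwa [intervalIntegral.integral_of_le (by norm_num)] at this
    · exact (hcq.intervalIntegrable 0 1).1
    · exact .of_forall fun s => by positivity
  refine (lintegral_mono e1).trans ?_
  rw [lintegral_lintegral_swap]
  · have e2 : ∀ s ∈ Ioc (0:ℝ) 1, ∫⁻ v, ENNReal.ofReal (jap v ^ 3 * (fderiv ℝ ζ (v + (s * δ) • e) e) ^ 2) ≤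
        8 * ∫⁻ v, ENNReal.ofReal (jap v ^ 3 * (fderiv ℝ ζ v e) ^ 2) := by
      intro s hs
      rw [← lintegral_add_right_eq_self _ (-((s * δ) • e)), ← lintegral_const_mul']
      · refine lintegral_mono fun v => ?_
        simp only [neg_add_cancel_right]
        rw [show (8:ℝ≥0∞) = ENNReal.ofReal 8 by simp, ← ENNReal.ofReal_mul (by norm_num)]
        apply ENNReal.ofReal_le_ofReal
        have hy : ‖-((s * δ) • e)‖ ≤ 1 := by
          rw [norm_neg, norm_smul, he, mul_one, Real.norm_eq_abs, abs_mul, abs_of_pos hs.1]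
          have := hs.2
          have := hs.1
          have := abs_nonneg δ
          nlinarith
        have := pow_le_pow_left₀ (jap_pos _).le (jap_add_le v _ hy) 3
        rw [← mul_assoc]
        refine mul_le_mul_of_nonneg_right ?_ (sq_nonneg _)
        calc _ ≤ _ := this
          _ = _ := by ring
      · simp
    refine (setLIntegral_mono' measurableSet_Ioc e2).trans ?_
    simp
  · apply Measurable.aemeasurable
    apply ENNReal.measurable_ofReal.comp
    apply Continuous.measurable
    fun_prop

/-- energy density -/
def en (χ : E3 → ℝ) (v : E3) : ℝ := om v * (gradNormSq χ v + χ v ^ 2)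

lemma pd_cont {C : ℝ} {χ : E3 → ℝ} (h : Dec1 C χ) (i : Fin 3) : Continuous (pd i χ) := (h.pd_dec i).1

lemma sq_le_dec {C : ℝ} {χ : E3 → ℝ} (h : Dec C χ) (v : E3) : χ v ^ 2 ≤ C ^ 2 * ((jap v ^ 4)⁻¹) ^ 2 := by
  rw [← mul_pow, ← sq_abs]
  exact pow_le_pow_left₀ (abs_nonneg _) (h.2 v) 2

lemma integrable_sq {C : ℝ} {χ : E3 → ℝ} (h : Dec C χ) : Integrable fun v => χ v ^ 2 := by
  refine integrable_of_dec (K := C ^ 2) (h.1.pow 2) fun v => ?_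
  rw [abs_of_nonneg (sq_nonneg _)]
  refine (sq_le_dec h v).trans ?_
  have := jap4_inv_le_one v
  have := (jap4_inv_pos v).le
  refine mul_le_mul_of_nonneg_left ?_ (sq_nonneg _)
  nlinarith

lemma integrable_bdd_mul {B : ℝ} {χ b : E3 → ℝ} (h : Integrable χ) (hc : Continuous b) (hb : ∀ v, |b v| ≤ B) :
    Integrable fun v => b v * χ v := h.bdd_mul hc.aestronglyMeasurable (.of_forall hb)

lemma integrable_om_sq {C : ℝ} {χ : E3 → ℝ} (h : Dec C χ) : Integrable fun v => om v * χ v ^ 2 :=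
  integrable_bdd_mul (B := 1) (integrable_sq h) om_cont (fun v => by
    rw [abs_of_pos (om_pos v)]; exact om_le_one v)

lemma gradNormSq_nonneg (χ : E3 → ℝ) (v : E3) : 0 ≤ gradNormSq χ v := Finset.sum_nonneg fun i _ => sq_nonneg _

lemma en_nonneg (χ : E3 → ℝ) (v : E3) : 0 ≤ en χ v :=
  mul_nonneg (om_pos v).le (add_nonneg (gradNormSq_nonneg _ _) (sq_nonneg _))

lemma integrable_om_grad {C : ℝ} {χ : E3 → ℝ} (h : Dec1 C χ) : Integrable fun v => om v * gradNormSq χ v := by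
  unfold gradNormSq
  simp_rw [Finset.mul_sum]
  exact integrable_finsetSum _ fun i _ => integrable_om_sq (h.pd_dec i)

lemma integrable_en {C : ℝ} {χ : E3 → ℝ} (h : Dec1 C χ) : Integrable (en χ) := by
  unfold en
  simp_rw [mul_add]
  exact (integrable_om_grad h).add (integrable_om_sq h.dec)

lemma pd_om_mul {C : ℝ} {χ : E3 → ℝ} (h : Dec1 C χ) (i : Fin 3) (v : E3) :
    pd i (fun v => om v * χ v) v = om v * pd i χ v - 3 * (jap v ^ 5)⁻¹ * v i * χ v := by
  unfold pd
  rw [fderiv_om_mul h]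
  simp [EuclideanSpace.inner_single_right]

lemma jap5_eq (v : E3) : (jap v ^ 5)⁻¹ = om v * (jap v ^ 2)⁻¹ := by
  unfold om; rw [← mul_inv]; ring_nf

lemma en_le {C : ℝ} {χ : E3 → ℝ} (h : Dec1 C χ) (v : E3) :
    en χ v / 4 ≤ ∑ j, pd j χ v * pd j (fun v => om v * χ v) v + χ v * (om v * χ v) := by
  simp_rw [pd_om_mul h]
  set r : ℝ := (jap v ^ 2)⁻¹ with hr
  have hr0 : 0 < r := by have := jap_pos v; positivity
  have hs : v 0 ^ 2 + v 1 ^ 2 + v 2 ^ 2 = ‖v‖ ^ 2 := by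
    rw [EuclideanSpace.norm_sq_eq]; simp [Fin.sum_univ_three]
  have hn : ‖v‖ * r ≤ 1 / 2 := by
    have := norm_div_jap v
    have hj := jap_pos v
    rw [hr, ← div_eq_mul_inv, div_le_div_iff₀ (by positivity) (by norm_num)]; linarith
  rw [jap5_eq, ← hr]
  unfold en gradNormSq
  simp only [Fin.sum_univ_three]
  have ho := om_pos v
  set a := pd 0 χ v
  set b := pd 1 χ v
  set c := pd 2 χ v
  set x := χ v
  set p := v 0 * r with hp
  set q := v 1 * r with hq
  set s := v 2 * r with hs'
  have hpqs : p ^ 2 + q ^ 2 + s ^ 2 ≤ 1 / 4 := by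
    have : p ^ 2 + q ^ 2 + s ^ 2 = (‖v‖ * r) ^ 2 := by rw [hp, hq, hs', mul_pow ‖v‖, ← hs]; ring
    rw [this]
    have : 0 ≤ ‖v‖ * r := by positivity
    nlinarith
  have key : 3 * ((p * a + q * b + s * c) * x) ≤ 3 / 4 * (a ^ 2 + b ^ 2 + c ^ 2 + x ^ 2) := by
    have : (p * a + q * b + s * c) * x ≤ (p*x)^2+(q*x)^2+(s*x)^2 + (a^2+b^2+c^2)/4 := by
      nlinarith [sq_nonneg (p * x - a / 2), sq_nonneg (q * x - b / 2), sq_nonneg (s * x - c / 2)]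
    have h2 : (p*x)^2+(q*x)^2+(s*x)^2 ≤ 1/4 * x^2 := by
      have := mul_le_mul_of_nonneg_right hpqs (sq_nonneg x); nlinarith
    linarith
  have key2 := mul_le_mul_of_nonneg_left key ho.le
  have e : a * (om v * a - 3 * (om v * r) * v 0 * x) + b * (om v * b - 3 * (om v * r) * v 1 * x) +
      c * (om v * c - 3 * (om v * r) * v 2 * x) + x * (om v * x) =
      om v * (a^2+b^2+c^2+x^2) - om v * (3 * ((p * a + q * b + s * c) * x)) := by
    rw [hp, hq, hs']; ring
  rw [e]; linarith

lemma pd_om_sq_le {C : ℝ} {χ : E3 → ℝ} (h : Dec1 C χ) (m : Fin 3) (v : E3) :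
    jap v ^ 3 * (pd m (fun v => om v * χ v) v) ^ 2 ≤ 13 / 4 * en χ v := by
  rw [pd_om_mul h]
  set r : ℝ := (jap v ^ 2)⁻¹ with hr
  have hj := jap_pos v
  have hr0 : 0 < r := by positivity
  have hvm : |v m| ≤ ‖v‖ := by simpa using PiLp.norm_apply_le v m
  have hn : |v m * r| ≤ 1 / 2 := by
    have := norm_div_jap v
    rw [abs_mul, abs_of_pos hr0, hr, ← div_eq_mul_inv, div_le_div_iff₀ (by positivity) (by norm_num)]; linarith
  rw [jap5_eq, ← hr]
  have hle : pd m χ v ^ 2 ≤ gradNormSq χ v := by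
    unfold gradNormSq
    exact Finset.single_le_sum (f := fun i => pd i χ v ^ 2) (fun i _ => sq_nonneg _) (Finset.mem_univ m)
  unfold en
  have ho := om_pos v
  have ho2 : jap v ^ 3 * om v = 1 := by unfold om; field_simp
  set a := pd m χ v
  set x := χ v
  set p := v m * r with hp
  have e : jap v ^ 3 * (om v * a - 3 * (om v * r) * v m * x) ^ 2 = om v * (a - 3 * p * x) ^ 2 := by
    rw [show jap v ^ 3 * (om v * a - 3 * (om v * r) * v m * x) ^ 2 = (jap v ^ 3 * om v) * (om v * (a - 3 * p * x) ^ 2) by rw [hp]; ring, ho2, one_mul]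
  rw [e]
  have hp2 : p ^ 2 ≤ 1 / 4 := by rw [← sq_abs]; have := abs_nonneg p; nlinarith
  have : (a - 3 * p * x) ^ 2 ≤ 13 / 4 * (a ^ 2 + x ^ 2) := by
    have h1 : (a - 3 * p * x) ^ 2 ≤ (1 + 9 * p^2) * (a ^ 2 + x ^ 2) := by
      nlinarith [sq_nonneg (3 * p * a + x)]
    refine h1.trans ?_
    gcongr
    linarith
  calc _ ≤ om v * (13 / 4 * (a ^ 2 + x ^ 2)) := by gcongr
    _ ≤ om v * (13 / 4 * (gradNormSq χ v + x ^ 2)) := by gcongr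
    _ = _ := by ring

lemma S2_nonneg : 0 ≤ S2 := measureReal_nonneg

lemma Dec.mul_integrable {C C' : ℝ} {φ ψ : E3 → ℝ} (h : Dec C φ) (h' : Dec C' ψ) :
    Integrable fun v => φ v * ψ v :=
  integrable_bdd_mul (B := C) h'.integrable h.1 h.bdd

lemma integral_dq_mul {C C' : ℝ} {φ ζ : E3 → ℝ} (h : Dec C φ) (h' : Dec C' ζ) (e : E3) {δ : ℝ} :
    ∫ v, dq e δ φ v * ζ v = - ∫ v, φ v * dq e (-δ) ζ v := by
  have hc := h'.1
  have hc2 := h.1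
  have i0 := h.mul_integrable h'
  have i1 : Integrable fun v => φ (v + δ • e) * ζ v :=
    integrable_bdd_mul (B := C) h'.integrable (by fun_prop) (fun v => h.bdd _)
  have i2 : Integrable fun v => φ v * ζ (v - δ • e) := by
    have := i1.comp_sub_right (δ • e)
    simpa using this
  have e1 : ∫ v, φ (v + δ • e) * ζ v = ∫ v, φ v * ζ (v - δ • e) := by
    rw [← integral_sub_right_eq_self _ (δ • e)]
    simp
  have l : ∀ v, dq e δ φ v * ζ v = (φ (v + δ • e) * ζ v - φ v * ζ v) / δ := by
    intro v; unfold dq; ring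
  have r : ∀ v, φ v * dq e (-δ) ζ v = -((φ v * ζ (v - δ • e) - φ v * ζ v) / δ) := by
    intro v; unfold dq; rw [neg_smul, ← sub_eq_add_neg, div_neg]; ring
  simp_rw [l, r]
  rw [integral_neg, neg_neg, integral_div, integral_div, integral_sub i1 i0, integral_sub i2 i0, e1]

def CE : ℝ := 416 * (S2 + 1) ^ 2

lemma CE_pos : 0 < CE := by have := S2_nonneg; unfold CE; positivity

lemma energy {C : ℝ} {φ : E3 → ℝ} (h : Dec C φ) (m : Fin 3) {δ : ℝ} (h0 : 0 < δ) (h1 : δ ≤ 1) :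
    ∫ v, en (dq (EuclideanSpace.single m 1) δ (cv bK φ)) v ≤ CE * ∫ v, om v * φ v ^ 2 := by
  set e : E3 := EuclideanSpace.single m 1 with he
  have hen : ‖e‖ = 1 := norm_e m
  have hψ := dq_dec h hen h0 h1
  have hχ := cv_dec1 hψ
  rw [dq_cv h] at hχ
  set χ := dq e δ (cv bK φ) with hχd
  set ζ : E3 → ℝ := fun v => om v * χ v with hζd
  have hζ := om_mul_dec1 hχ
  have wf := weak_form hψ hζ
  rw [dq_cv h, ← hχd, integral_dq_mul h hζ.dec e] at wf
  set D := dq e (-δ) ζ with hD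
  set E := ∫ v, en χ v with hE
  have iφ := integrable_om_sq h
  set Φ := ∫ v, om v * φ v ^ 2 with hΦ
  -- lower bound
  have low : E / 4 ≤ ∫ v, (∑ j, pd j χ v * pd j ζ v + χ v * ζ v) := by
    rw [hE, ← integral_div]
    refine integral_mono ((integrable_en hχ).div_const 4) ?_ (fun v => en_le hχ v)
    exact (integrable_finsetSum _ fun j _ => (hχ.pd_dec j).mul_integrable (hζ.pd_dec j)).add
      (hχ.dec.mul_integrable hζ.dec)
  rw [wf] at low
  -- weighted bound of D
  have hDc : Continuous D := by
    have := hζ.1.continuous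
    rw [hD]; unfold dq; fun_prop
  have hj := jap_continuous
  have key : ∫⁻ v, ENNReal.ofReal (jap v ^ 3 * D v ^ 2) ≤ ENNReal.ofReal (26 * E) := by
    have a1 := dq_weighted hζ hen (δ := -δ) (neg_ne_zero.2 h0.ne') (by rw [abs_neg, abs_of_pos h0]; exact h1)
    refine a1.trans ?_
    have a2 : ∫⁻ v, ENNReal.ofReal (jap v ^ 3 * (fderiv ℝ ζ v e) ^ 2) ≤ ENNReal.ofReal (13 / 4 * E) := by
      rw [hE, ← integral_const_mul, ofReal_integral_eq_lintegral_ofReal]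
      · exact lintegral_mono fun v => ENNReal.ofReal_le_ofReal (pd_om_sq_le hχ m v)
      · exact (integrable_en hχ).const_mul _
      · exact .of_forall fun v => mul_nonneg (by norm_num) (en_nonneg _ _)
    calc _ ≤ 8 * ENNReal.ofReal (13 / 4 * E) := by gcongr
      _ = _ := by
        rw [show (8:ℝ≥0∞) = ENNReal.ofReal 8 by simp, ← ENNReal.ofReal_mul (by norm_num)]
        congr 1; ring
  have hE0 : 0 ≤ E := integral_nonneg fun v => en_nonneg _ _
  have hpos : ∀ v, 0 ≤ jap v ^ 3 * D v ^ 2 := fun v => by have := jap_pos v; positivity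
  have iD : Integrable fun v => jap v ^ 3 * D v ^ 2 := by
    refine ⟨Continuous.aestronglyMeasurable (by fun_prop), ?_⟩
    rw [hasFiniteIntegral_iff_ofReal (.of_forall hpos)]
    exact key.trans_lt ENNReal.ofReal_lt_top
  have key2 : ∫ v, jap v ^ 3 * D v ^ 2 ≤ 26 * E := by
    rw [← ofReal_integral_eq_lintegral_ofReal iD (.of_forall hpos)] at key
    exact (ENNReal.ofReal_le_ofReal_iff (by positivity)).1 key
  -- Young
  set s := S2 + 1 with hs
  have hs2 := S2_nonneg
  have hsp : 0 < s := by positivity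
  have yo : -∫ v, φ v * D v ≤ 52 * s * Φ + 1 / (208 * s) * ∫ v, jap v ^ 3 * D v ^ 2 := by
    have pw : ∀ v, |φ v * D v| ≤ 52 * s * (om v * φ v ^ 2) + 1 / (208 * s) * (jap v ^ 3 * D v ^ 2) := by
      intro v
      have hjp := jap_pos v
      rw [abs_mul, ← sq_abs (φ v), ← sq_abs (D v)]
      set a := |φ v|
      set b := |D v|
      have e : 52 * s * (om v * a ^ 2) + 1 / (208 * s) * (jap v ^ 3 * b ^ 2) - a * b =
          (52 * s * om v) * (a - jap v ^ 3 * b / (104 * s)) ^ 2 := by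
        unfold om; field_simp; ring
      have : 0 ≤ (52 * s * om v) * (a - jap v ^ 3 * b / (104 * s)) ^ 2 := by
        have := om_pos v; positivity
      linarith
    have iR := (iφ.const_mul (52 * s)).add (iD.const_mul (1 / (208 * s)))
    have hφc := h.1
    have iL : Integrable fun v => φ v * D v := iR.mono' (Continuous.aestronglyMeasurable (by fun_prop)) (.of_forall pw)
    rw [hΦ, ← integral_neg, ← integral_const_mul, ← integral_const_mul, ← integral_add (iφ.const_mul _) (iD.const_mul _)]
    exact integral_mono iL.neg iR fun v => (neg_le_abs _).trans (pw v)
  have hΦ0 : 0 ≤ Φ := integral_nonneg fun v => mul_nonneg (om_pos v).le (sq_nonneg _)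
  have fin1 : E / 4 ≤ s * (52 * s * Φ + 1 / (208 * s) * (26 * E)) := by
    refine low.trans ?_
    have : 0 ≤ 52 * s * Φ + 1 / (208 * s) * (26 * E) := by positivity
    calc S2 * (-∫ v, φ v * D v) ≤ S2 * (52 * s * Φ + 1 / (208 * s) * (26 * E)) := by
          refine mul_le_mul_of_nonneg_left (yo.trans ?_) hs2
          gcongr
      _ ≤ _ := by
          refine mul_le_mul_of_nonneg_right ?_ this
          rw [hs]; linarith
  have : s * (52 * s * Φ + 1 / (208 * s) * (26 * E)) = 52 * s ^ 2 * Φ + E / 8 := by field_simp; ring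
  rw [this] at fin1
  unfold CE
  rw [← hs]
  linarith

lemma pd_meas (i : Fin 3) (φ : E3 → ℝ) : Measurable (pd i φ) := measurable_fderiv_apply_const ℝ φ _

lemma energy_pd {C : ℝ} {φ : E3 → ℝ} (h : Dec C φ) (j m : Fin 3) :
    ∫⁻ v, ENNReal.ofReal (om v * (pd m (pd j (cv bK φ)) v) ^ 2) ≤ ENNReal.ofReal (CE * ∫ v, om v * φ v ^ 2) := by
  set e : E3 := EuclideanSpace.single m 1 with he
  have hh := cv_dec1 h
  set H := cv bK φ with hH
  let δ : ℕ → ℝ := fun n => 1 / ((n : ℝ) + 1)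
  have δ0 : ∀ n, 0 < δ n := fun n => by positivity
  have δ1 : ∀ n, δ n ≤ 1 := fun n => by
    rw [div_le_one (by positivity)]; have : (0:ℝ) ≤ n := by positivity
    linarith
  have hδ : Filter.Tendsto δ Filter.atTop (nhds 0) := tendsto_one_div_add_atTop_nhds_zero_nat
  have hdec : ∀ n, Dec1 (Ckb * (17 * C / δ n)) (dq e (δ n) H) := by
    intro n
    have := cv_dec1 (dq_dec h (norm_e m) (δ0 n) (δ1 n))
    rwa [dq_cv h] at this
  have pw : ∀ v, ENNReal.ofReal (om v * (pd m (pd j H) v) ^ 2) ≤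
      Filter.liminf (fun n => ENNReal.ofReal (en (dq e (δ n) H) v)) Filter.atTop := by
    intro v
    by_cases hd : DifferentiableAt ℝ (pd j H) v
    · have ht : Filter.Tendsto (fun n => dq e (δ n) (pd j H) v) Filter.atTop (nhds (pd m (pd j H) v)) := by
        have h1 : HasDerivAt (fun s : ℝ => pd j H (v + s • e)) (pd m (pd j H) v) 0 := by
          have h2 : HasDerivAt (fun s : ℝ => v + s • e) e 0 := by
            simpa using ((hasDerivAt_id (0:ℝ)).smul_const e).const_add v
          have h3 : HasFDerivAt (pd j H) (fderiv ℝ (pd j H) v) (v + (0:ℝ) • e) := by simpa using hd.hasFDerivAt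
          exact h3.comp_hasDerivAt 0 h2
        have h4 := h1.tendsto_slope_zero
        have h5 : Filter.Tendsto δ Filter.atTop (nhdsWithin 0 {0}ᶜ) :=
          tendsto_nhdsWithin_iff.2 ⟨hδ, .of_forall fun n => (δ0 n).ne'⟩
        refine (h4.comp h5).congr fun n => ?_
        simp [dq, div_eq_inv_mul]
      have ht2 : Filter.Tendsto (fun n => ENNReal.ofReal (om v * (dq e (δ n) (pd j H) v) ^ 2)) Filter.atTop
          (nhds (ENNReal.ofReal (om v * (pd m (pd j H) v) ^ 2))) :=
        ENNReal.tendsto_ofReal ((ht.pow 2).const_mul _)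
      rw [← ht2.liminf_eq]
      refine Filter.liminf_le_liminf (.of_forall fun n => ENNReal.ofReal_le_ofReal ?_)
      have e1 : dq e (δ n) (pd j H) v = pd j (dq e (δ n) H) v := by
        unfold pd; rw [dq_fderiv hh]; rfl
      rw [e1]
      unfold en
      refine mul_le_mul_of_nonneg_left ?_ (om_pos v).le
      have : pd j (dq e (δ n) H) v ^ 2 ≤ gradNormSq (dq e (δ n) H) v :=
        Finset.single_le_sum (f := fun i => pd i (dq e (δ n) H) v ^ 2) (fun _ _ => sq_nonneg _) (Finset.mem_univ j)
      linarith [sq_nonneg (dq e (δ n) H v)]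
    · have : pd m (pd j H) v = 0 := by
        conv_lhs => unfold pd
        rw [show (fun v => fderiv ℝ H v (EuclideanSpace.single j 1)) = pd j H from rfl, fderiv_zero_of_not_differentiableAt hd]; rfl
      rw [this]; simp
  refine (lintegral_mono pw).trans ?_
  refine (lintegral_liminf_le' ?_).trans ?_
  · exact fun n => (integrable_en (hdec n)).aestronglyMeasurable.aemeasurable.ennreal_ofReal
  · refine Filter.liminf_le_of_le (by isBoundedDefault) fun b hb => ?_
    obtain ⟨n, hn⟩ := hb.exists
    refine hn.trans ?_
    rw [← ofReal_integral_eq_lintegral_ofReal (integrable_en (hdec n)) (.of_forall fun v => en_nonneg _ _)]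
    exact ENNReal.ofReal_le_ofReal (energy h m (δ0 n) (δ1 n))

/-- square root of the weight -/
def sg (v : E3) : ℝ := Real.sqrt (om v)

lemma sg_pos (v : E3) : 0 < sg v := Real.sqrt_pos.2 (om_pos v)
lemma sg_sq (v : E3) : sg v ^ 2 = om v := Real.sq_sqrt (om_pos v).le
lemma sg_le_one (v : E3) : sg v ≤ 1 := Real.sqrt_le_one.2 (om_le_one v)
lemma sg_contDiff : ContDiff ℝ 1 sg := om_contDiff.sqrt (fun x => (om_pos x).ne')

lemma sg_fderiv_norm (v : E3) : ‖fderiv ℝ sg v‖ ≤ 1 := by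
  have h : HasFDerivAt sg _ v := (om_hasFDerivAt v).sqrt (om_pos v).ne'
  rw [h.fderiv, norm_smul, norm_smul, innerSL_apply_norm, norm_neg]
  have hj := jap_pos v
  have hs := sg_pos v
  have h1 := sg_le_one v
  change ‖1 / (2 * sg v)‖ * _ ≤ 1
  rw [Real.norm_of_nonneg (by positivity), Real.norm_of_nonneg (by positivity), jap5_eq, ← sg_sq]
  have h2 := norm_div_jap v
  have h3 : (jap v ^ 2)⁻¹ * ‖v‖ ≤ 1 / 2 := by
    rw [inv_mul_le_iff₀ (by positivity)]; linarith
  calc 1 / (2 * sg v) * (3 * (sg v ^ 2 * (jap v ^ 2)⁻¹) * ‖v‖) = 3 / 2 * sg v * ((jap v ^ 2)⁻¹ * ‖v‖) := by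
        field_simp
    _ ≤ 3 / 2 * 1 * (1 / 2) := by gcongr
    _ ≤ 1 := by norm_num

lemma fderiv_sq_le (g : E3 → ℝ) (v : E3) : ‖fderiv ℝ g v‖ ^ 2 ≤ gradNormSq g v := by
  have h0 := gradNormSq_nonneg g v
  have : ‖fderiv ℝ g v‖ ≤ Real.sqrt (gradNormSq g v) := by
    refine ContinuousLinearMap.opNorm_le_bound _ (Real.sqrt_nonneg _) fun x => ?_
    rw [inner_eq_sum, EuclideanSpace.norm_eq, ← Real.sqrt_mul h0]
    apply Real.abs_le_sqrt
    unfold gradNormSq pd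
    simp only [Real.norm_eq_abs, sq_abs]
    exact Finset.sum_mul_sq_le_sq_mul_sq _ _ _
  calc _ ≤ Real.sqrt (gradNormSq g v) ^ 2 := by gcongr
    _ = _ := Real.sq_sqrt h0

def bump0 : ContDiffBump (0 : E3) := ⟨1, 2, one_pos, one_lt_two⟩

lemma bump_bound : ∃ K : ℝ, 0 ≤ K ∧ ∀ v, ‖fderiv ℝ (bump0 : E3 → ℝ) v‖ ≤ K := by
  have h1 : HasCompactSupport (fderiv ℝ (bump0 : E3 → ℝ)) := bump0.hasCompactSupport.fderiv ℝ
  have h2 : Continuous (fderiv ℝ (bump0 : E3 → ℝ)) := (bump0.contDiff (n := 1)).continuous_fderiv one_ne_zero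
  obtain ⟨K, hK⟩ := h1.exists_bound_of_continuous h2
  exact ⟨K, (norm_nonneg _).trans (hK 0), hK⟩

lemma gns : ∃ c : ℝ≥0, ∀ u : E3 → ℝ, ContDiff ℝ 1 u → HasCompactSupport u →
    eLpNorm u 6 volume ≤ c * eLpNorm (fderiv ℝ u) 2 volume := by
  refine ⟨SNormLESNormFDerivOfEqConst ℝ (volume : Measure E3) (2 : ℝ≥0), fun u hu hs => ?_⟩
  exact eLpNorm_le_eLpNorm_fderiv_of_eq (volume : Measure E3) (F := ℝ) hu hs (p := 2) (p' := 6)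
      (by norm_num) (by rw [finrank_E3]; norm_num) (by rw [finrank_E3]; norm_num)

lemma bump_contDiff (r : ℝ) : ContDiff ℝ 1 (fun v : E3 => bump0 (r • v)) :=
  ContDiff.comp (g := (bump0 : E3 → ℝ)) bump0.contDiff (contDiff_const_smul r)

lemma bump_compact {r : ℝ} (hr : r ≠ 0) : HasCompactSupport (fun v : E3 => bump0 (r • v)) := by
  have h : HasCompactSupport (bump0 : E3 → ℝ) := bump0.hasCompactSupport
  exact h.comp_smul hr

lemma sobolev : ∃ CS : ℝ, 0 < CS ∧ ∀ (C : ℝ) (g : E3 → ℝ), Dec1 C g →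
    (∫⁻ v, ‖sg v * g v‖ₑ ^ (6:ℝ)) ^ (1 / 3 : ℝ) ≤
      ENNReal.ofReal (CS * ((∫ v, om v * gradNormSq g v) + ∫ v, g v ^ 2)) := by
  obtain ⟨K, hK0, hK⟩ := bump_bound
  obtain ⟨c, hc⟩ := gns
  refine ⟨(c ^ 2 + 1) * (2 * (1 + K) ^ 2), by positivity, fun C g hg => ?_⟩
  set D := (∫ v, om v * gradNormSq g v) + ∫ v, g v ^ 2 with hD
  let r : ℕ → ℝ := fun n => ((n : ℝ) + 1)⁻¹
  have r0 : ∀ n, 0 < r n := fun n => by positivity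
  have r1 : ∀ n, r n ≤ 1 := fun n => by
    apply inv_le_one_of_one_le₀; have : (0:ℝ) ≤ n := by positivity
    linarith
  have hr : Filter.Tendsto r Filter.atTop (nhds 0) := by
    simpa [one_div] using (tendsto_one_div_add_atTop_nhds_zero_nat (𝕜 := ℝ))
  let u : ℕ → E3 → ℝ := fun n v => bump0 (r n • v) * (sg v * g v)
  have hu : ∀ n, ContDiff ℝ 1 (u n) := fun n => (bump_contDiff (r n)).mul (sg_contDiff.mul hg.1)
  have hs : ∀ n, HasCompactSupport (u n) := fun n => (bump_compact (r0 n).ne').mul_right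
  have ig := integrable_om_grad hg
  have ig2 := integrable_sq hg.dec
  have hD0 : 0 ≤ D := add_nonneg (integral_nonneg fun v => mul_nonneg (om_pos v).le (gradNormSq_nonneg _ _))
    (integral_nonneg fun v => sq_nonneg _)
  have hfd : ∀ n v, ‖fderiv ℝ (u n) v‖ ^ 2 ≤ 2 * (1 + K) ^ 2 * (om v * gradNormSq g v + g v ^ 2) := by
    intro n v
    have d1 : HasFDerivAt (fun v => sg v * g v) (sg v • fderiv ℝ g v + g v • fderiv ℝ sg v) v :=
      (sg_contDiff.differentiable one_ne_zero v).hasFDerivAt.mul (hg.hasFDerivAt v)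
    have d2 : HasFDerivAt (fun v : E3 => bump0 (r n • v)) (r n • fderiv ℝ (bump0 : E3 → ℝ) (r n • v)) v := by
      have a1 : HasFDerivAt (fun v : E3 => r n • v) (r n • ContinuousLinearMap.id ℝ E3) v :=
        (hasFDerivAt_id v).const_smul (r n)
      have a2 := ((bump0.contDiff (n := 1)).differentiable one_ne_zero (r n • v)).hasFDerivAt
      refine (a2.comp v a1).congr_fderiv ?_
      ext y; simp
    have d3 : HasFDerivAt (u n) _ v := d2.mul d1
    have b0 : |(bump0 : E3 → ℝ) (r n • v)| ≤ 1 := by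
      rw [abs_of_nonneg bump0.nonneg]; exact bump0.le_one
    have hn : ‖fderiv ℝ (u n) v‖ ≤ sg v * ‖fderiv ℝ g v‖ + (1 + K) * |g v| := by
      rw [d3.fderiv]
      refine (norm_add_le _ _).trans ?_
      rw [norm_smul, norm_smul, norm_smul, Real.norm_eq_abs, Real.norm_of_nonneg (r0 n).le, Real.norm_eq_abs,
        abs_mul, abs_of_pos (sg_pos v)]
      have a1 : ‖sg v • fderiv ℝ g v + g v • fderiv ℝ sg v‖ ≤ sg v * ‖fderiv ℝ g v‖ + |g v| * 1 := by
        refine (norm_add_le _ _).trans ?_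
        rw [norm_smul, norm_smul, Real.norm_of_nonneg (sg_pos v).le, Real.norm_eq_abs]
        gcongr
        exact sg_fderiv_norm v
      have h3 := sg_pos v
      calc _ ≤ 1 * (sg v * ‖fderiv ℝ g v‖ + |g v| * 1) + 1 * |g v| * (1 * K) := by
            gcongr
            · exact sg_le_one v
            · exact r1 n
            · exact hK _
        _ = _ := by ring
    have h4 := fderiv_sq_le g v
    have h3 := sg_pos v
    calc _ ≤ (sg v * ‖fderiv ℝ g v‖ + (1 + K) * |g v|) ^ 2 := by gcongr
      _ ≤ 2 * ((sg v * ‖fderiv ℝ g v‖) ^ 2 + ((1 + K) * |g v|) ^ 2) := by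
          nlinarith [sq_nonneg (sg v * ‖fderiv ℝ g v‖ - (1 + K) * |g v|)]
      _ = 2 * (om v * ‖fderiv ℝ g v‖ ^ 2 + (1 + K) ^ 2 * g v ^ 2) := by
          rw [mul_pow, mul_pow, sg_sq, sq_abs]
      _ ≤ 2 * ((1 + K) ^ 2 * (om v * gradNormSq g v) + (1 + K) ^ 2 * g v ^ 2) := by
          have h5 : om v * ‖fderiv ℝ g v‖ ^ 2 ≤ 1 * (om v * gradNormSq g v) := by
            rw [one_mul]; exact mul_le_mul_of_nonneg_left h4 (om_pos v).le
          have h6 : 1 * (om v * gradNormSq g v) ≤ (1 + K) ^ 2 * (om v * gradNormSq g v) :=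
            mul_le_mul_of_nonneg_right (by nlinarith) (mul_nonneg (om_pos v).le (gradNormSq_nonneg _ _))
          linarith
      _ = _ := by ring
  have hn : ∀ n, eLpNorm (u n) 6 volume ≤ c * ENNReal.ofReal (2 * (1 + K) ^ 2 * D) ^ (1 / 2 : ℝ) := by
    intro n
    have := hc (u n) (hu n) (hs n)
    refine this.trans ?_
    gcongr
    rw [eLpNorm_eq_lintegral_rpow_enorm_toReal (by norm_num) (by simp)]
    simp only [ENNReal.toReal_ofNat]
    gcongr
    rw [hD, ← integral_add ig ig2, ← integral_const_mul, ofReal_integral_eq_lintegral_ofReal]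
    · refine lintegral_mono fun v => ?_
      rw [← ofReal_norm, ENNReal.ofReal_rpow_of_nonneg (norm_nonneg _) (by norm_num)]
      refine ENNReal.ofReal_le_ofReal ?_
      have := hfd n v
      simpa using this
    · exact (ig.add ig2).const_mul _
    · refine .of_forall fun v => ?_
      have := mul_nonneg (om_pos v).le (gradNormSq_nonneg g v)
      positivity
  have lim : eLpNorm (fun v => sg v * g v) 6 volume ≤ c * ENNReal.ofReal (2 * (1 + K) ^ 2 * D) ^ (1 / 2 : ℝ) := by
    refine (Lp.eLpNorm_lim_le_liminf_eLpNorm (f := u) (fun n => (hu n).continuous.aestronglyMeasurable) _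
      (.of_forall fun v => ?_)).trans ?_
    · have t1 : Filter.Tendsto (fun n => r n • v) Filter.atTop (nhds 0) := by
        simpa using hr.smul_const v
      have t2 : Filter.Tendsto (fun n => bump0 (r n • v)) Filter.atTop (nhds 1) := by
        have h := (bump0.contDiff (n := 1)).continuous.tendsto (0 : E3)
        have h1 : (bump0 : E3 → ℝ) 0 = 1 := bump0.one_of_mem_closedBall (by simp [bump0])
        rw [h1] at h
        exact h.comp t1
      simpa using t2.mul_const (sg v * g v)
    · refine Filter.liminf_le_of_le (by isBoundedDefault) fun b hb => ?_
      obtain ⟨n, h⟩ := hb.exists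
      exact h.trans (hn n)
  rw [eLpNorm_eq_lintegral_rpow_enorm_toReal (by norm_num) (by simp)] at lim
  simp only [ENNReal.toReal_ofNat] at lim
  have sq := ENNReal.rpow_le_rpow lim (show (0:ℝ) ≤ 2 by norm_num)
  rw [← ENNReal.rpow_mul, ENNReal.mul_rpow_of_nonneg _ _ (by norm_num), ← ENNReal.rpow_mul] at sq
  norm_num at sq
  refine (le_of_eq ?_).trans (sq.trans ?_)
  · norm_num
  · rw [show (c:ℝ≥0∞) = ENNReal.ofReal c by simp, ← ENNReal.ofReal_pow (by positivity), ← ENNReal.ofReal_mul (by positivity)]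
    apply ENNReal.ofReal_le_ofReal
    rw [mul_assoc ((c:ℝ)^2 + 1)]
    gcongr
    linarith

/-- the Riesz kernel -/
def kk (x : E3) : ℝ≥0∞ := ENNReal.ofReal ((‖x‖ ^ 2)⁻¹)

lemma kk_meas : Measurable kk := by unfold kk; fun_prop

lemma kk_neg (x : E3) : kk (-x) = kk x := by simp [kk]

lemma lintegral_scale {F : E3 → ℝ≥0∞} (hF : Measurable F) {r : ℝ} (hr : 0 < r) :
    ∫⁻ x, F x = ENNReal.ofReal (r ^ 3) * ∫⁻ x, F (r • x) := by
  have h := Measure.map_addHaar_smul (volume : Measure E3) hr.ne'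
  have h2 : ∫⁻ x, F (r • x) = ∫⁻ x, F x ∂(Measure.map (r • ·) volume) := by
    rw [lintegral_map hF (measurable_const_smul r)]
  rw [h2, h, lintegral_smul_measure, finrank_E3, smul_eq_mul, ← mul_assoc, abs_of_pos (by positivity),
    ← ENNReal.ofReal_mul (by positivity), mul_inv_cancel₀ (by positivity)]
  simp

def nearC : ℝ≥0∞ := ∫⁻ x : E3, if ‖x‖ < 1 then kk x else 0
def farC : ℝ≥0∞ := ∫⁻ x : E3, if 1 ≤ ‖x‖ then kk x ^ (3:ℝ) else 0

lemma nearC_lt : nearC < ∞ := by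
  have h : nearC ≤ ∫⁻ x, ENNReal.ofReal (Real.exp 1 * kb x) := by
    refine lintegral_mono fun x => ?_
    split_ifs with hx
    · unfold kk kb
      apply ENNReal.ofReal_le_ofReal
      have h1 : 1 ≤ Real.exp 1 * Real.exp (-‖x‖) := by
        rw [← Real.exp_add]; apply Real.one_le_exp; linarith
      have h2 : (‖x‖ ^ 2)⁻¹ ≤ 1 / ‖x‖ + (1 + ‖x‖) / ‖x‖ ^ 2 := by
        have : (1 + ‖x‖) / ‖x‖ ^ 2 = (‖x‖ ^ 2)⁻¹ + ‖x‖ / ‖x‖ ^ 2 := by rw [add_div, one_div]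
        rw [this]
        have : 0 ≤ 1 / ‖x‖ + ‖x‖ / ‖x‖ ^ 2 := by positivity
        linarith
      calc _ ≤ _ := h2
        _ = 1 * (1 / ‖x‖ + (1 + ‖x‖) / ‖x‖ ^ 2) := by ring
        _ ≤ (Real.exp 1 * Real.exp (-‖x‖)) * (1 / ‖x‖ + (1 + ‖x‖) / ‖x‖ ^ 2) := by gcongr
        _ = _ := by ring
    · exact zero_le
  refine h.trans_lt ?_
  exact (integrable_kb.const_mul _).lintegral_lt_top

lemma farC_lt : farC < ∞ := by
  have h : farC ≤ ∫⁻ x, ENNReal.ofReal (4 * (jap x ^ 4)⁻¹) := by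
    refine lintegral_mono fun x => ?_
    split_ifs with hx
    · unfold kk
      rw [ENNReal.ofReal_rpow_of_nonneg (by positivity) (by norm_num)]
      apply ENNReal.ofReal_le_ofReal
      have hj := jap_pos x
      norm_cast
      rw [← div_eq_mul_inv, le_div_iff₀ (by positivity), inv_pow, inv_mul_le_iff₀ (by positivity),
        show jap x ^ 4 = (jap x ^ 2) ^ 2 by ring, jap_sq]
      have h1 : 1 ≤ ‖x‖ ^ 2 := by nlinarith
      set t := ‖x‖ ^ 2
      nlinarith [mul_nonneg (sq_nonneg t) (sub_nonneg.2 h1)]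
    · exact zero_le
  refine h.trans_lt ?_
  exact (integrable_jap4.const_mul _).lintegral_lt_top

lemma near_scale {ρ : ℝ} (hρ : 0 < ρ) :
    ∫⁻ x : E3, (if ‖x‖ < ρ then kk x else 0) = ENNReal.ofReal ρ * nearC := by
  rw [lintegral_scale (Measurable.ite (measurableSet_lt (by fun_prop) (by fun_prop)) kk_meas measurable_const) hρ]
  have : ∀ x : E3, (if ‖ρ • x‖ < ρ then kk (ρ • x) else 0) = ENNReal.ofReal ((ρ ^ 2)⁻¹) * (if ‖x‖ < 1 then kk x else 0) := by
    intro x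
    rw [norm_smul, Real.norm_of_nonneg hρ.le]
    have : ρ * ‖x‖ < ρ ↔ ‖x‖ < 1 := by
      constructor <;> intro h <;> nlinarith
    simp only [this]
    split_ifs
    · unfold kk
      rw [← ENNReal.ofReal_mul (by positivity), norm_smul, Real.norm_of_nonneg hρ.le, mul_pow, mul_inv]
    · simp
  simp_rw [this]
  rw [lintegral_const_mul' _ _ (by simp), ← mul_assoc, ← ENNReal.ofReal_mul (by positivity)]
  unfold nearC
  congr 2
  field_simp

lemma far_scale {ρ : ℝ} (hρ : 0 < ρ) :
    ∫⁻ x : E3, (if ρ ≤ ‖x‖ then kk x ^ (3:ℝ) else 0) = ENNReal.ofReal ((ρ ^ 3)⁻¹) * farC := by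
  rw [lintegral_scale (Measurable.ite (measurableSet_le (by fun_prop) (by fun_prop)) (kk_meas.pow_const _) measurable_const) hρ]
  have : ∀ x : E3, (if ρ ≤ ‖ρ • x‖ then kk (ρ • x) ^ (3:ℝ) else 0) = ENNReal.ofReal ((ρ ^ 6)⁻¹) * (if 1 ≤ ‖x‖ then kk x ^ (3:ℝ) else 0) := by
    intro x
    rw [norm_smul, Real.norm_of_nonneg hρ.le]
    have : ρ ≤ ρ * ‖x‖ ↔ 1 ≤ ‖x‖ := by
      constructor <;> intro h <;> nlinarith
    simp only [this]
    split_ifs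
    · unfold kk
      rw [norm_smul, Real.norm_of_nonneg hρ.le, ENNReal.ofReal_rpow_of_nonneg (by positivity) (by norm_num),
        ENNReal.ofReal_rpow_of_nonneg (by positivity) (by norm_num), ← ENNReal.ofReal_mul (by positivity)]
      congr 1
      norm_cast
      rw [mul_pow, mul_inv, mul_pow, inv_pow, ← pow_mul]
    · simp
  simp_rw [this]
  rw [lintegral_const_mul' _ _ (by simp), ← mul_assoc, ← ENNReal.ofReal_mul (by positivity)]
  unfold farC
  congr 2
  field_simp

lemma hls_inner {T : E3 → ℝ≥0∞} (hT : Measurable T) (h1 : ∫⁻ v, T v ^ (3/2:ℝ) ≤ 1) {s : ℝ} (hs : 0 < s) (z : E3) :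
    ∫⁻ v, (if T v ≤ ENNReal.ofReal s then T v * kk (v - z) else 0) ≤
      (nearC + farC ^ (1/3:ℝ)) * ENNReal.ofReal (Real.sqrt s) := by
  set ρ := (Real.sqrt s)⁻¹ with hρd
  have hsq : 0 < Real.sqrt s := Real.sqrt_pos.2 hs
  have hρ : 0 < ρ := by positivity
  have mk : Measurable fun v => kk (v - z) := kk_meas.comp (by fun_prop)
  have b : ∀ v, (if T v ≤ ENNReal.ofReal s then T v * kk (v - z) else 0) ≤
      ENNReal.ofReal s * (if ‖v - z‖ < ρ then kk (v - z) else 0) + T v * (if ρ ≤ ‖v - z‖ then kk (v - z) else 0) := by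
    intro v
    split_ifs with h2 h3 h4 h4
    · linarith
    · rw [mul_zero, add_zero]; gcongr
    · simp
    · linarith
    all_goals exact zero_le
  refine (lintegral_mono b).trans ?_
  have mf : Measurable fun v => (if ρ ≤ ‖v - z‖ then kk (v - z) else 0) :=
    Measurable.ite (measurableSet_le (by fun_prop) (by fun_prop)) mk measurable_const
  have mf2 : Measurable fun v => T v * (if ρ ≤ ‖v - z‖ then kk (v - z) else 0) := hT.mul mf
  rw [lintegral_add_right _ mf2, lintegral_const_mul' _ _ (by simp), add_mul]
  refine add_le_add ?_ ?_
  · rw [lintegral_sub_right_eq_self (fun x => if ‖x‖ < ρ then kk x else 0), near_scale hρ, ← mul_assoc, ← ENNReal.ofReal_mul hs.le,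
      mul_comm nearC]
    gcongr
    rw [hρd]
    nth_rewrite 1 [← Real.mul_self_sqrt hs.le]
    field_simp
    exact le_rfl
  · have hh := ENNReal.lintegral_mul_le_Lp_mul_Lq (volume : Measure E3) (p := 3/2) (q := 3)
      (by rw [Real.holderConjugate_iff]; norm_num) hT.aemeasurable mf.aemeasurable
    refine hh.trans ?_
    have e : ∀ v : E3, (if ρ ≤ ‖v - z‖ then kk (v - z) else 0) ^ (3:ℝ) = (fun x => if ρ ≤ ‖x‖ then kk x ^ (3:ℝ) else 0) (v - z) := by
      intro v; simp only
      split_ifs <;> simp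
    simp_rw [e]
    rw [lintegral_sub_right_eq_self (fun x => if ρ ≤ ‖x‖ then kk x ^ (3:ℝ) else 0), far_scale hρ, ENNReal.mul_rpow_of_nonneg _ _ (by norm_num)]
    calc _ ≤ (1:ℝ≥0∞) ^ (1 / (3/2) : ℝ) * (ENNReal.ofReal ((ρ ^ 3)⁻¹) ^ (1/3:ℝ) * farC ^ (1/3:ℝ)) := by gcongr
      _ = farC ^ (1/3:ℝ) * ENNReal.ofReal ((ρ ^ 3)⁻¹) ^ (1/3:ℝ) := by rw [ENNReal.one_rpow, one_mul, mul_comm]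
      _ = _ := by
        congr 1
        rw [hρd, inv_pow, inv_inv, ENNReal.ofReal_rpow_of_nonneg (by positivity) (by norm_num)]
        congr 1
        rw [← Real.rpow_natCast, ← Real.rpow_mul hsq.le]
        norm_num

def hlsC : ℝ≥0∞ := 2 * (nearC + farC ^ (1/3:ℝ))

lemma hlsC_lt : hlsC < ∞ := by
  unfold hlsC
  have := nearC_lt
  have h2 : farC ^ (1/3:ℝ) < ∞ := ENNReal.rpow_lt_top_of_nonneg (by norm_num) farC_lt.ne
  exact ENNReal.mul_lt_top (by simp) (ENNReal.add_lt_top.2 ⟨this, h2⟩)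

lemma hls_half {S T : E3 → ℝ≥0∞} (hT : Measurable T) (hf : ∀ z, S z ≠ ∞)
    (h0 : ∫⁻ v, S v ^ (3/2:ℝ) ≤ 1) (h1 : ∫⁻ v, T v ^ (3/2:ℝ) ≤ 1) :
    ∫⁻ z, ∫⁻ v, (if T v ≤ S z then S z * (T v * kk (v - z)) else 0) ≤ nearC + farC ^ (1/3:ℝ) := by
  have hfin : nearC + farC ^ (1/3:ℝ) ≠ ∞ := by
    have h2 : farC ^ (1/3:ℝ) < ∞ := ENNReal.rpow_lt_top_of_nonneg (by norm_num) farC_lt.ne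
    exact (ENNReal.add_lt_top.2 ⟨nearC_lt, h2⟩).ne
  have pw : ∀ z, ∫⁻ v, (if T v ≤ S z then S z * (T v * kk (v - z)) else 0) ≤
      (nearC + farC ^ (1/3:ℝ)) * S z ^ (3/2:ℝ) := by
    intro z
    by_cases hz : S z = 0
    · simp [hz]
    have e : S z = ENNReal.ofReal (S z).toReal := (ENNReal.ofReal_toReal (hf z)).symm
    have hs : 0 < (S z).toReal := ENNReal.toReal_pos hz (hf z)
    have := hls_inner hT h1 hs z
    rw [← e] at this
    have e2 : ∀ v, (if T v ≤ S z then S z * (T v * kk (v - z)) else 0) = S z * (if T v ≤ S z then (T v * kk (v - z)) else 0) := by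
      intro v; split_ifs <;> simp
    simp_rw [e2]
    rw [lintegral_const_mul' _ _ (hf z)]
    calc _ ≤ S z * ((nearC + farC ^ (1/3:ℝ)) * ENNReal.ofReal (Real.sqrt (S z).toReal)) := by gcongr
      _ = (nearC + farC ^ (1/3:ℝ)) * (S z * ENNReal.ofReal (Real.sqrt (S z).toReal)) := by ring
      _ = _ := by
        congr 1
        rw [Real.sqrt_eq_rpow, ← ENNReal.ofReal_rpow_of_pos hs, ← e]
        nth_rewrite 1 [← ENNReal.rpow_one (S z)]
        rw [← ENNReal.rpow_add _ _ hz (hf z)]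
        norm_num
  refine (lintegral_mono pw).trans ?_
  rw [lintegral_const_mul' _ _ hfin]
  calc _ ≤ (nearC + farC ^ (1/3:ℝ)) * 1 := by gcongr
    _ = _ := mul_one _

lemma hls_one {S T : E3 → ℝ≥0∞} (hS : Measurable S) (hT : Measurable T) (hf : ∀ z, S z ≠ ∞) (hf' : ∀ z, T z ≠ ∞)
    (h0 : ∫⁻ v, S v ^ (3/2:ℝ) ≤ 1) (h1 : ∫⁻ v, T v ^ (3/2:ℝ) ≤ 1) :
    ∫⁻ z, ∫⁻ v, S z * (T v * kk (v - z)) ≤ hlsC := by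
  have a1 := hls_half hT hf h0 h1
  have a2 := hls_half hS hf' h1 h0
  have mS : Measurable fun p : E3 × E3 => S p.1 := hS.comp measurable_fst
  have mT : Measurable fun p : E3 × E3 => T p.2 := hT.comp measurable_snd
  have mk : Measurable fun p : E3 × E3 => kk (p.2 - p.1) := kk_meas.comp (by fun_prop)
  have m1 : Measurable fun p : E3 × E3 => (if S p.1 ≤ T p.2 then T p.2 * (S p.1 * kk (p.1 - p.2)) else 0) := by
    refine Measurable.ite (measurableSet_le mS mT) (mT.mul (mS.mul ?_)) measurable_const
    exact kk_meas.comp (by fun_prop)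
  have m2 : Measurable fun p : E3 × E3 => (if T p.2 ≤ S p.1 then S p.1 * (T p.2 * kk (p.2 - p.1)) else 0) :=
    Measurable.ite (measurableSet_le mT mS) (mS.mul (mT.mul mk)) measurable_const
  rw [lintegral_lintegral_swap] at a2
  · have b : ∀ z v, S z * (T v * kk (v - z)) ≤ (if T v ≤ S z then S z * (T v * kk (v - z)) else 0) +
        (if S z ≤ T v then T v * (S z * kk (z - v)) else 0) := by
      intro z v
      rcases le_total (T v) (S z) with h | h
      · rw [if_pos h]; exact le_self_add
      · rw [if_pos h, ← kk_neg (z - v), neg_sub]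
        refine le_trans (le_of_eq ?_) le_add_self
        ring
    calc _ ≤ ∫⁻ z, ∫⁻ v, ((if T v ≤ S z then S z * (T v * kk (v - z)) else 0) +
        (if S z ≤ T v then T v * (S z * kk (z - v)) else 0)) := lintegral_mono fun z => lintegral_mono fun v => b z v
      _ = (∫⁻ z, ∫⁻ v, (if T v ≤ S z then S z * (T v * kk (v - z)) else 0)) +
          ∫⁻ z, ∫⁻ v, (if S z ≤ T v then T v * (S z * kk (z - v)) else 0) := by
        rw [← lintegral_add_left]
        · congr 1; ext z
          rw [← lintegral_add_left]
          exact m2.comp (measurable_const.prodMk measurable_id)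
        · exact m2.lintegral_prod_right'
      _ ≤ _ := by unfold hlsC; rw [two_mul]; gcongr
  · exact (m1.comp measurable_swap).aemeasurable

lemma hls {S T : E3 → ℝ≥0∞} (hS : Measurable S) (hT : Measurable T) (hf : ∀ z, S z ≠ ∞) (hf' : ∀ z, T z ≠ ∞)
    {a b : ℝ} (ha : 0 < a) (hb : 0 < b)
    (h0 : ∫⁻ v, S v ^ (3/2:ℝ) ≤ ENNReal.ofReal a ^ (3/2:ℝ)) (h1 : ∫⁻ v, T v ^ (3/2:ℝ) ≤ ENNReal.ofReal b ^ (3/2:ℝ)) :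
    ∫⁻ z, ∫⁻ v, S z * (T v * kk (v - z)) ≤ hlsC * ENNReal.ofReal (a * b) := by
  have key : ∀ (S : E3 → ℝ≥0∞) (a : ℝ), 0 < a → ∫⁻ v, S v ^ (3/2:ℝ) ≤ ENNReal.ofReal a ^ (3/2:ℝ) →
      ∫⁻ v, (ENNReal.ofReal a⁻¹ * S v) ^ (3/2:ℝ) ≤ 1 := by
    intro S a ha h
    simp_rw [ENNReal.mul_rpow_of_nonneg _ _ (show (0:ℝ) ≤ 3/2 by norm_num)]
    rw [lintegral_const_mul' _ _ (ENNReal.rpow_ne_top_of_nonneg (by norm_num) (by simp))]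
    calc _ ≤ ENNReal.ofReal a⁻¹ ^ (3/2:ℝ) * ENNReal.ofReal a ^ (3/2:ℝ) := by gcongr
      _ = 1 := by
        rw [← ENNReal.mul_rpow_of_nonneg _ _ (show (0:ℝ) ≤ 3/2 by norm_num), ← ENNReal.ofReal_mul (by positivity),
          inv_mul_cancel₀ ha.ne']; simp
  have := hls_one (S := fun z => ENNReal.ofReal a⁻¹ * S z) (T := fun z => ENNReal.ofReal b⁻¹ * T z)
    (hS.const_mul _) (hT.const_mul _) (fun z => ENNReal.mul_ne_top (by simp) (hf z))
    (fun z => ENNReal.mul_ne_top (by simp) (hf' z)) (key S a ha h0) (key T b hb h1)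
  have e : ∀ z v, S z * (T v * kk (v - z)) = ENNReal.ofReal (a * b) * (ENNReal.ofReal a⁻¹ * S z * (ENNReal.ofReal b⁻¹ * T v * kk (v - z))) := by
    intro z v
    have : ENNReal.ofReal (a * b) * (ENNReal.ofReal a⁻¹ * ENNReal.ofReal b⁻¹) = 1 := by
      rw [← ENNReal.ofReal_mul (by positivity), ← ENNReal.ofReal_mul (by positivity)]
      rw [show a * b * (a⁻¹ * b⁻¹) = 1 by field_simp]; simp
    calc _ = 1 * (S z * (T v * kk (v - z))) := by rw [one_mul]
      _ = _ := by rw [← this]; ring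
  simp_rw [e]
  have e2 : ∀ z, ∫⁻ v, ENNReal.ofReal (a * b) * (ENNReal.ofReal a⁻¹ * S z * (ENNReal.ofReal b⁻¹ * T v * kk (v - z)))
      = ENNReal.ofReal (a * b) * ∫⁻ v, (ENNReal.ofReal a⁻¹ * S z * (ENNReal.ofReal b⁻¹ * T v * kk (v - z))) :=
    fun z => lintegral_const_mul' _ _ (by simp)
  simp_rw [e2]
  rw [lintegral_const_mul' _ _ (by simp), mul_comm]
  gcongr

/-- kernel of LandauA -/
def Nk (j m : Fin 3) (x : E3) : ℝ := Pker x j m / ‖x‖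

lemma Nk_meas (j m : Fin 3) : Measurable (Nk j m) := by
  unfold Nk Pker
  fun_prop

lemma coord_le (x : E3) (j : Fin 3) : |x j| ≤ ‖x‖ := by simpa using PiLp.norm_apply_le x j

lemma Nk_eq (j m : Fin 3) (x : E3) : Nk j m x =
    (if j = m then (1:ℝ) else 0) * ‖x‖⁻¹ - (x j * ‖x‖⁻¹) * (x m * ‖x‖⁻¹) * ‖x‖⁻¹ := by
  unfold Nk Pker
  simp only [div_eq_mul_inv, sq, mul_inv]; ring

lemma unit_coord_le (x : E3) (j : Fin 3) : |x j * ‖x‖⁻¹| ≤ 1 := by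
  rw [abs_mul, abs_of_nonneg (inv_nonneg.2 (norm_nonneg x)), ← div_eq_mul_inv]
  exact div_le_one_of_le₀ (coord_le x j) (norm_nonneg _)

lemma Nk_abs (j m : Fin 3) (x : E3) : |Nk j m x| ≤ 2 * (1 + (‖x‖ ^ 2)⁻¹) := by
  rw [Nk_eq]
  have h0 : 0 ≤ ‖x‖⁻¹ := by positivity
  have h1 : |(x j * ‖x‖⁻¹) * (x m * ‖x‖⁻¹) * ‖x‖⁻¹| ≤ 1 * 1 * ‖x‖⁻¹ := by
    rw [abs_mul, abs_mul, abs_of_nonneg h0]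
    gcongr
    · exact unit_coord_le x j
    · exact unit_coord_le x m
  have h2 : |(if j = m then (1:ℝ) else 0) * ‖x‖⁻¹| ≤ ‖x‖⁻¹ := by
    split_ifs <;> simp
  have h3 := abs_sub ((if j = m then (1:ℝ) else 0) * ‖x‖⁻¹) ((x j * ‖x‖⁻¹) * (x m * ‖x‖⁻¹) * ‖x‖⁻¹)
  have h4 : ‖x‖⁻¹ ≤ 1 + (‖x‖ ^ 2)⁻¹ := by
    rw [← inv_pow]; nlinarith [sq_nonneg (‖x‖⁻¹ - 1)]
  linarith

lemma Nk_diff (j m : Fin 3) {a b : E3} (ha : a ≠ 0) (hb : b ≠ 0) :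
    |Nk j m a - Nk j m b| ≤ 3 * ‖a - b‖ * ((‖a‖ ^ 2)⁻¹ + (‖b‖ ^ 2)⁻¹) := by
  have pa : 0 < ‖a‖ := norm_pos_iff.2 ha
  have pb : 0 < ‖b‖ := norm_pos_iff.2 hb
  set d := ‖a - b‖ with hd
  have hd0 : 0 ≤ d := norm_nonneg _
  set α := ‖a‖⁻¹ with hα
  set β := ‖b‖⁻¹ with hβ
  have qa : 0 < α := by positivity
  have qb : 0 < β := by positivity
  have h1 : |α - β| ≤ d * α * β := by
    have e : α - β = (‖b‖ - ‖a‖) * α * β := by rw [hα, hβ]; field_simp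
    rw [e, abs_mul, abs_mul, abs_of_pos qa, abs_of_pos qb]
    gcongr
    rw [abs_sub_comm]; exact abs_norm_sub_norm_le a b
  have h2 : ∀ i : Fin 3, |a i * α - b i * β| ≤ 2 * d * α := by
    intro i
    have e : a i * α - b i * β = (a - b) i * α + b i * (α - β) := by simp; ring
    rw [e]
    refine (abs_add_le _ _).trans ?_
    rw [abs_mul, abs_mul, abs_of_pos qa]
    have c1 := coord_le (a - b) i
    have c2 := coord_le b i
    calc _ ≤ d * α + ‖b‖ * (d * α * β) := by gcongr
      _ = _ := by rw [hβ]; field_simp; ring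
  have u := unit_coord_le
  have ua : ∀ i, |a i * α| ≤ 1 := u a
  have ub : ∀ i, |b i * β| ≤ 1 := u b
  have h3 : |(a j * α) * (a m * α) - (b j * β) * (b m * β)| ≤ 4 * d * α := by
    have e : (a j * α) * (a m * α) - (b j * β) * (b m * β) =
      (a j * α) * (a m * α - b m * β) + (a j * α - b j * β) * (b m * β) := by ring
    rw [e]
    refine (abs_add_le _ _).trans ?_
    rw [abs_mul (a j * α) (a m * α - b m * β), abs_mul (a j * α - b j * β)]
    calc _ ≤ 1 * (2 * d * α) + (2 * d * α) * 1 := by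
          gcongr
          · exact ua j
          · exact h2 m
          · exact h2 j
          · exact ub m
      _ = _ := by ring
  have tot : |Nk j m a - Nk j m b| ≤ 6 * d * α * β := by
    rw [Nk_eq, Nk_eq]
    have e : (if j = m then (1:ℝ) else 0) * α - (a j * α) * (a m * α) * α - ((if j = m then (1:ℝ) else 0) * β - (b j * β) * (b m * β) * β)
      = (if j = m then (1:ℝ) else 0) * (α - β) - ((a j * α) * (a m * α) * (α - β) + ((a j * α) * (a m * α) - (b j * β) * (b m * β)) * β) := by ring
    rw [e]
    refine (abs_sub _ _).trans ?_
    have t1 : |(if j = m then (1:ℝ) else 0) * (α - β)| ≤ d * α * β := by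
      split_ifs
      · simpa using h1
      · simp; positivity
    have t2 := abs_add_le ((a j * α) * (a m * α) * (α - β)) (((a j * α) * (a m * α) - (b j * β) * (b m * β)) * β)
    have t3 : |(a j * α) * (a m * α) * (α - β)| ≤ 1 * 1 * (d * α * β) := by
      rw [abs_mul, abs_mul]
      gcongr
      · exact ua j
      · exact ua m
    have t4 : |((a j * α) * (a m * α) - (b j * β) * (b m * β)) * β| ≤ 4 * d * α * β := by
      rw [abs_mul, abs_of_pos qb]; gcongr
    linarith
  refine tot.trans ?_
  rw [← inv_pow, ← inv_pow]
  change _ ≤ 3 * d * (α ^ 2 + β ^ 2)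
  have : 2 * (α * β) ≤ α ^ 2 + β ^ 2 := by nlinarith [sq_nonneg (α - β)]
  calc 6 * d * α * β = 3 * d * (2 * (α * β)) := by ring
    _ ≤ _ := by gcongr

/-- Riesz potential in extended nonnegative reals -/
def JJ (h : E3 → ℝ) (v : E3) : ℝ≥0∞ := ∫⁻ z, ENNReal.ofReal (h z) * kk (v - z)

lemma LandauA_eq (h : E3 → ℝ) (v : E3) (j m : Fin 3) :
    LandauA h v j m = 1 / (8 * Real.pi) * ∫ z, Nk j m (v - z) * h z := rfl

lemma Nk_integrable {h : E3 → ℝ} (hi : Integrable h) (h0 : ∀ z, 0 ≤ h z) {v : E3} (hJ : JJ h v ≠ ∞) (j m : Fin 3) :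
    Integrable fun z => Nk j m (v - z) * h z := by
  have mN : AEStronglyMeasurable (fun z => Nk j m (v - z)) volume :=
    ((Nk_meas j m).comp (by fun_prop)).aestronglyMeasurable
  have mk2 : Measurable fun z : E3 => (‖v - z‖ ^ 2)⁻¹ := by fun_prop
  have i2 : Integrable fun z => h z * (‖v - z‖ ^ 2)⁻¹ := by
    refine ⟨hi.1.mul mk2.aestronglyMeasurable, ?_⟩
    rw [hasFiniteIntegral_iff_ofReal (.of_forall fun z => mul_nonneg (h0 z) (by positivity))]
    have : ∀ z, ENNReal.ofReal (h z * (‖v - z‖ ^ 2)⁻¹) = ENNReal.ofReal (h z) * kk (v - z) :=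
      fun z => ENNReal.ofReal_mul (h0 z)
    simp_rw [this]
    exact lt_top_iff_ne_top.2 hJ
  refine ((hi.add i2).const_mul 2).mono' (mN.mul hi.1) (.of_forall fun z => ?_)
  rw [norm_mul, Real.norm_eq_abs, Real.norm_of_nonneg (h0 z)]
  have := mul_le_mul_of_nonneg_right (Nk_abs j m (v - z)) (h0 z)
  simp only [Pi.add_apply]
  linarith

lemma LandauA_diff {h : E3 → ℝ} (hi : Integrable h) (h0 : ∀ z, 0 ≤ h z) (v y : E3) (hy : y ≠ 0) (j m : Fin 3) :
    ENNReal.ofReal |LandauA h (v + y) j m - LandauA h v j m| ≤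
      ENNReal.ofReal ‖y‖ * (JJ h v + JJ h (v + y)) := by
  have hy0 : ENNReal.ofReal ‖y‖ ≠ 0 := by
    simp [hy]
  by_cases h1 : JJ h v = ∞
  · rw [h1, top_add, ENNReal.mul_top hy0]; exact le_top
  by_cases h2 : JJ h (v + y) = ∞
  · rw [h2, add_top, ENNReal.mul_top hy0]; exact le_top
  have i1 := Nk_integrable hi h0 h1 j m
  have i2 := Nk_integrable hi h0 h2 j m
  rw [LandauA_eq, LandauA_eq, ← mul_sub, ← integral_sub i2 i1, abs_mul, abs_of_pos (by positivity)]
  rw [ENNReal.ofReal_mul (by positivity)]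
  have key : ENNReal.ofReal |∫ z, (Nk j m (v + y - z) * h z - Nk j m (v - z) * h z)| ≤
      ENNReal.ofReal (3 * ‖y‖) * (JJ h v + JJ h (v + y)) := by
    have := enorm_integral_le_lintegral_enorm (μ := volume) (fun z => Nk j m (v + y - z) * h z - Nk j m (v - z) * h z)
    rw [← Real.norm_eq_abs, ofReal_norm]
    refine this.trans ?_
    have mh : AEMeasurable (fun z => ENNReal.ofReal (h z) * kk (v - z)) volume :=
      hi.1.aemeasurable.ennreal_ofReal.mul (kk_meas.comp (by fun_prop)).aemeasurable
    unfold JJ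
    rw [← lintegral_add_left' mh, ← lintegral_const_mul' _ _ ENNReal.ofReal_ne_top]
    refine lintegral_mono_ae ?_
    have n1 : ∀ᵐ z : E3, z ≠ v := by simp [ae_iff]
    have n2 : ∀ᵐ z : E3, z ≠ v + y := by simp [ae_iff]
    filter_upwards [n1, n2] with z z1 z2
    rw [← ofReal_norm]
    unfold kk
    rw [← ENNReal.ofReal_mul (h0 z), ← ENNReal.ofReal_mul (h0 z), ← ENNReal.ofReal_add (mul_nonneg (h0 z) (by positivity)) (mul_nonneg (h0 z) (by positivity)),
      ← ENNReal.ofReal_mul (by positivity)]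
    apply ENNReal.ofReal_le_ofReal
    rw [← sub_mul, norm_mul, Real.norm_of_nonneg (h0 z), Real.norm_eq_abs]
    have := Nk_diff j m (a := v + y - z) (b := v - z) (sub_ne_zero.2 z2.symm) (sub_ne_zero.2 z1.symm)
    rw [show v + y - z - (v - z) = y by abel] at this
    have := mul_le_mul_of_nonneg_right this (h0 z)
    linarith
  calc _ ≤ ENNReal.ofReal (1 / (8 * Real.pi)) * (ENNReal.ofReal (3 * ‖y‖) * (JJ h v + JJ h (v + y))) := by gcongr
    _ = ENNReal.ofReal (1 / (8 * Real.pi) * (3 * ‖y‖)) * (JJ h v + JJ h (v + y)) := by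
        rw [← mul_assoc, ← ENNReal.ofReal_mul (by positivity)]
    _ ≤ _ := by
        gcongr
        have := Real.pi_gt_three
        rw [div_mul_eq_mul_div, div_le_iff₀ (by positivity)]
        nlinarith [norm_nonneg y]

lemma pd_LandauA {h : E3 → ℝ} (hi : Integrable h) (h0 : ∀ z, 0 ≤ h z) (i j m : Fin 3) (v : E3) :
    ENNReal.ofReal |pd i (fun u => LandauA h u j m) v| ≤
      Filter.liminf (fun n : ℕ => JJ h v + JJ h (v + (1 / ((n:ℝ) + 1)) • EuclideanSpace.single i 1)) Filter.atTop := by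
  set A : E3 → ℝ := fun u => LandauA h u j m with hA
  set e : E3 := EuclideanSpace.single i 1 with he
  let δ : ℕ → ℝ := fun n => 1 / ((n : ℝ) + 1)
  have δ0 : ∀ n, 0 < δ n := fun n => by positivity
  have hδ : Filter.Tendsto δ Filter.atTop (nhds 0) := tendsto_one_div_add_atTop_nhds_zero_nat
  by_cases hd : DifferentiableAt ℝ A v
  · have ht : Filter.Tendsto (fun n => dq e (δ n) A v) Filter.atTop (nhds (pd i A v)) := by
      have h1 : HasDerivAt (fun s : ℝ => A (v + s • e)) (pd i A v) 0 := by
        have h2 : HasDerivAt (fun s : ℝ => v + s • e) e 0 := by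
          simpa using ((hasDerivAt_id (0:ℝ)).smul_const e).const_add v
        have h3 : HasFDerivAt A (fderiv ℝ A v) (v + (0:ℝ) • e) := by simpa using hd.hasFDerivAt
        exact h3.comp_hasDerivAt 0 h2
      have h4 := h1.tendsto_slope_zero
      have h5 : Filter.Tendsto δ Filter.atTop (nhdsWithin 0 {0}ᶜ) :=
        tendsto_nhdsWithin_iff.2 ⟨hδ, .of_forall fun n => (δ0 n).ne'⟩
      refine (h4.comp h5).congr fun n => ?_
      simp [dq, div_eq_inv_mul]
    have ht2 := ENNReal.tendsto_ofReal ht.abs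
    rw [← ht2.liminf_eq]
    refine Filter.liminf_le_liminf (.of_forall fun n => ?_)
    have hne : δ n • e ≠ 0 := smul_ne_zero (δ0 n).ne' (by rw [← norm_ne_zero_iff, he, norm_e]; norm_num)
    have b := LandauA_diff hi h0 v (δ n • e) hne j m
    have hn : ‖δ n • e‖ = δ n := by rw [norm_smul, he, norm_e, mul_one, Real.norm_of_nonneg (δ0 n).le]
    rw [hn] at b
    unfold dq
    rw [abs_div, abs_of_pos (δ0 n), ENNReal.ofReal_div_of_pos (δ0 n)]
    refine ENNReal.div_le_of_le_mul' b
  · have : pd i A v = 0 := by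
      unfold pd; rw [fderiv_zero_of_not_differentiableAt hd]; rfl
    rw [this]; simp

def II (S : E3 → ℝ≥0∞) (v : E3) : ℝ≥0∞ := ∫⁻ z, S z * kk (v - z)

lemma II_meas {S : E3 → ℝ≥0∞} (hS : Measurable S) : Measurable (II S) := by
  unfold II
  refine Measurable.lintegral_prod_right' (f := fun p : E3 × E3 => S p.2 * kk (p.1 - p.2)) ?_
  exact (hS.comp measurable_snd).mul (kk_meas.comp (by fun_prop))

lemma om_le_sg (v : E3) : om v ≤ sg v := by
  rw [← sg_sq]; nlinarith [sg_pos v, sg_le_one v]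

lemma jap2_le_sg (v : E3) : (jap v ^ 2)⁻¹ ≤ sg v := by
  have h := jap_pos v
  refine le_of_sq_le_sq ?_ (sg_pos v).le |> fun h => h
  rw [sg_sq]; unfold om
  rw [← inv_pow, ← inv_pow, ← pow_mul]
  exact pow_le_pow_of_le_one (by positivity) (inv_le_one_of_one_le₀ (one_le_jap v)) (by norm_num)

lemma om_shift (v y : E3) (hy : ‖y‖ ≤ 1) : om (v + y) ≤ 8 * om v := by
  have h := jap_pos v
  have h' := jap_pos (v + y)
  have h1 := jap_le_add v y hy
  unfold om
  have : jap v ^ 3 ≤ 8 * jap (v + y) ^ 3 := by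
    calc _ ≤ (2 * jap (v + y)) ^ 3 := by gcongr
      _ = _ := by ring
  rw [inv_le_iff_one_le_mul₀ (by positivity)]
  rw [mul_assoc, inv_mul_eq_div, ← mul_div_assoc, le_div_iff₀ (by positivity)]
  linarith

lemma sg_shift (v y : E3) (hy : ‖y‖ ≤ 1) : sg (v + y) ≤ 3 * sg v := by
  refine abs_le_of_sq_le_sq' ?_ (by have := sg_pos v; positivity) |>.2
  rw [mul_pow, sg_sq, sg_sq]
  have := om_shift v y hy
  have := om_pos v
  linarith

lemma near_pt (v z : E3) (h : ‖v - z‖ < 1) : 1 ≤ 8 * om v * jap z ^ 3 := by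
  have h1 := jap_le_add v (z - v) (by rw [norm_sub_rev]; exact h.le)
  rw [add_sub_cancel] at h1
  have hp := jap_pos v
  have hz := jap_pos z
  unfold om
  have : jap v ^ 3 ≤ 8 * jap z ^ 3 := by
    calc _ ≤ (2 * jap z) ^ 3 := by gcongr
      _ = _ := by ring
  rw [mul_right_comm, ← div_eq_mul_inv, le_div_iff₀ (by positivity)]
  linarith

lemma far_pt (v z : E3) (h : 1 ≤ ‖v - z‖) : (‖v - z‖ ^ 2)⁻¹ ≤ 16 * sg v * jap z ^ 2 := by
  have h1 := jap_le_mul v z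
  have hp := jap_pos v
  have hz := jap_pos z
  have h2 : jap (v - z) ≤ 2 * ‖v - z‖ := by
    unfold jap
    rw [Real.sqrt_le_left (by positivity)]
    nlinarith
  have h3 : jap v ≤ 4 * (jap z * ‖v - z‖) := by nlinarith
  have h4 : jap v ^ 2 ≤ 16 * (jap z ^ 2 * ‖v - z‖ ^ 2) := by
    calc _ ≤ (4 * (jap z * ‖v - z‖)) ^ 2 := by gcongr
      _ = _ := by ring
  have h5 : (‖v - z‖ ^ 2)⁻¹ ≤ 16 * (jap v ^ 2)⁻¹ * jap z ^ 2 := by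
    rw [inv_le_iff_one_le_mul₀ (by positivity)]
    rw [show 16 * (jap v ^ 2)⁻¹ * jap z ^ 2 * ‖v - z‖ ^ 2 = 16 * (jap z ^ 2 * ‖v - z‖ ^ 2) / jap v ^ 2 by
      field_simp, le_div_iff₀ (by positivity)]
    linarith
  refine h5.trans ?_
  gcongr
  exact jap2_le_sg v

def BB (H M : ℝ) : ℝ := 8 * H * nearC.toReal + 16 * M

lemma JJ_bound {f : E3 → ℝ} (h0 : ∀ z, 0 ≤ f z) {S : E3 → ℝ≥0∞} (hS : Measurable S)
    {H M : ℝ} (hH : 0 ≤ H) (hM0 : 0 ≤ M)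
    (hb : ∀ᵐ z, ENNReal.ofReal (jap z ^ 3 * f z) ≤ S z + ENNReal.ofReal H)
    (hM : ∫⁻ z, ENNReal.ofReal (jap z ^ 2 * f z) ≤ ENNReal.ofReal M) (v : E3) :
    JJ f v ≤ ENNReal.ofReal (8 * om v) * II S v + ENNReal.ofReal (BB H M * sg v) := by
  have so := sg_pos v
  have oo := om_pos v
  have m1 : Measurable fun z => ENNReal.ofReal (8 * om v) * (S z * kk (v - z)) :=
    (hS.mul (kk_meas.comp (by fun_prop))).const_mul _
  have m2 : Measurable fun z : E3 => ENNReal.ofReal (8 * om v * H) * (if ‖v - z‖ < 1 then kk (v - z) else 0) := by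
    refine Measurable.const_mul ?_ _
    exact Measurable.ite (measurableSet_lt (by fun_prop) (by fun_prop)) (kk_meas.comp (by fun_prop)) measurable_const
  have key : JJ f v ≤ ∫⁻ z, (ENNReal.ofReal (8 * om v) * (S z * kk (v - z)) +
      (ENNReal.ofReal (8 * om v * H) * (if ‖v - z‖ < 1 then kk (v - z) else 0) +
        ENNReal.ofReal (16 * sg v) * ENNReal.ofReal (jap z ^ 2 * f z))) := by
    refine lintegral_mono_ae ?_
    filter_upwards [hb] with z hz
    by_cases hn : ‖v - z‖ < 1
    · rw [if_pos hn]
      have hp := near_pt v z hn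
      calc ENNReal.ofReal (f z) * kk (v - z) ≤ ENNReal.ofReal (8 * om v * (jap z ^ 3 * f z)) * kk (v - z) := by
            gcongr
            nlinarith [h0 z]
        _ ≤ ENNReal.ofReal (8 * om v) * (S z + ENNReal.ofReal H) * kk (v - z) := by
            rw [ENNReal.ofReal_mul (by positivity)]
            gcongr
        _ = ENNReal.ofReal (8 * om v) * (S z * kk (v - z)) + ENNReal.ofReal (8 * om v * H) * kk (v - z) := by
            rw [ENNReal.ofReal_mul (p := 8 * om v) (q := H) (by positivity)]; ring
        _ ≤ _ := by
            rw [← add_assoc]; exact le_self_add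
    · have hp := far_pt v z (not_lt.1 hn)
      calc ENNReal.ofReal (f z) * kk (v - z) ≤ ENNReal.ofReal (f z) * ENNReal.ofReal (16 * sg v * jap z ^ 2) := by
            gcongr; unfold kk; exact ENNReal.ofReal_le_ofReal hp
        _ = ENNReal.ofReal (16 * sg v) * ENNReal.ofReal (jap z ^ 2 * f z) := by
            rw [← ENNReal.ofReal_mul (h0 z), ← ENNReal.ofReal_mul (by positivity)]; congr 1; ring
        _ ≤ _ := by
            rw [← add_assoc]; exact le_add_self
  refine key.trans ?_
  rw [lintegral_add_left m1, lintegral_add_left m2, lintegral_const_mul' _ _ ENNReal.ofReal_ne_top,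
    lintegral_const_mul' _ _ ENNReal.ofReal_ne_top, lintegral_const_mul' _ _ ENNReal.ofReal_ne_top]
  refine add_le_add le_rfl ?_
  rw [lintegral_sub_left_eq_self (fun x : E3 => if ‖x‖ < 1 then kk x else 0) v]
  change _ * nearC + _ ≤ _
  have hN : nearC = ENNReal.ofReal nearC.toReal := (ENNReal.ofReal_toReal nearC_lt.ne).symm
  have hNr : 0 ≤ nearC.toReal := ENNReal.toReal_nonneg
  calc _ ≤ ENNReal.ofReal (8 * om v * H) * ENNReal.ofReal nearC.toReal + ENNReal.ofReal (16 * sg v) * ENNReal.ofReal M := by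
        rw [← hN]; gcongr
    _ = ENNReal.ofReal (8 * om v * H * nearC.toReal + 16 * sg v * M) := by
        rw [← ENNReal.ofReal_mul (by positivity), ← ENNReal.ofReal_mul (by positivity), ENNReal.ofReal_add (by positivity) (by positivity)]
    _ ≤ _ := by
        apply ENNReal.ofReal_le_ofReal
        unfold BB
        have := mul_le_mul_of_nonneg_left (om_le_sg v) (show 0 ≤ 8 * H * nearC.toReal by positivity)
        nlinarith

lemma BB_nonneg {H M : ℝ} (hH : 0 ≤ H) (hM : 0 ≤ M) : 0 ≤ BB H M := by
  have hNr : 0 ≤ nearC.toReal := ENNReal.toReal_nonneg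
  unfold BB; positivity

lemma JJ_bound_shift {f : E3 → ℝ} (h0 : ∀ z, 0 ≤ f z) {S : E3 → ℝ≥0∞} (hS : Measurable S)
    {H M : ℝ} (hH : 0 ≤ H) (hM0 : 0 ≤ M)
    (hb : ∀ᵐ z, ENNReal.ofReal (jap z ^ 3 * f z) ≤ S z + ENNReal.ofReal H)
    (hM : ∫⁻ z, ENNReal.ofReal (jap z ^ 2 * f z) ≤ ENNReal.ofReal M) (v y : E3) (hy : ‖y‖ ≤ 1) :
    JJ f (v + y) ≤ ENNReal.ofReal (64 * om v) * II S (v + y) + ENNReal.ofReal (3 * BB H M * sg v) := by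
  refine (JJ_bound h0 hS hH hM0 hb hM (v + y)).trans ?_
  refine add_le_add ?_ ?_
  · refine mul_le_mul_left (ENNReal.ofReal_le_ofReal ?_) _
    have := om_shift v y hy
    linarith
  · apply ENNReal.ofReal_le_ofReal
    have := mul_le_mul_of_nonneg_left (sg_shift v y hy) (BB_nonneg hH hM0)
    linarith

lemma holder_T {G X : E3 → ℝ≥0∞} (hG : Measurable G) (hX : Measurable X) {p q b : ℝ} (hp : 0 ≤ p) (hb : 0 ≤ b)
    (hpq : p * q ≤ b ^ 2)
    (h6 : (∫⁻ v, G v ^ (6:ℝ)) ^ (1/3:ℝ) ≤ ENNReal.ofReal p) (h2 : ∫⁻ v, X v ^ (2:ℝ) ≤ ENNReal.ofReal q) :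
    ∫⁻ v, (G v * X v) ^ (3/2:ℝ) ≤ ENNReal.ofReal b ^ (3/2:ℝ) := by
  have hc : (4:ℝ).HolderConjugate (4/3) := by
    rw [Real.holderConjugate_iff]; norm_num
  have h := ENNReal.lintegral_mul_le_Lp_mul_Lq (μ := volume) hc (f := fun v => G v ^ (3/2:ℝ)) (g := fun v => X v ^ (3/2:ℝ))
    (hG.pow_const _).aemeasurable (hX.pow_const _).aemeasurable
  have e1 : ∀ v, (G v * X v) ^ (3/2:ℝ) = ((fun v => G v ^ (3/2:ℝ)) * (fun v => X v ^ (3/2:ℝ))) v := fun v => by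
    simp only [Pi.mul_apply]; rw [ENNReal.mul_rpow_of_nonneg _ _ (by norm_num)]
  simp_rw [e1]
  refine h.trans ?_
  simp_rw [← ENNReal.rpow_mul]
  norm_num only
  have k1 : (∫⁻ v, G v ^ (6:ℝ)) ^ (1/4:ℝ) ≤ ENNReal.ofReal p ^ (3/4:ℝ) := by
    calc _ = ((∫⁻ v, G v ^ (6:ℝ)) ^ (1/3:ℝ)) ^ (3/4:ℝ) := by rw [← ENNReal.rpow_mul]; norm_num
      _ ≤ _ := ENNReal.rpow_le_rpow h6 (by norm_num)
  have k2 : (∫⁻ v, X v ^ (2:ℝ)) ^ (3/4:ℝ) ≤ ENNReal.ofReal q ^ (3/4:ℝ) := ENNReal.rpow_le_rpow h2 (by norm_num)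
  refine (mul_le_mul' k1 k2).trans ?_
  rw [← ENNReal.mul_rpow_of_nonneg _ _ (by norm_num), ← ENNReal.ofReal_mul hp]
  calc _ ≤ ENNReal.ofReal (b ^ 2) ^ (3/4:ℝ) := ENNReal.rpow_le_rpow (ENNReal.ofReal_le_ofReal hpq) (by norm_num)
    _ = _ := by
      rw [ENNReal.ofReal_pow hb, ← ENNReal.rpow_natCast, ← ENNReal.rpow_mul]; norm_num

lemma hls_shift {S T : E3 → ℝ≥0∞} (hS : Measurable S) (hT : Measurable T) (hf : ∀ z, S z ≠ ∞) (hf' : ∀ z, T z ≠ ∞)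
    {a b : ℝ} (ha : 0 < a) (hb : 0 < b) (h0 : ∫⁻ v, S v ^ (3/2:ℝ) ≤ ENNReal.ofReal a ^ (3/2:ℝ))
    (h1 : ∫⁻ v, T v ^ (3/2:ℝ) ≤ ENNReal.ofReal b ^ (3/2:ℝ)) (y : E3) :
    ∫⁻ v, T v * II S (v + y) ≤ hlsC * ENNReal.ofReal (a * b) := by
  have hSy : Measurable fun z => S (z + y) := hS.comp (by fun_prop)
  have h0' : ∫⁻ v, S (v + y) ^ (3/2:ℝ) ≤ ENNReal.ofReal a ^ (3/2:ℝ) := by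
    rw [lintegral_add_right_eq_self (fun v => S v ^ (3/2:ℝ)) y]; exact h0
  have h := hls hSy hT (fun z => hf _) hf' ha hb h0' h1
  refine le_trans (le_of_eq ?_) h
  rw [lintegral_lintegral_swap]
  · refine lintegral_congr fun v => ?_
    unfold II
    rw [← lintegral_add_right_eq_self (fun z => S z * kk (v + y - z)) y, ← lintegral_const_mul' _ _ (hf' v)]
    refine lintegral_congr fun z => ?_
    rw [add_sub_add_right_eq_sub]; ring
  · refine Measurable.aemeasurable ?_
    exact (hSy.comp measurable_fst).mul ((hT.comp measurable_snd).mul (kk_meas.comp (by fun_prop)))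

lemma spatial1 {g X a f : E3 → ℝ} {S : E3 → ℝ≥0∞} {CS D N η θ H M : ℝ} {y : ℕ → E3}
    (hg : Measurable g) (hX : Measurable X) (hCS : 0 < CS) (hD : 0 < D) (hN : 0 ≤ N) (hη : 0 < η) (hθ : 0 < θ)
    (h6 : (∫⁻ v, ‖sg v * g v‖ₑ ^ (6:ℝ)) ^ (1/3:ℝ) ≤ ENNReal.ofReal (CS * D))
    (h2 : ∫⁻ v, ENNReal.ofReal (om v * X v ^ 2) ≤ ENNReal.ofReal (CE * D))
    (hgN : ∫⁻ v, ENNReal.ofReal (g v ^ 2) ≤ ENNReal.ofReal N)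
    (hy : ∀ n, ‖y n‖ ≤ 1)
    (ha : ∀ v, ENNReal.ofReal |a v| ≤ Filter.liminf (fun n => JJ f v + JJ f (v + y n)) Filter.atTop)
    (h0 : ∀ z, 0 ≤ f z) (hS : Measurable S) (hSf : ∀ z, S z ≠ ∞) (hH : 0 ≤ H) (hM0 : 0 ≤ M)
    (hb : ∀ᵐ z, ENNReal.ofReal (jap z ^ 3 * f z) ≤ S z + ENNReal.ofReal H)
    (hM : ∫⁻ z, ENNReal.ofReal (jap z ^ 2 * f z) ≤ ENNReal.ofReal M)
    (hSη : ∫⁻ v, S v ^ (3/2:ℝ) ≤ ENNReal.ofReal η ^ (3/2:ℝ)) :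
    ∫⁻ v, ENNReal.ofReal |g v * (a v * X v)| ≤
      ENNReal.ofReal (128 * (hlsC.toReal * (η * ((CS + CE) * D))) + (θ * (CE * D) + 9 * BB H M ^ 2 / θ * N)) := by
  have hCE := CE_pos
  set B := BB H M with hBdef
  have hB : 0 ≤ B := BB_nonneg hH hM0
  have msg : Measurable sg := sg_contDiff.continuous.measurable
  have mom : Measurable om := om_cont.measurable
  -- the function T
  let T : E3 → ℝ≥0∞ := fun v => ‖sg v * g v‖ₑ * ‖sg v * X v‖ₑ
  have hT : Measurable T := (msg.mul hg).enorm.mul (msg.mul hX).enorm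
  have hTf : ∀ v, T v ≠ ∞ := fun v => ENNReal.mul_ne_top enorm_ne_top enorm_ne_top
  have hT32 : ∫⁻ v, T v ^ (3/2:ℝ) ≤ ENNReal.ofReal ((CS + CE) * D) ^ (3/2:ℝ) := by
    refine holder_T (msg.mul hg).enorm (msg.mul hX).enorm (p := CS * D) (q := CE * D) (by positivity) (by positivity) ?_ h6 ?_
    · have : 0 ≤ (CS ^ 2 + CS * CE + CE ^ 2) * D ^ 2 := by positivity
      nlinarith
    · refine le_trans (le_of_eq (lintegral_congr fun v => ?_)) h2
      rw [← ofReal_norm, Real.norm_eq_abs, ENNReal.ofReal_rpow_of_nonneg (abs_nonneg _) (by norm_num)]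
      congr 1
      rw [Real.rpow_two, sq_abs, Pi.mul_apply, mul_pow, sg_sq]
  have hT1 : ∀ v, ENNReal.ofReal |g v * X v| * ENNReal.ofReal (64 * om v) = 64 * T v := fun v => by
    have := om_pos v
    have hs := sg_pos v
    rw [← ENNReal.ofReal_mul (abs_nonneg _)]
    simp only [T]
    rw [← enorm_mul, ← ofReal_norm, Real.norm_eq_abs, show (64:ℝ≥0∞) = ENNReal.ofReal 64 by norm_num,
      ← ENNReal.ofReal_mul (by norm_num)]
    congr 1
    rw [show sg v * g v * (sg v * X v) = sg v ^ 2 * (g v * X v) by ring, sg_sq, abs_mul (om v), abs_of_pos this]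
    ring
  -- the bounding functions
  let U : ℕ → E3 → ℝ≥0∞ := fun n v => 64 * (T v * II S (v + 0)) + (64 * (T v * II S (v + y n)) +
    ENNReal.ofReal (6 * B * sg v * |g v * X v|))
  have hU : ∀ n v, ENNReal.ofReal |g v * X v| * (JJ f v + JJ f (v + y n)) ≤ U n v := fun n v => by
    have b1 := JJ_bound_shift h0 hS hH hM0 hb hM v 0 (by simp)
    have b2 := JJ_bound_shift h0 hS hH hM0 hb hM v (y n) (hy n)
    have hs := sg_pos v
    rw [add_zero] at b1
    calc _ ≤ ENNReal.ofReal |g v * X v| * ((ENNReal.ofReal (64 * om v) * II S v + ENNReal.ofReal (3 * B * sg v)) +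
        (ENNReal.ofReal (64 * om v) * II S (v + y n) + ENNReal.ofReal (3 * B * sg v))) := by gcongr
      _ = (ENNReal.ofReal |g v * X v| * ENNReal.ofReal (64 * om v)) * II S v +
          ((ENNReal.ofReal |g v * X v| * ENNReal.ofReal (64 * om v)) * II S (v + y n) +
            ENNReal.ofReal |g v * X v| * (ENNReal.ofReal (3 * B * sg v) + ENNReal.ofReal (3 * B * sg v))) := by ring
      _ = _ := by
        have e3 : |g v * X v| * (3 * B * sg v + 3 * B * sg v) = 6 * B * sg v * |g v * X v| := by ring
        rw [hT1, ← ENNReal.ofReal_add (by positivity) (by positivity), ← ENNReal.ofReal_mul (abs_nonneg _), e3]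
        simp only [U]
        rw [add_zero, mul_assoc 64 (T v) (II S v), mul_assoc 64 (T v)]
  have mI := II_meas hS
  have m1 : ∀ x : E3, Measurable fun v => 64 * (T v * II S (v + x)) := fun x =>
    (hT.mul (mI.comp (by fun_prop))).const_mul _
  have m3 : Measurable fun v => ENNReal.ofReal (6 * B * sg v * |g v * X v|) := by
    refine ENNReal.measurable_ofReal.comp ?_
    fun_prop
  have mU : ∀ n, Measurable (U n) := fun n => (m1 0).add ((m1 (y n)).add m3)
  -- the third term
  have hI3 : ∫⁻ v, ENNReal.ofReal (6 * B * sg v * |g v * X v|) ≤ ENNReal.ofReal (θ * (CE * D) + 9 * B ^ 2 / θ * N) := by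
    have mq : Measurable fun v => ENNReal.ofReal θ * ENNReal.ofReal (om v * X v ^ 2) := by
      refine Measurable.const_mul (ENNReal.measurable_ofReal.comp ?_) _
      fun_prop
    calc _ ≤ ∫⁻ v, (ENNReal.ofReal θ * ENNReal.ofReal (om v * X v ^ 2) + ENNReal.ofReal (9 * B ^ 2 / θ) * ENNReal.ofReal (g v ^ 2)) := by
          refine lintegral_mono fun v => ?_
          have := om_pos v
          rw [← ENNReal.ofReal_mul hθ.le, ← ENNReal.ofReal_mul (by positivity), ← ENNReal.ofReal_add (by positivity) (by positivity)]
          apply ENNReal.ofReal_le_ofReal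
          rw [← sg_sq, abs_mul, ← sq_abs (X v), ← sq_abs (g v)]
          have h := sq_nonneg (θ * (sg v * |X v|) - 3 * B * |g v|)
          rw [← sub_nonneg]
          have : θ * (sg v ^ 2 * |X v| ^ 2) + 9 * B ^ 2 / θ * |g v| ^ 2 - 6 * B * sg v * (|g v| * |X v|) =
            (θ * (sg v * |X v|) - 3 * B * |g v|) ^ 2 / θ := by field_simp; ring
          rw [this]; positivity
      _ ≤ _ := by
          rw [lintegral_add_left mq, lintegral_const_mul' _ _ ENNReal.ofReal_ne_top, lintegral_const_mul' _ _ ENNReal.ofReal_ne_top,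
            ENNReal.ofReal_add (by positivity) (by positivity), ENNReal.ofReal_mul (p := θ) hθ.le, ENNReal.ofReal_mul (p := 9 * B ^ 2 / θ) (by positivity)]
          exact add_le_add (mul_le_mul_right h2 _) (mul_le_mul_right hgN _)
  have hQ : hlsC * ENNReal.ofReal (η * ((CS + CE) * D)) = ENNReal.ofReal (hlsC.toReal * (η * ((CS + CE) * D))) := by
    rw [ENNReal.ofReal_mul ENNReal.toReal_nonneg, ENNReal.ofReal_toReal hlsC_lt.ne]
  have hr : 0 ≤ hlsC.toReal := ENNReal.toReal_nonneg
  have hIU : ∀ n, ∫⁻ v, U n v ≤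
      ENNReal.ofReal (128 * (hlsC.toReal * (η * ((CS + CE) * D))) + (θ * (CE * D) + 9 * B ^ 2 / θ * N)) := fun n => by
    have k := hls_shift hS hT hSf hTf hη (b := (CS + CE) * D) (by positivity) hSη hT32
    rw [hQ] at k
    rw [lintegral_add_left (m1 0), lintegral_add_left (m1 (y n)), lintegral_const_mul' _ _ (by norm_num), lintegral_const_mul' _ _ (by norm_num)]
    refine (add_le_add (mul_le_mul_right (k 0) 64) (add_le_add (mul_le_mul_right (k (y n)) 64) hI3)).trans (le_of_eq ?_)
    rw [show (64:ℝ≥0∞) = ENNReal.ofReal 64 by norm_num, ← ENNReal.ofReal_mul (by norm_num),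
      ← ENNReal.ofReal_add (by positivity) (by positivity), ← ENNReal.ofReal_add (by positivity) (by positivity)]
    congr 1; ring
  calc _ ≤ ∫⁻ v, Filter.liminf (fun n => U n v) Filter.atTop := by
        refine lintegral_mono fun v => ?_
        rw [show g v * (a v * X v) = (g v * X v) * a v by ring, abs_mul, ENNReal.ofReal_mul (abs_nonneg _)]
        refine (mul_le_mul_right (ha v) _).trans ?_
        have := ENNReal.le_liminf_mul (f := Filter.atTop) (u := fun _ : ℕ => ENNReal.ofReal |g v * X v|)
          (v := fun n => JJ f v + JJ f (v + y n))
        rw [Filter.liminf_const] at this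
        exact this.trans (Filter.liminf_le_liminf (.of_forall fun n => hU n v))
    _ ≤ Filter.liminf (fun n => ∫⁻ v, U n v) Filter.atTop := lintegral_liminf_le mU
    _ ≤ _ := by
        refine (Filter.liminf_le_liminf (.of_forall hIU)).trans ?_
        rw [Filter.liminf_const]

lemma pd_const_mul (i : Fin 3) (c : ℝ) (φ : E3 → ℝ) : pd i (fun v => c * φ v) = fun v => c * pd i φ v := by
  funext v
  unfold pd
  rw [show (fun v => c * φ v) = c • φ from rfl, fderiv_const_smul_field]
  simp

def c4 : ℝ := 1 / (4 * Real.pi)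

lemma c4_pos : 0 < c4 := by unfold c4; positivity
lemma c4_le : c4 ≤ 1 := by
  unfold c4
  have := Real.pi_gt_three
  rw [div_le_one (by positivity)]; linarith

lemma besselM_eq (h : E3 → ℝ) : besselM h = fun v => c4 * cv bK h v := by
  funext v
  unfold besselM c4 cv bK
  congr 1
  exact integral_congr_ae (.of_forall fun z => by simp only [smul_eq_mul]; ring)

lemma besselM_dec1 {C : ℝ} {h : E3 → ℝ} (hh : Dec C h) : Dec1 (Ckb * C) (besselM h) := by
  have k := cv_dec1 hh
  rw [besselM_eq]
  have hc := c4_pos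
  have hc1 := c4_le
  refine ⟨contDiff_const.mul k.1, fun v => ?_, fun v => ?_⟩
  · rw [abs_mul, abs_of_pos hc]
    calc _ ≤ 1 * |cv bK h v| := by gcongr
      _ ≤ _ := by rw [one_mul]; exact k.2.1 v
  · rw [show (fun v => c4 * cv bK h v) = c4 • cv bK h from rfl, fderiv_const_smul_field, Pi.smul_apply, norm_smul,
      Real.norm_of_nonneg hc.le]
    calc _ ≤ 1 * ‖fderiv ℝ (cv bK h) v‖ := by gcongr
      _ ≤ _ := by rw [one_mul]; exact k.2.2 v

def DD (g : E3 → ℝ) : ℝ := (∫ v, om v * gradNormSq g v) + ∫ v, g v ^ 2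

lemma X_bound {C : ℝ} {g : E3 → ℝ} (h : Dec1 C g) (i j m : Fin 3) :
    ∫⁻ v, ENNReal.ofReal (om v * (pd m (pd j (pd i (besselM g))) v) ^ 2) ≤ ENNReal.ofReal (CE * DD g) := by
  have e : pd m (pd j (pd i (besselM g))) = fun v => c4 * pd m (pd j (cv bK (pd i g))) v := by
    rw [besselM_eq, pd_const_mul, show pd i (cv bK g) = cv bK (pd i g) from funext (pd_cv h i), pd_const_mul, pd_const_mul]
  rw [e]
  have hc := c4_pos
  have hc1 := c4_le
  calc _ ≤ ∫⁻ v, ENNReal.ofReal (om v * (pd m (pd j (cv bK (pd i g))) v) ^ 2) := by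
        refine lintegral_mono fun v => ENNReal.ofReal_le_ofReal ?_
        have := om_pos v
        refine mul_le_mul_of_nonneg_left ?_ this.le
        rw [mul_pow]
        exact mul_le_of_le_one_left (sq_nonneg _) (pow_le_one₀ hc.le hc1)
    _ ≤ _ := energy_pd (h.pd_dec i) j m
    _ ≤ _ := by
        apply ENNReal.ofReal_le_ofReal
        refine mul_le_mul_of_nonneg_left ?_ CE_pos.le
        unfold DD
        have h1 : ∫ v, om v * (pd i g v) ^ 2 ≤ ∫ v, om v * gradNormSq g v := by
          refine integral_mono (integrable_om_sq (h.pd_dec i)) (integrable_om_grad h) fun v => ?_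
          refine mul_le_mul_of_nonneg_left ?_ (om_pos v).le
          exact Finset.single_le_sum (f := fun i => (pd i g v) ^ 2) (fun i _ => sq_nonneg _) (Finset.mem_univ i)
        have h2 : 0 ≤ ∫ v, g v ^ 2 := integral_nonneg fun v => sq_nonneg _
        linarith

/-- hypotheses on the density at a fixed time -/
def GoodF (f : E3 → ℝ) (η H M : ℝ) : Prop :=
  Integrable f ∧ (∀ z, 0 ≤ f z) ∧ (∫⁻ z, ENNReal.ofReal (jap z ^ 2 * f z) ≤ ENNReal.ofReal M) ∧
  ∃ S : E3 → ℝ≥0∞, Measurable S ∧ (∀ z, S z ≠ ∞) ∧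
    (∀ᵐ z, ENNReal.ofReal (jap z ^ 3 * f z) ≤ S z + ENNReal.ofReal H) ∧
    ∫⁻ v, S v ^ (3/2:ℝ) ≤ ENNReal.ofReal η ^ (3/2:ℝ)

lemma DD_nonneg (g : E3 → ℝ) : 0 ≤ DD g :=
  add_nonneg (integral_nonneg fun v => mul_nonneg (om_pos v).le (gradNormSq_nonneg g v)) (integral_nonneg fun v => sq_nonneg _)

def bnd (CS η θ B : ℝ) (g : E3 → ℝ) : ℝ :=
  128 * (hlsC.toReal * (η * ((CS + CE) * DD g))) + (θ * (CE * DD g) + 9 * B ^ 2 / θ * ∫ v, g v ^ 2)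

lemma spatial2 {CS : ℝ} (hCS : 0 < CS)
    (hsob : ∀ (C : ℝ) (g : E3 → ℝ), Dec1 C g → (∫⁻ v, ‖sg v * g v‖ₑ ^ (6:ℝ)) ^ (1/3:ℝ) ≤
      ENNReal.ofReal (CS * ((∫ v, om v * gradNormSq g v) + ∫ v, g v ^ 2)))
    {f : E3 → ℝ} {η H M θ : ℝ} (hη : 0 < η) (hθ : 0 < θ) (hH : 0 ≤ H) (hM : 0 ≤ M) (hf : GoodF f η H M)
    {C : ℝ} {g : E3 → ℝ} (h : Dec1 C g) (i j m : Fin 3) :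
    ∫⁻ v, ENNReal.ofReal |g v * (pd i (fun u => LandauA f u j m) v * pd m (pd j (pd i (besselM g))) v)| ≤
      ENNReal.ofReal (bnd CS η θ (BB H M) g) := by
  have hX := X_bound h i j m
  set X := pd m (pd j (pd i (besselM g))) with hXdef
  have mX : Measurable X := pd_meas _ _
  obtain ⟨hfi, hf0, hfM, S, mS, hSf, hSb, hSη⟩ := hf
  rcases (DD_nonneg g).eq_or_lt with hD | hD
  · rw [← hD] at hX
    simp only [mul_zero, ENNReal.ofReal_zero, nonpos_iff_eq_zero] at hX
    rw [lintegral_eq_zero_iff (by have := om_cont.measurable; fun_prop)] at hX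
    refine le_trans (le_of_eq ?_) zero_le
    rw [lintegral_eq_zero_iff']
    · filter_upwards [hX] with v hv
      have := om_pos v
      have : X v = 0 := by
        simp only [Pi.zero_apply, ENNReal.ofReal_eq_zero] at hv
        by_contra hne
        have : 0 < om v * X v ^ 2 := by positivity
        linarith
      simp [this]
    · have m1 := h.1.continuous.measurable
      have m2 := pd_meas i (fun u => LandauA f u j m)
      exact (ENNReal.measurable_ofReal.comp (by fun_prop)).aemeasurable
  · refine spatial1 (y := fun n : ℕ => (1 / ((n:ℝ) + 1)) • EuclideanSpace.single i 1) h.1.continuous.measurable mX hCS hD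
      (integral_nonneg fun v => sq_nonneg _) hη hθ (hsob C g h) hX ?_ ?_ (pd_LandauA hfi hf0 i j m) hf0 mS hSf hH hM hSb hfM hSη
    · rw [← ofReal_integral_eq_lintegral_ofReal (integrable_sq h.dec) (.of_forall fun v => sq_nonneg _)]
    · intro n
      rw [norm_smul, norm_e, mul_one, Real.norm_of_nonneg (by positivity), div_le_one (by positivity)]
      have : (0:ℝ) ≤ n := n.cast_nonneg
      linarith

lemma bnd_nonneg {CS η θ B : ℝ} {g : E3 → ℝ} (hCS : 0 < CS) (hη : 0 < η) (hθ : 0 < θ) : 0 ≤ bnd CS η θ B g := by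
  have := CE_pos
  have := DD_nonneg g
  have : 0 ≤ hlsC.toReal := ENNReal.toReal_nonneg
  have h2 : 0 ≤ ∫ v, g v ^ 2 := integral_nonneg fun v => sq_nonneg _
  unfold bnd; positivity

lemma spatial3 {CS : ℝ} (hCS : 0 < CS)
    (hsob : ∀ (C : ℝ) (g : E3 → ℝ), Dec1 C g → (∫⁻ v, ‖sg v * g v‖ₑ ^ (6:ℝ)) ^ (1/3:ℝ) ≤
      ENNReal.ofReal (CS * ((∫ v, om v * gradNormSq g v) + ∫ v, g v ^ 2)))
    {f : E3 → ℝ} {η H M θ : ℝ} (hη : 0 < η) (hθ : 0 < θ) (hH : 0 ≤ H) (hM : 0 ≤ M) (hf : GoodF f η H M)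
    {C : ℝ} {g : E3 → ℝ} (h : Dec1 C g) :
    |∫ v, g v * ∑ i, ∑ j, ∑ m, pd i (fun u => LandauA f u j m) v * pd m (pd j (pd i (besselM g))) v| ≤
      27 * bnd CS η θ (BB H M) g := by
  have hb := bnd_nonneg (g := g) (B := BB H M) hCS hη hθ
  let Y : Fin 3 → Fin 3 → Fin 3 → E3 → ℝ≥0∞ := fun i j m v =>
    ENNReal.ofReal |g v * (pd i (fun u => LandauA f u j m) v * pd m (pd j (pd i (besselM g))) v)|
  have mY : ∀ i j m, Measurable (Y i j m) := fun i j m => by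
    have m1 := h.1.continuous.measurable
    have m2 := pd_meas i (fun u => LandauA f u j m)
    have m3 := pd_meas m (pd j (pd i (besselM g)))
    exact ENNReal.measurable_ofReal.comp (by fun_prop)
  rw [← ENNReal.ofReal_le_ofReal_iff (by positivity), ← Real.norm_eq_abs, ofReal_norm]
  refine (enorm_integral_le_lintegral_enorm _).trans ?_
  calc _ ≤ ∫⁻ v, ∑ i, ∑ j, ∑ m, Y i j m v := by
        refine lintegral_mono fun v => ?_
        simp only [Finset.mul_sum, Y]
        refine (enorm_sum_le _ _).trans (Finset.sum_le_sum fun i _ => ?_)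
        refine (enorm_sum_le _ _).trans (Finset.sum_le_sum fun j _ => ?_)
        refine (enorm_sum_le _ _).trans (Finset.sum_le_sum fun m _ => ?_)
        rw [← ofReal_norm, Real.norm_eq_abs]
    _ = ∑ i, ∑ j, ∑ m, ∫⁻ v, Y i j m v := by
        rw [lintegral_finsetSum _ fun i _ => Finset.measurable_fun_sum _ fun j _ => Finset.measurable_fun_sum _ fun m _ => mY i j m]
        refine Finset.sum_congr rfl fun i _ => ?_
        rw [lintegral_finsetSum _ fun j _ => Finset.measurable_fun_sum _ fun m _ => mY i j m]
        refine Finset.sum_congr rfl fun j _ => ?_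
        rw [lintegral_finsetSum _ fun m _ => mY i j m]
    _ ≤ ∑ i : Fin 3, ∑ j : Fin 3, ∑ m : Fin 3, ENNReal.ofReal (bnd CS η θ (BB H M) g) :=
        Finset.sum_le_sum fun i _ => Finset.sum_le_sum fun j _ => Finset.sum_le_sum fun m _ =>
          spatial2 hCS hsob hη hθ hH hM hf h i j m
    _ = _ := by
        simp only [Finset.sum_const, Finset.card_univ, Fintype.card_fin, nsmul_eq_mul]
        rw [ENNReal.ofReal_mul (by norm_num)]
        norm_num
        ring

lemma p32_toReal : (3 / 2 : ℝ≥0∞).toReal = 3 / 2 := by simp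

lemma lint32 (u : E3 → ℝ) : ∫⁻ v, ‖u v‖ₑ ^ (3/2:ℝ) = (eLpNorm u (3/2) volume) ^ (3/2:ℝ) := by
  rw [eLpNorm_eq_lintegral_rpow_enorm_toReal (by simp) (by finiteness), p32_toReal, ← ENNReal.rpow_mul]
  norm_num

lemma young32 {a x : ℝ} (ha : 0 < a) (hx : 0 ≤ x) : a * x ≤ a ^ 3 + x ^ (3/2:ℝ) := by
  have h32 : x ^ (3/2:ℝ) = x * Real.sqrt x := by
    rw [Real.sqrt_eq_rpow, ← Real.rpow_one_add' hx (by norm_num)]; norm_num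
  have hs := Real.sqrt_nonneg x
  have hss := Real.sq_sqrt hx
  rw [h32]
  rcases le_total x (a ^ 2) with h | h
  · have : a * x ≤ a * a ^ 2 := by gcongr
    nlinarith [mul_nonneg hx hs]
  · have : a ≤ Real.sqrt x := Real.le_sqrt_of_sq_le h
    nlinarith [pow_pos ha 3]

lemma goodF_one {k₀ : ℝ} (hk₀ : 5 ≤ k₀) {f : E3 → ℝ} (h0 : ∀ z, 0 ≤ f z) (hi : Integrable f)
    {G : E3 → ℝ} (mG : Measurable G) (hG : G =ᵐ[volume] fun v => jap v ^ k₀ * f v)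
    {s : E3 → ℝ} (ms : Measurable s) {η H M : ℝ} (hs : ∀ v, |s v| ≤ H)
    (hη : eLpNorm (G - s) (3/2) volume ≤ ENNReal.ofReal η)
    (hM : eLpNorm G (3/2) volume ^ (3/2:ℝ) ≤ ENNReal.ofReal M) (hM0 : 0 ≤ M) :
    GoodF f η H ((∫ v : E3, (jap v ^ 4)⁻¹) + M) := by
  have hk : ∀ v, jap v ^ 5 ≤ jap v ^ k₀ := fun v => by
    rw [← Real.rpow_natCast]
    exact Real.rpow_le_rpow_of_exponent_le (one_le_jap v) (by norm_num; exact hk₀)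
  have hH : 0 ≤ H := (abs_nonneg _).trans (hs 0)
  refine ⟨hi, h0, ?_, fun v => ‖G v - s v‖ₑ, (mG.sub ms).enorm, fun z => enorm_ne_top, ?_, ?_⟩
  · have h1 : ∫⁻ z, ENNReal.ofReal (jap z ^ 2 * f z) ≤ ∫⁻ z, (ENNReal.ofReal ((jap z ^ 4)⁻¹) + ‖G z‖ₑ ^ (3/2:ℝ)) := by
      refine lintegral_mono_ae ?_
      filter_upwards [hG] with z hz
      have hj := jap_pos z
      have hp : 0 ≤ jap z ^ k₀ * f z := mul_nonneg (by positivity) (h0 z)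
      rw [hz, ← ofReal_norm, Real.norm_of_nonneg hp, ENNReal.ofReal_rpow_of_nonneg hp (by norm_num),
        ← ENNReal.ofReal_add (by positivity) (by positivity)]
      apply ENNReal.ofReal_le_ofReal
      have y := young32 (om_pos z) hp
      have a1 : jap z ^ 2 * f z ≤ om z * (jap z ^ k₀ * f z) := by
        rw [← mul_assoc]
        refine mul_le_mul_of_nonneg_right ?_ (h0 z)
        calc jap z ^ 2 = om z * jap z ^ 5 := by unfold om; field_simp
          _ ≤ _ := mul_le_mul_of_nonneg_left (hk z) (om_pos z).le
      have a2 : om z ^ 3 ≤ (jap z ^ 4)⁻¹ := by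
        unfold om
        rw [← inv_pow, ← inv_pow, ← pow_mul]
        exact pow_le_pow_of_le_one (by positivity) (inv_le_one_of_one_le₀ (one_le_jap z)) (by norm_num)
      linarith
    refine h1.trans ?_
    have hj : ∀ z : E3, 0 ≤ (jap z ^ 4)⁻¹ := fun z => (jap4_inv_pos z).le
    rw [lintegral_add_right _ (mG.enorm.pow_const _), lint32, ENNReal.ofReal_add (integral_nonneg hj) hM0,
      ← ofReal_integral_eq_lintegral_ofReal integrable_jap4 (.of_forall hj)]
    gcongr
  · filter_upwards [hG] with z hz
    have hj := jap_pos z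
    rw [← ofReal_norm, Real.norm_eq_abs, ← ENNReal.ofReal_add (abs_nonneg _) hH]
    apply ENNReal.ofReal_le_ofReal
    have a1 : jap z ^ 3 * f z ≤ G z := by
      rw [hz]
      refine mul_le_mul_of_nonneg_right (le_trans ?_ (hk z)) (h0 z)
      exact pow_le_pow_right₀ (one_le_jap z) (by norm_num)
    have := le_abs_self (G z - s z)
    have := (le_abs_self (s z)).trans (hs z)
    linarith
  · have := lint32 (G - s)
    simp only [Pi.sub_apply] at this
    rw [this]
    exact ENNReal.rpow_le_rpow hη (by norm_num)

lemma goodF_ex {k₀ T₀ : ℝ} (hk₀ : 5 ≤ k₀) (hT₀ : 0 < T₀)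
    {f : ℝ → E3 → ℝ}
    (hf_nonneg : ∀ t ∈ Icc (0 : ℝ) T₀, ∀ v, 0 ≤ f t v)
    (hf_int : ∀ t ∈ Icc (0 : ℝ) T₀, Integrable (f t) volume)
    {F : ℝ → Lp ℝ (3 / 2 : ℝ≥0∞) (volume : Measure E3)}
    (hF_cont : ContinuousOn F (Icc 0 T₀))
    (hF_eq : ∀ t ∈ Icc (0 : ℝ) T₀, ⇑(F t) =ᵐ[volume] fun v => jap v ^ k₀ * f t v)
    {η : ℝ} (hη : 0 < η) :
    ∃ ts ∈ Ioc (0 : ℝ) T₀, ∃ H M : ℝ, 0 ≤ H ∧ 0 ≤ M ∧ ∀ t ∈ Icc (0:ℝ) ts, GoodF (f t) η H M := by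
  have z0 : (0:ℝ) ∈ Icc 0 T₀ := ⟨le_rfl, hT₀.le⟩
  obtain ⟨s, hs, -⟩ := (Lp.memLp (F 0)).exists_simpleFunc_eLpNorm_sub_lt (by finiteness)
    (ε := ENNReal.ofReal (η / 2)) (by simpa using hη)
  obtain ⟨H, hH⟩ := s.exists_forall_norm_le
  have hc := Metric.continuousWithinAt_iff.1 (hF_cont 0 z0) (η / 2) (by positivity)
  obtain ⟨δ, hδ, hc⟩ := hc
  set A := eLpNorm (F 0) (3/2) volume with hA
  have hAt : A ≠ ∞ := (Lp.eLpNorm_lt_top (F 0)).ne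
  set B := (ENNReal.ofReal (η / 2) + A) ^ (3/2:ℝ) with hB
  have hBt : B ≠ ∞ := ENNReal.rpow_ne_top_of_nonneg (by norm_num) (by finiteness)
  refine ⟨min T₀ (δ / 2), ⟨by positivity, min_le_left _ _⟩, H, (∫ v : E3, (jap v ^ 4)⁻¹) + B.toReal,
    (norm_nonneg _).trans (hH 0), add_nonneg (integral_nonneg fun z => (jap4_inv_pos z).le) ENNReal.toReal_nonneg, fun t ht => ?_⟩
  have ht0 : t ∈ Icc 0 T₀ := ⟨ht.1, ht.2.trans (min_le_left _ _)⟩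
  have hd := hc ht0 (by
    rw [Real.dist_eq, sub_zero, abs_of_nonneg ht.1]
    have := ht.2.trans (min_le_right _ _)
    linarith)
  have hd2 : eLpNorm (⇑(F t) - ⇑(F 0)) (3/2) volume ≤ ENNReal.ofReal (η / 2) := by
    rw [← Lp.edist_def, edist_dist]; exact ENNReal.ofReal_le_ofReal hd.le
  have mF : ∀ t, AEStronglyMeasurable (F t) volume := fun t => (Lp.stronglyMeasurable (F t)).aestronglyMeasurable
  refine goodF_one hk₀ (hf_nonneg t ht0) (hf_int t ht0) (Lp.stronglyMeasurable (F t)).measurable (hF_eq t ht0)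
    s.measurable hH ?_ ?_ ENNReal.toReal_nonneg
  · have e : ⇑(F t) - ⇑s = (⇑(F t) - ⇑(F 0)) + (⇑(F 0) - ⇑s) := by abel
    rw [e]
    refine (eLpNorm_add_le ((mF t).sub (mF 0)) ((mF 0).sub s.measurable.aestronglyMeasurable) (Fact.out)).trans ?_
    refine (add_le_add hd2 hs.le).trans ?_
    rw [← ENNReal.ofReal_add (by positivity) (by positivity), add_halves]
  · rw [ENNReal.ofReal_toReal hBt]
    refine ENNReal.rpow_le_rpow ?_ (by norm_num)
    have e : ⇑(F t) = (⇑(F t) - ⇑(F 0)) + ⇑(F 0) := by abel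
    rw [e]
    exact (eLpNorm_add_le ((mF t).sub (mF 0)) (mF 0) (Fact.out)).trans (add_le_add hd2 le_rfl)

lemma niceW_dec {T₀ : ℝ} {w : ℝ → E3 → ℝ} (hw : NiceW T₀ w) : ∃ C : ℝ, ∀ t ∈ Icc (0:ℝ) T₀, Dec C (w t) := by
  obtain ⟨C, hC⟩ := hw.2 [] 4
  refine ⟨C, fun t ht => ⟨?_, fun v => ?_⟩⟩
  · have h := hw.1 []
    have : Continuous fun v : E3 => ((t, v) : ℝ × E3) := by fun_prop
    exact h.comp this
  · have := hC t ht v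
    have hj := jap_pos v
    rw [← div_eq_mul_inv, le_div_iff₀ (by positivity), mul_comm]
    exact this

lemma w_meas {T₀ : ℝ} {w : ℝ → E3 → ℝ} (hw : NiceW T₀ w) : Measurable fun p : ℝ × E3 => w p.1 p.2 :=
  (hw.1 []).measurable

lemma cvt_meas {T₀ : ℝ} {w : ℝ → E3 → ℝ} (hw : NiceW T₀ w) {κ : E3 → ℝ} (hκ : Measurable κ) :
    StronglyMeasurable fun p : ℝ × E3 => ∫ z, w p.1 z * κ (p.2 - z) := by
  refine StronglyMeasurable.integral_prod_right' (f := fun q : (ℝ × E3) × E3 => w q.1.1 q.2 * κ (q.1.2 - q.2)) ?_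
  refine Measurable.stronglyMeasurable ?_
  have m1 : Measurable fun q : (ℝ × E3) × E3 => w q.1.1 q.2 :=
    (w_meas hw).comp (by fun_prop : Measurable fun q : (ℝ × E3) × E3 => (q.1.1, q.2))
  exact m1.mul (hκ.comp (by fun_prop))

lemma pd_besselM {C : ℝ} {h : E3 → ℝ} (hh : Dec C h) (i : Fin 3) (v : E3) :
    pd i (besselM h) v = c4 * ∫ z, h z * (bk (v - z) * inner ℝ (v - z) (EuclideanSpace.single i 1)) := by
  rw [besselM_eq, pd_const_mul]
  unfold pd
  beta_reduce
  rw [cv_fderiv_apply hh]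

lemma jap4_sq_le (v : E3) : ((jap v ^ 4)⁻¹) ^ 2 ≤ (jap v ^ 4)⁻¹ := by
  have := jap4_inv_pos v
  have := jap4_inv_le_one v
  nlinarith

lemma l_int {T₀ T : ℝ} (hT : T ≤ T₀) {w : ℝ → E3 → ℝ} (hw : NiceW T₀ w) :
    IntegrableOn (fun t => ∫ v, (besselM (w t) v) ^ 2) (Ioo 0 T) := by
  obtain ⟨C, hC⟩ := niceW_dec hw
  have m : StronglyMeasurable fun t => ∫ v, (besselM (w t) v) ^ 2 := by
    refine StronglyMeasurable.integral_prod_right' (f := fun q : ℝ × E3 => (besselM (w q.1) q.2) ^ 2) ?_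
    have := cvt_meas hw bK_meas
    simp_rw [besselM_eq]
    exact (stronglyMeasurable_const.mul this).pow 2
  refine Measure.integrableOn_of_bounded (M := (Ckb * C) ^ 2 * ∫ v : E3, (jap v ^ 4)⁻¹) (by simp) m.aestronglyMeasurable ?_
  refine (ae_restrict_iff' measurableSet_Ioo).2 (.of_forall fun t ht => ?_)
  have h := (besselM_dec1 (hC t ⟨ht.1.le, ht.2.le.trans hT⟩)).dec
  rw [Real.norm_of_nonneg (integral_nonneg fun v => sq_nonneg _), ← integral_const_mul]
  refine integral_mono (integrable_sq h) (integrable_jap4.const_mul _) fun v => ?_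
  refine (sq_le_dec h v).trans ?_
  exact mul_le_mul_of_nonneg_left (jap4_sq_le v) (sq_nonneg _)

lemma d_int {T₀ T : ℝ} (hT : T ≤ T₀) {w : ℝ → E3 → ℝ} (hw : NiceW T₀ w) :
    IntegrableOn (fun t => ∫ v, om v * gradNormSq (besselM (w t)) v) (Ioo 0 T) := by
  obtain ⟨C, hC⟩ := niceW_dec hw
  have mk : ∀ i : Fin 3, Measurable fun x : E3 => bk x * inner ℝ x (EuclideanSpace.single i (1:ℝ)) := fun i =>
    bk_meas.mul (by fun_prop)
  let q : ℝ → E3 → ℝ := fun t v => om v * ∑ i : Fin 3,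
    (c4 * ∫ z, w t z * (bk (v - z) * inner ℝ (v - z) (EuclideanSpace.single i (1:ℝ)))) ^ 2
  have m : StronglyMeasurable fun t => ∫ v, q t v := by
    refine StronglyMeasurable.integral_prod_right' (f := fun p : ℝ × E3 => q p.1 p.2) ?_
    refine Measurable.stronglyMeasurable ?_
    refine (om_cont.measurable.comp measurable_snd).mul ?_
    refine Finset.measurable_fun_sum _ fun i _ => ?_
    exact ((cvt_meas hw (mk i)).measurable.const_mul c4).pow_const 2
  have e : ∀ t ∈ Ioo 0 T, ∫ v, q t v = ∫ v, om v * gradNormSq (besselM (w t)) v := fun t ht => by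
    refine integral_congr_ae (.of_forall fun v => ?_)
    simp only [q, gradNormSq]
    congr 1
    refine Finset.sum_congr rfl fun i _ => ?_
    rw [pd_besselM (hC t ⟨ht.1.le, ht.2.le.trans hT⟩)]
  refine IntegrableOn.congr_fun ?_ e measurableSet_Ioo
  refine Measure.integrableOn_of_bounded (M := 3 * (Ckb * C) ^ 2 * ∫ v : E3, (jap v ^ 4)⁻¹) (by simp) m.aestronglyMeasurable ?_
  refine (ae_restrict_iff' measurableSet_Ioo).2 (.of_forall fun t ht => ?_)
  have h := besselM_dec1 (hC t ⟨ht.1.le, ht.2.le.trans hT⟩)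
  rw [e t ht, Real.norm_of_nonneg (integral_nonneg fun v => mul_nonneg (om_pos v).le (gradNormSq_nonneg _ v)), ← integral_const_mul]
  refine integral_mono (integrable_om_grad h) (integrable_jap4.const_mul _) fun v => ?_
  have hb : gradNormSq (besselM (w t)) v ≤ 3 * (Ckb * C) ^ 2 * (jap v ^ 4)⁻¹ := by
    unfold gradNormSq
    have : ∀ i : Fin 3, (pd i (besselM (w t)) v) ^ 2 ≤ (Ckb * C) ^ 2 * (jap v ^ 4)⁻¹ := fun i =>
      (sq_le_dec (h.pd_dec i) v).trans (mul_le_mul_of_nonneg_left (jap4_sq_le v) (sq_nonneg _))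
    refine (Finset.sum_le_sum fun i _ => this i).trans (le_of_eq ?_)
    simp; ring
  calc _ ≤ 1 * gradNormSq (besselM (w t)) v := mul_le_mul_of_nonneg_right (om_le_one v) (gradNormSq_nonneg _ v)
    _ ≤ _ := by rw [one_mul]; exact hb

lemma dissT_eq (w : ℝ → E3 → ℝ) (T : ℝ) : dissT w T = ∫ t in Ioo (0:ℝ) T, ∫ v, om v * gradNormSq (besselM (w t)) v := by
  unfold dissT
  have : ∀ v : E3, jap v ^ (-(3:ℝ)) = om v := fun v => by
    rw [Real.rpow_neg (jap_pos v).le]; unfold om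
    norm_cast
  simp_rw [this]
/-- Lemma 3.2: estimate of the first commutator term
`Int(I₁₂⁽¹⁾)(T) = −∫₀ᵀ∫ 𝓜w · Σᵢ Tr(∂ᵢA[f] · Hess(∂ᵢ𝓜²w)) dv dt`. -/
theorem int_I12_one_estimate (k₀ T₀ : ℝ) (hk₀ : 5 ≤ k₀) (hT₀ : 0 < T₀)
    (f : ℝ → EuclideanSpace ℝ (Fin 3) → ℝ)
    (hf_nonneg : ∀ t ∈ Icc (0 : ℝ) T₀, ∀ v, 0 ≤ f t v)
    (hf_mass : ∀ t ∈ Icc (0 : ℝ) T₀, Integrable (f t) volume ∧ ∫ v, |f t v| = 1)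
    (F : ℝ → Lp ℝ (3 / 2 : ℝ≥0∞) (volume : Measure (EuclideanSpace ℝ (Fin 3))))
    (hF_cont : ContinuousOn F (Icc 0 T₀))
    (hF_eq : ∀ t ∈ Icc (0 : ℝ) T₀, ⇑(F t) =ᵐ[volume] fun v => jap v ^ k₀ * f t v)
    (w : ℝ → EuclideanSpace ℝ (Fin 3) → ℝ) (hw : NiceW T₀ w)
    (ε₀ : ℝ) (hε₀ : 0 < ε₀) :
    ∃ ts ∈ Ioc (0 : ℝ) T₀, ∃ C > 0, ∀ T ∈ Ioc (0 : ℝ) ts,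
      -(∫ t in Ioo (0 : ℝ) T, ∫ v, besselM (w t) v *
          ∑ i, ∑ j, ∑ m, pd i (fun u => LandauA (f t) u j m) v *
            pd m (pd j (pd i (besselM (besselM (w t))))) v)
        ≤ ε₀ * dissT w T + C * l2T w T := by
  obtain ⟨CS, hCS, hsob⟩ := sobolev
  have hCE := CE_pos
  have hr : 0 ≤ hlsC.toReal := ENNReal.toReal_nonneg
  set R : ℝ := hlsC.toReal * (CS + CE) + 1 with hR
  have hR0 : 0 < R := by positivity
  set η : ℝ := ε₀ / (54 * 128 * R) with hη
  have hη0 : 0 < η := by positivity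
  set θ : ℝ := ε₀ / (54 * CE) with hθ
  have hθ0 : 0 < θ := by positivity
  obtain ⟨ts, hts, H, M, hH, hM, hgood⟩ := goodF_ex hk₀ hT₀ hf_nonneg (fun t ht => (hf_mass t ht).1) hF_cont hF_eq hη0
  obtain ⟨Cw, hCw⟩ := niceW_dec hw
  set B := BB H M with hB
  refine ⟨ts, hts, ε₀ + 243 * B ^ 2 / θ, by positivity, fun T hT => ?_⟩
  have hTT : T ≤ T₀ := hT.2.trans hts.2
  have hl := l_int hTT hw
  have hd := d_int hTT hw
  have l0 : ∀ t, 0 ≤ ∫ v, (besselM (w t) v) ^ 2 := fun t => integral_nonneg fun v => sq_nonneg _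
  have d0 : ∀ t, 0 ≤ ∫ v, om v * gradNormSq (besselM (w t)) v := fun t =>
    integral_nonneg fun v => mul_nonneg (om_pos v).le (gradNormSq_nonneg _ v)
  rw [dissT_eq]
  unfold l2T
  rw [← integral_const_mul, ← integral_const_mul, ← integral_add (hd.const_mul _) (hl.const_mul _), ← integral_neg]
  have hpt : ∀ t ∈ Ioo (0:ℝ) T, -(∫ v, besselM (w t) v *
          ∑ i, ∑ j, ∑ m, pd i (fun u => LandauA (f t) u j m) v *
            pd m (pd j (pd i (besselM (besselM (w t))))) v) ≤
        ε₀ * (∫ v, om v * gradNormSq (besselM (w t)) v) + (ε₀ + 243 * B ^ 2 / θ) * ∫ v, (besselM (w t) v) ^ 2 := by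
    intro t ht
    have h1 := spatial3 hCS hsob hη0 hθ0 hH hM (hgood t ⟨ht.1.le, ht.2.le.trans hT.2⟩)
      (besselM_dec1 (hCw t ⟨ht.1.le, ht.2.le.trans hTT⟩))
    refine (neg_le_abs _).trans (h1.trans ?_)
    unfold bnd DD
    have hl1 := l0 t
    have hd1 := d0 t
    set d := ∫ v, om v * gradNormSq (besselM (w t)) v
    set l := ∫ v, (besselM (w t) v) ^ 2
    have e1 : 27 * (128 * (hlsC.toReal * (η * (CS + CE)))) ≤ ε₀ / 2 := by
      have : 27 * (128 * (hlsC.toReal * (η * (CS + CE)))) = ε₀ / 2 * ((R - 1) / R) := by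
        rw [hη, show R - 1 = hlsC.toReal * (CS + CE) by rw [hR]; ring]; field_simp; norm_num; ring
      rw [this]
      refine mul_le_of_le_one_right (by positivity) ?_
      rw [div_le_one hR0]; linarith
    have e2 : 27 * (θ * CE) = ε₀ / 2 := by rw [hθ]; field_simp; norm_num
    have e3 := mul_le_mul_of_nonneg_right e1 (add_nonneg hd1 hl1)
    have e4 : 27 * (θ * CE) * (d + l) = ε₀ / 2 * (d + l) := by rw [e2]
    have e5 : 27 * (9 * B ^ 2 / θ * l) = 243 * B ^ 2 / θ * l := by ring
    linarith
  by_cases hI : IntegrableOn (fun t => -(∫ v, besselM (w t) v *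
          ∑ i, ∑ j, ∑ m, pd i (fun u => LandauA (f t) u j m) v *
            pd m (pd j (pd i (besselM (besselM (w t))))) v)) (Ioo 0 T)
  · exact setIntegral_mono_on hI ((hd.const_mul _).add (hl.const_mul _)) measurableSet_Ioo hpt
  · rw [integral_undef hI]
    refine integral_nonneg fun t => ?_
    have hl1 := l0 t
    have hd1 := d0 t
    simp only [Pi.zero_apply]
    positivity
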